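/- Let K be an algebraically closed field of characteristic zero and (X, φ) a rational dynamical system over K, i.e. X is an algebraic variety over K and φ : X → X a dominant rational self-map. If (X, φ) has infinitely many totally invariant hypersurfaces, i.e. hypersurfaces H with φ*H = H, then there exists g ∈ K(X) \ K such that g∘φ = g. -/

import Mathlib

/-!
# Cantat's theorem on rational dynamical systems (Corollary 1.3)

The algebraic variety `X` over an algebraically closed field `K` of characteristic zero is
modelled by an (affine model with) coordinate ring `R`: a finitely generated `K`-algebra
which is an integral domain.  A dominant rational self-map `φ : X → X` is regular on a
dense open subset `V ⊆ X`; `V` is modelled by a finitely generated `K`-algebra domain `S`,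
where the inclusion `V ⊆ X` is modelled by an injective `K`-algebra map `j : R → S` that is
birational (every element of `S` is a fraction of elements of `j(R)`), and `φ|_V : V → X` is
modelled by an injective `K`-algebra map `f : R → S`.

A hypersurface `H = V(I)` on `X` is totally invariant (`φ*H = H`) when the proper transform
of `I` along `f` agrees with its proper transform along the inclusion `j` (the latter being
`H ∩ V`).  A preserved nonconstant rational function `g = a/b ∈ K(X) \ K` with `g∘φ = g` is
expressed denominator-freely by `f(a)·j(b) = j(a)·f(b)`.
-/

/-- A prime ideal `P` of a commutative ring has height one. -/
def HeightOnePrime {R : Type*} [CommRing R] (P : Ideal R) : Prop :=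
  P.IsPrime ∧ P ≠ ⊥ ∧ ∀ Q : Ideal R, Q.IsPrime → Q < P → Q = ⊥

/-- `I` is the radical vanishing ideal of a nonempty Zariski closed subset of pure
codimension one. -/
def IsHypersurfaceIdeal {R : Type*} [CommRing R] (I : Ideal R) : Prop :=
  I.IsRadical ∧ I ≠ ⊤ ∧ ∀ P ∈ I.minimalPrimes, HeightOnePrime P

/-- The vanishing ideal of the proper transform of `V(I)` along the dominant map induced
by `f`. -/
def properTransform {R S : Type*} [CommRing R] [CommRing S] (f : R →+* S) (I : Ideal R) :
    Ideal S :=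
  sInf {Q : Ideal S | Q ∈ (I.map f).minimalPrimes ∧ Q.comap f ∈ I.minimalPrimes}

section Residue

open Polynomial

variable {A Ω : Type*} [CommRing A] [Field Ω]

/-- A value is in the maximal ideal iff its residue vanishes. -/
lemma ValuationSubring.residue_eq_zero_iff' (V : ValuationSubring Ω) (x : V) :
    IsLocalRing.residue V x = 0 ↔ V.valuation (x : Ω) < 1 := by
  rw [IsLocalRing.residue_eq_zero_iff, ValuationSubring.valuation_lt_one_iff]

lemma ValuationSubring.mem_of_isIntegral_eval₂ (V : ValuationSubring Ω) (ψ : A →+* Ω)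
    (hψ : ∀ a, ψ a ∈ V) {f : A[X]} (hf : f.Monic) {z : Ω} (hz : eval₂ ψ z f = 0) : z ∈ V := by
  let ψV : A →+* V := ψ.codRestrict V.toSubring hψ
  have h : IsIntegral V z := by
    refine ⟨f.map ψV, hf.map _, ?_⟩
    rw [eval₂_map]
    exact hz
  obtain ⟨w, hw⟩ := IsIntegrallyClosed.isIntegral_iff.mp h
  rw [← hw]; exact w.2

lemma ValuationSubring.eval₂_mem (V : ValuationSubring Ω) (ψ : A →+* Ω)
    (hψ : ∀ a, ψ a ∈ V) {z : Ω} (hz : z ∈ V) (h : A[X]) : eval₂ ψ z h ∈ V := by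
  rw [eval₂_eq_sum_range]
  exact sum_mem fun i _ => V.mul_mem _ _ (hψ _) (pow_mem hz _)

/-- The reduction of a ring map into a valuation ring. -/
noncomputable def resHom (V : ValuationSubring Ω) (ψ : A →+* Ω) (hψ : ∀ a, ψ a ∈ V) :
    A →+* IsLocalRing.ResidueField V :=
  (IsLocalRing.residue V).comp (ψ.codRestrict V.toSubring hψ)

lemma resHom_eq_zero_iff (V : ValuationSubring Ω) (ψ : A →+* Ω) (hψ : ∀ a, ψ a ∈ V) (a : A) :
    resHom V ψ hψ a = 0 ↔ V.valuation (ψ a) < 1 :=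
  V.residue_eq_zero_iff' _

lemma residue_eval₂ (V : ValuationSubring Ω) (ψ : A →+* Ω) (hψ : ∀ a, ψ a ∈ V) {z : Ω}
    (hz : z ∈ V) (h : A[X]) :
    eval₂ (resHom V ψ hψ) (IsLocalRing.residue V ⟨z, hz⟩) h =
      IsLocalRing.residue V ⟨eval₂ ψ z h, V.eval₂_mem ψ hψ hz h⟩ := by
  unfold resHom
  rw [← hom_eval₂]
  congr 1
  apply Subtype.ext
  have := hom_eval₂ h (ψ.codRestrict V.toSubring hψ) (V.subtype) (⟨z, hz⟩ : V)
  exact this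

lemma eval₂_resHom_eq_zero_iff (V : ValuationSubring Ω) (ψ : A →+* Ω) (hψ : ∀ a, ψ a ∈ V) {z : Ω}
    (hz : z ∈ V) (h : A[X]) :
    eval₂ (resHom V ψ hψ) (IsLocalRing.residue V ⟨z, hz⟩) h = 0 ↔
      V.valuation (eval₂ ψ z h) < 1 := by
  rw [residue_eval₂, V.residue_eq_zero_iff']

end Residue

section Factor

open Polynomial

/-- A simple root of a monic polynomial splits off its minimal polynomial with a cofactor
nonvanishing at the root. -/
lemma exists_factor_of_simple_root {κ E : Type*} [Field κ] [Field E] (i : κ →+* E) (z : E)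
    (f : κ[X]) (hf : f.Monic) (hz : eval₂ i z f = 0) (hz' : eval₂ i z (derivative f) ≠ 0) :
    ∃ f₁ f₂ : κ[X], f₁.Monic ∧ f₂.Monic ∧ f = f₁ * f₂ ∧
      (∀ h : κ[X], eval₂ i z h = 0 ↔ f₁ ∣ h) ∧ eval₂ i z f₂ ≠ 0 := by
  let _ := i.toAlgebra
  have h_int : IsIntegral κ z := ⟨f, hf, hz⟩
  have key : ∀ h : κ[X], eval₂ i z h = 0 ↔ minpoly κ z ∣ h := fun h =>
    (minpoly.dvd_iff (A := κ) (x := z) (p := h)).symm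
  obtain ⟨f₂, h₂⟩ := (key f).mp hz
  refine ⟨minpoly κ z, f₂, minpoly.monic h_int, ?_, h₂, key, fun h0 => hz' ?_⟩
  · exact (minpoly.monic h_int).of_mul_monic_left (h₂ ▸ hf)
  · rw [h₂, derivative_mul, eval₂_add, eval₂_mul, eval₂_mul, h0, (key _).mpr dvd_rfl]
    simp

end Factor

section Kap

open Polynomial

variable {A : Type*} [CommRing A]

instance {p : A} [hp : Fact (Prime p)] : (Ideal.span {p}).IsPrime :=
  (Ideal.span_singleton_prime hp.out.ne_zero).mpr hp.out

/-- The residue field of a prime element. -/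
abbrev Kap (p : A) [Fact (Prime p)] : Type _ := FractionRing (A ⧸ Ideal.span {p})

/-- The reduction modulo a prime element. -/
noncomputable def toKap (p : A) [Fact (Prime p)] : A →+* Kap p :=
  (algebraMap (A ⧸ Ideal.span {p}) (Kap p)).comp (Ideal.Quotient.mk _)

lemma toKap_eq_zero_iff (p : A) [Fact (Prime p)] (a : A) : toKap p a = 0 ↔ p ∣ a := by
  simp only [toKap, RingHom.comp_apply]
  rw [FaithfulSMul.algebraMap_eq_zero_iff, Ideal.Quotient.eq_zero_iff_mem,
    Ideal.mem_span_singleton]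

lemma Kap.exists_mul (p : A) [Fact (Prime p)] (c : Kap p) :
    ∃ a b : A, ¬ p ∣ b ∧ c * toKap p b = toKap p a := by
  obtain ⟨⟨a, b⟩, h⟩ := IsLocalization.surj (nonZeroDivisors (A ⧸ Ideal.span {p})) c
  obtain ⟨a, rfl⟩ := Ideal.Quotient.mk_surjective a
  obtain ⟨b, hb⟩ := b
  obtain ⟨b, rfl⟩ := Ideal.Quotient.mk_surjective b
  refine ⟨a, b, fun hpb => ?_, h⟩
  rw [← Ideal.mem_span_singleton, ← Ideal.Quotient.eq_zero_iff_mem] at hpb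
  rw [hpb] at hb
  exact zero_notMem_nonZeroDivisors hb

/-- Extension to the residue field of a map with kernel generated by `p`. -/
noncomputable def kapLift {E : Type*} [Field E] (p : A) [Fact (Prime p)] (ψ : A →+* E)
    (h : ∀ a, ψ a = 0 ↔ p ∣ a) : Kap p →+* E :=
  IsFractionRing.lift (A := A ⧸ Ideal.span {p}) (K := Kap p) (L := E)
    (g := Ideal.Quotient.lift (Ideal.span {p}) ψ
      (fun a ha => (h a).mpr (Ideal.mem_span_singleton.mp ha)))
    (by
      rw [injective_iff_map_eq_zero]
      intro a ha
      obtain ⟨a, rfl⟩ := Ideal.Quotient.mk_surjective a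
      rw [Ideal.Quotient.lift_mk] at ha
      rw [Ideal.Quotient.eq_zero_iff_mem, Ideal.mem_span_singleton]
      exact (h a).mp ha)

lemma kapLift_toKap {E : Type*} [Field E] (p : A) [Fact (Prime p)] (ψ : A →+* E)
    (h : ∀ a, ψ a = 0 ↔ p ∣ a) (a : A) : kapLift p ψ h (toKap p a) = ψ a := by
  simp only [kapLift, toKap, RingHom.comp_apply, IsFractionRing.lift_algebraMap,
    Ideal.Quotient.lift_mk]

lemma kapLift_comp {E : Type*} [Field E] (p : A) [Fact (Prime p)] (ψ : A →+* E)
    (h : ∀ a, ψ a = 0 ↔ p ∣ a) : (kapLift p ψ h).comp (toKap p) = ψ :=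
  RingHom.ext (kapLift_toKap p ψ h)

lemma Kap.exists_poly_mul (p : A) [Fact (Prime p)] (c : (Kap p)[X]) :
    ∃ (F : A[X]) (b : A), ¬ p ∣ b ∧ c * C (toKap p b) = F.map (toKap p) := by
  have hp : Prime p := Fact.out
  induction c using Polynomial.induction_on' with
  | add c d hc hd =>
    obtain ⟨F, b, hb, h⟩ := hc
    obtain ⟨G, b', hb', h'⟩ := hd
    refine ⟨F * C b' + G * C b, b * b', fun H => (hp.dvd_or_dvd H).elim hb hb', ?_⟩
    simp only [Polynomial.map_add, Polynomial.map_mul, Polynomial.map_C, ← h, ← h', map_mul]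
    ring
  | monomial n c =>
    obtain ⟨a, b, hb, h⟩ := Kap.exists_mul p c
    refine ⟨monomial n a, b, hb, ?_⟩
    rw [Polynomial.map_monomial, ← h, monomial_mul_C]

lemma toKap_map_dvd (p : A) [Fact (Prime p)] {f h : A[X]} (hf : f.Monic)
    (hd : f.map (toKap p) ∣ h.map (toKap p)) : ∃ q r : A[X], h = f * q + C p * r := by
  unfold toKap at hd
  rw [← Polynomial.map_map, ← Polynomial.map_map,
    Polynomial.map_dvd_map _ (FaithfulSMul.algebraMap_injective _ _) (hf.map _)] at hd
  obtain ⟨q, hq⟩ := hd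
  obtain ⟨q, rfl⟩ := Polynomial.map_surjective _ (Ideal.Quotient.mk_surjective) q
  rw [← Polynomial.map_mul, ← sub_eq_zero, ← Polynomial.map_sub] at hq
  have : C p ∣ h - f * q := by
    rw [C_dvd_iff_dvd_coeff]
    intro i
    rw [← Ideal.mem_span_singleton, ← Ideal.Quotient.eq_zero_iff_mem, ← coeff_map, hq, coeff_zero]
  obtain ⟨r, hr⟩ := this
  exact ⟨q, r, by rw [← hr]; ring⟩

end Kap

section Good

open Polynomial

variable {A F : Type*} [CommRing A] [Field F] [Algebra A F]

/-- An integral generator of the field `F` over `A`, with a separable equation. -/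
structure PrimElt (A F : Type*) [CommRing A] [Field F] [Algebra A F] where
  y : F
  f : A[X]
  monic : f.Monic
  root : aeval y f = 0
  sep : aeval y (derivative f) ≠ 0
  gen : ∀ g : F, ∃ (h : A[X]) (a : A), a ≠ 0 ∧ g * algebraMap A F a = aeval y h

namespace PrimElt

variable (E : PrimElt A F)

/-- Valuation rings unramified over a prime element of `A`. -/
structure IsGood (O : ValuationSubring F) (p : A) : Prop where
  prime : Prime p
  mem : ∀ a, algebraMap A F a ∈ O
  lt_one : ∀ a, O.valuation (algebraMap A F a) < 1 ↔ p ∣ a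
  unit : O.valuation (aeval E.y (derivative E.f)) = 1

namespace IsGood

variable {E} {O : ValuationSubring F} {p : A} (hO : E.IsGood O p)
include hO

lemma y_mem : E.y ∈ O :=
  O.mem_of_isIntegral_eval₂ (algebraMap A F) hO.mem E.monic E.root

lemma aeval_mem (h : A[X]) : aeval E.y h ∈ O :=
  O.eval₂_mem (algebraMap A F) hO.mem hO.y_mem h

lemma algebraMap_eq_one {a : A} (ha : ¬ p ∣ a) : O.valuation (algebraMap A F a) = 1 :=
  le_antisymm ((O.valuation_le_one_iff _).mpr (hO.mem a))
    (not_lt.mp fun h => ha ((hO.lt_one a).mp h))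

lemma p_lt_one : O.valuation (algebraMap A F p) < 1 := (hO.lt_one p).mpr dvd_rfl

lemma exists_factor [Fact (Prime p)] : ∃ f₁ f₂ : (Kap p)[X], f₁.Monic ∧ f₂.Monic ∧
    E.f.map (toKap p) = f₁ * f₂ ∧
    (∀ h : (Kap p)[X], eval₂ (kapLift p (resHom O (algebraMap A F) hO.mem)
      fun a => (resHom_eq_zero_iff _ _ _ a).trans (hO.lt_one a))
        (IsLocalRing.residue O ⟨E.y, hO.y_mem⟩) h = 0 ↔ f₁ ∣ h) ∧
    eval₂ (kapLift p (resHom O (algebraMap A F) hO.mem)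
      fun a => (resHom_eq_zero_iff _ _ _ a).trans (hO.lt_one a))
        (IsLocalRing.residue O ⟨E.y, hO.y_mem⟩) f₂ ≠ 0 := by
  apply exists_factor_of_simple_root _ _ _ (E.monic.map _)
  · rw [eval₂_map, kapLift_comp, eval₂_resHom_eq_zero_iff]
    rw [show eval₂ (algebraMap A F) E.y E.f = 0 from E.root]
    simp
  · rw [derivative_map, eval₂_map, kapLift_comp, ne_eq, eval₂_resHom_eq_zero_iff]
    exact fun h => absurd hO.unit h.ne

lemma exists_cofactor : ∃ b : A[X], O.valuation (aeval E.y b) = 1 ∧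
    ∀ h : A[X], O.valuation (aeval E.y h) < 1 →
      ∃ w : A[X], aeval E.y b * aeval E.y h = algebraMap A F p * aeval E.y w := by
  have : Fact (Prime p) := ⟨hO.prime⟩
  obtain ⟨f₁, f₂, -, -, hf, hdvd, hf₂⟩ := hO.exists_factor
  obtain ⟨b, c, hc, hb⟩ := Kap.exists_poly_mul p f₂
  refine ⟨b, ?_, ?_⟩
  · refine le_antisymm ((O.valuation_le_one_iff _).mpr (hO.aeval_mem b)) (not_lt.mp fun h => ?_)
    change O.valuation (eval₂ (algebraMap A F) E.y b) < 1 at h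
    rw [← eval₂_resHom_eq_zero_iff O _ hO.mem hO.y_mem, ← kapLift_comp p
      (resHom O (algebraMap A F) hO.mem)
      fun a => (resHom_eq_zero_iff _ _ _ a).trans (hO.lt_one a),
      ← eval₂_map, ← hb, eval₂_mul, eval₂_C, mul_eq_zero] at h
    refine h.elim hf₂ fun h => hc ?_
    rwa [map_eq_zero, toKap_eq_zero_iff] at h
  · intro h hh
    change O.valuation (eval₂ (algebraMap A F) E.y h) < 1 at hh
    rw [← eval₂_resHom_eq_zero_iff O _ hO.mem hO.y_mem, ← kapLift_comp p
      (resHom O (algebraMap A F) hO.mem)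
      fun a => (resHom_eq_zero_iff _ _ _ a).trans (hO.lt_one a),
      ← eval₂_map, hdvd] at hh
    have : E.f.map (toKap p) ∣ (b * h).map (toKap p) := by
      rw [Polynomial.map_mul, ← hb, hf, mul_comm f₁, mul_assoc]
      exact mul_dvd_mul_left _ (hh.mul_left _)
    obtain ⟨q, r, hqr⟩ := toKap_map_dvd p E.monic this
    refine ⟨r, ?_⟩
    rw [← map_mul, hqr, map_add, map_mul, E.root, zero_mul, zero_add, map_mul, aeval_C]

lemma exists_pow_aux (b : A[X]) (hb1 : O.valuation (aeval E.y b) = 1)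
    (hb : ∀ h : A[X], O.valuation (aeval E.y h) < 1 →
      ∃ w : A[X], aeval E.y b * aeval E.y h = algebraMap A F p * aeval E.y w)
    (hp0 : algebraMap A F p ≠ 0) (e : ℕ) : ∀ (h : A[X]) (z s : F), z ∈ O → O.valuation s = 1 →
      aeval E.y h * z = algebraMap A F p ^ e * s →
      ∃ (i N : ℕ) (h₁ : A[X]), O.valuation (aeval E.y h₁) = 1 ∧
        aeval E.y b ^ N * aeval E.y h = algebraMap A F p ^ i * aeval E.y h₁ := by
  induction e with
  | zero =>
    intro h z s hz hs e
    refine ⟨0, 0, h, le_antisymm ((O.valuation_le_one_iff _).mpr (hO.aeval_mem h)) ?_, by simp⟩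
    have := congrArg O.valuation e
    rw [map_mul, pow_zero, one_mul, hs] at this
    rw [← this]
    exact mul_le_of_le_one_right' ((O.valuation_le_one_iff _).mpr hz)
  | succ e ih =>
    intro h z s hz hs he
    by_cases hh : O.valuation (aeval E.y h) < 1
    · obtain ⟨w, hw⟩ := hb h hh
      obtain ⟨i, N, h₁, hh₁, hN⟩ := ih w z (aeval E.y b * s) hz (by rw [map_mul, hb1, hs, one_mul])
        (by
          apply mul_left_cancel₀ hp0
          rw [← mul_assoc, ← hw, mul_assoc, he]; ring)
      refine ⟨i + 1, N + 1, h₁, hh₁, ?_⟩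
      rw [pow_succ, mul_assoc, hw, mul_left_comm, hN]; ring
    · exact ⟨0, 0, h, le_antisymm ((O.valuation_le_one_iff _).mpr (hO.aeval_mem h)) (not_lt.mp hh),
        by simp⟩

variable [IsDomain A] [UniqueFactorizationMonoid A] [FaithfulSMul A F]

omit [IsDomain A] [UniqueFactorizationMonoid A] in
lemma p_ne_zero : algebraMap A F p ≠ 0 := by
  rw [ne_eq, FaithfulSMul.algebraMap_eq_zero_iff]; exact hO.prime.ne_zero

lemma exists_pow_poly (h : A[X]) (h0 : aeval E.y h ≠ 0) :
    ∃ (i : ℕ) (h₁ b : A[X]), O.valuation (aeval E.y h₁) = 1 ∧ O.valuation (aeval E.y b) = 1 ∧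
        aeval E.y h * aeval E.y b = algebraMap A F p ^ i * aeval E.y h₁ := by
  obtain ⟨b, hb1, hb⟩ := hO.exists_cofactor
  obtain ⟨h', a, ha, hh'⟩ := E.gen (aeval E.y h)⁻¹
  obtain ⟨e, c, hc, rfl⟩ := WfDvdMonoid.max_power_factor ha hO.prime.irreducible
  obtain ⟨i, N, h₁, hh₁, hN⟩ := hO.exists_pow_aux b hb1 hb hO.p_ne_zero e h (aeval E.y h')
    (algebraMap A F c) (hO.aeval_mem h') (hO.algebraMap_eq_one hc) (by
      rw [← hh', mul_inv_cancel_left₀ h0, map_mul, map_pow])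
  refine ⟨i, h₁, b ^ N, hh₁, by rw [map_pow, map_pow, hb1, one_pow], ?_⟩
  rw [← hN, map_pow, mul_comm]

lemma exists_pow {g : F} (g0 : g ≠ 0) :
    ∃ (m : ℤ) (h b : A[X]), O.valuation (aeval E.y h) = 1 ∧ O.valuation (aeval E.y b) = 1 ∧
        g * aeval E.y b = algebraMap A F p ^ m * aeval E.y h := by
  obtain ⟨h, a, ha, hh⟩ := E.gen g
  obtain ⟨e, c, hc, rfl⟩ := WfDvdMonoid.max_power_factor ha hO.prime.irreducible
  have ha' := (FaithfulSMul.algebraMap_eq_zero_iff A F).not.mpr ha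
  obtain ⟨i, h₁, b, hh₁, hb, e1⟩ := hO.exists_pow_poly h (by rw [← hh]; exact mul_ne_zero g0 ha')
  refine ⟨i - e, h₁, b * C c, hh₁, ?_, ?_⟩
  · rw [map_mul, map_mul, aeval_C, hb, hO.algebraMap_eq_one hc, one_mul]
  · have hp := hO.p_ne_zero
    have hpe : algebraMap A F p ^ e ≠ 0 := pow_ne_zero _ hp
    rw [zpow_sub₀ hp, zpow_natCast, zpow_natCast, map_mul, aeval_C, div_mul_eq_mul_div,
      eq_div_iff hpe, ← e1, ← hh, map_mul, map_pow]
    ring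

omit [IsDomain A] [UniqueFactorizationMonoid A] in
lemma zpow_le_one_iff {m : ℤ} : O.valuation (algebraMap A F p ^ m) ≤ 1 ↔ 0 ≤ m := by
  have hp := (Valuation.ne_zero_iff O.valuation).mpr hO.p_ne_zero
  rw [map_zpow₀]
  constructor
  · intro h
    by_contra! hm
    have := one_lt_zpow_of_neg₀ (zero_lt_iff.mpr hp) hO.p_lt_one hm
    exact absurd h (not_le.mpr this)
  · intro h
    exact zpow_le_one₀ (zero_lt_iff.mpr hp) hO.p_lt_one.le h

lemma exists_pow_of_mem {g : F} (g0 : g ≠ 0) (hg : g ∈ O) :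
    ∃ (i : ℕ) (h b : A[X]), O.valuation (aeval E.y h) = 1 ∧ O.valuation (aeval E.y b) = 1 ∧
        g * aeval E.y b = algebraMap A F p ^ i * aeval E.y h := by
  obtain ⟨m, h, b, hh, hb, e⟩ := hO.exists_pow g0
  have := congrArg O.valuation e
  rw [map_mul, hb, mul_one, map_mul, hh, mul_one] at this
  have hm : 0 ≤ m := by
    rw [← hO.zpow_le_one_iff, ← this]; exact (O.valuation_le_one_iff _).mpr hg
  lift m to ℕ using hm
  exact ⟨m, h, b, hh, hb, by rw [e, zpow_natCast]⟩

/-- Elements of a good valuation ring are fractions of polynomials in the generator. -/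
lemma exists_frac {g : F} (hg : g ∈ O) :
    ∃ h b : A[X], O.valuation (aeval E.y b) = 1 ∧ g * aeval E.y b = aeval E.y h := by
  by_cases g0 : g = 0
  · exact ⟨0, 1, by simp, by simp [g0]⟩
  · obtain ⟨i, h, b, -, hb, e⟩ := hO.exists_pow_of_mem g0 hg
    exact ⟨C (p ^ i) * h, b, hb, by rw [e, map_mul, aeval_C, map_pow]⟩

/-- The prime element generates the maximal ideal. -/
lemma div_mem {g : F} (hg : O.valuation g < 1) : g / algebraMap A F p ∈ O := by
  by_cases g0 : g = 0
  · rw [g0, zero_div]; exact O.zero_mem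
  obtain ⟨i, h, b, hh, hb, e⟩ := hO.exists_pow_of_mem g0 ((O.valuation_le_one_iff _).mp hg.le)
  have h1 := congrArg O.valuation e
  rw [map_mul, hb, mul_one, map_mul, hh, mul_one] at h1
  obtain _ | i := i
  · rw [pow_zero, map_one] at h1; exact absurd hg (by rw [h1]; exact lt_irrefl _)
  · have hp := (Valuation.ne_zero_iff O.valuation).mpr hO.p_ne_zero
    rw [← O.valuation_le_one_iff, map_div₀, h1, map_pow, pow_succ, mul_div_assoc, div_self hp,
      mul_one]
    exact pow_le_one' hO.p_lt_one.le _

lemma exists_eq_pow_mul_unit {g : F} (g0 : g ≠ 0) (hg : g ∈ O) :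
    ∃ (i : ℕ) (u : F), O.valuation u = 1 ∧ g = algebraMap A F p ^ i * u := by
  obtain ⟨i, h, b, hh, hb, e⟩ := hO.exists_pow_of_mem g0 hg
  have hb0 : aeval E.y b ≠ 0 := by
    intro h0; rw [h0, map_zero] at hb; exact zero_ne_one hb
  refine ⟨i, aeval E.y h / aeval E.y b, by rw [map_div₀, hh, hb, div_one], ?_⟩
  rw [← mul_div_assoc, ← e, mul_div_cancel_right₀ _ hb0]

/-- Good places are determined by their centers. -/
lemma eq_of_center {O' : ValuationSubring F} {p' : A} (hO' : E.IsGood O' p')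
    (h : ∀ a : A[X], O.valuation (aeval E.y a) < 1 ↔ O'.valuation (aeval E.y a) < 1) : O = O' := by
  have key : ∀ {O O' : ValuationSubring F} {p p' : A}, E.IsGood O p → E.IsGood O' p' →
      (∀ a : A[X], O.valuation (aeval E.y a) < 1 ↔ O'.valuation (aeval E.y a) < 1) → O ≤ O' := by
    intro O O' p p' hO hO' h g hg
    obtain ⟨a, b, hb, e⟩ := hO.exists_frac hg
    have hb' : O'.valuation (aeval E.y b) = 1 := by
      refine le_antisymm ((O'.valuation_le_one_iff _).mpr (hO'.aeval_mem b))
        (not_lt.mp fun hlt => ?_)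
      rw [← h, hb] at hlt
      exact lt_irrefl _ hlt
    have := congrArg O'.valuation e
    rw [map_mul, hb', mul_one] at this
    rw [← O'.valuation_le_one_iff, this, O'.valuation_le_one_iff]
    exact hO'.aeval_mem a
  exact le_antisymm (key hO hO' h) (key hO' hO fun a => (h a).symm)

omit [IsDomain A] [UniqueFactorizationMonoid A] in
lemma ne_top : O ≠ ⊤ := by
  rintro rfl
  have h1 : (algebraMap A F p)⁻¹ ∈ (⊤ : ValuationSubring F) := ValuationSubring.mem_top _
  rw [← ValuationSubring.valuation_le_one_iff, map_inv₀] at h1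
  have hp := (Valuation.ne_zero_iff (⊤ : ValuationSubring F).valuation).mpr hO.p_ne_zero
  have := one_lt_inv₀ (zero_lt_iff.mpr hp) |>.mpr hO.p_lt_one
  exact absurd h1 (not_le.mpr this)

/-- The center of a good place on a birational subring has no smaller nonzero primes. -/
lemma eq_bot_of_lt_center (B : Subring F)
    (hB : ∀ x ∈ B, x ∈ O) (hfrac : ∀ g ∈ O, ∃ b ∈ B, O.valuation b = 1 ∧ b * g ∈ B)
    (N : Ideal B) [N.IsPrime] (hN : ∀ x ∈ N, O.valuation (x : F) < 1) (hN0 : N ≠ ⊥) :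
    ∀ x : B, O.valuation (x : F) < 1 → x ∈ N := by
  intro b hb
  obtain ⟨z, hz, hz0⟩ := Submodule.exists_mem_ne_zero_of_ne_bot hN0
  have hz0' : (z : F) ≠ 0 := fun h => hz0 (Subtype.ext h)
  obtain ⟨i, u, hu, e⟩ := hO.exists_eq_pow_mul_unit hz0' (hB _ z.2)
  have hu0 : u ≠ 0 := by
    intro h0; rw [h0, map_zero] at hu; exact zero_ne_one hu
  have hp := hO.p_ne_zero
  have hg : (b : F) ^ i / z ∈ O := by
    rw [e, ← div_div, ← div_pow]
    rw [← O.valuation_le_one_iff, map_div₀, hu, div_one, O.valuation_le_one_iff]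
    exact pow_mem (hO.div_mem hb) _
  obtain ⟨s, hs, hs1, hsg⟩ := hfrac _ hg
  have hmem : (⟨s, hs⟩ : B) * b ^ i ∈ N := by
    have : (⟨s, hs⟩ : B) * b ^ i = ⟨_, hsg⟩ * z := by
      apply Subtype.ext
      simp only [Subring.coe_mul, SubmonoidClass.coe_pow]
      field_simp
    rw [this]
    exact N.mul_mem_left _ hz
  rcases Ideal.IsPrime.mem_or_mem ‹_› hmem with h | h
  · have := hN _ h
    rw [hs1] at this
    exact absurd this (lt_irrefl _)
  · exact Ideal.IsPrime.mem_of_pow_mem ‹_› _ h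

end IsGood

end PrimElt

end Good

section GoingDown

open Polynomial

variable {A B : Type*} [CommRing A] [IsDomain A] [UniqueFactorizationMonoid A]
  [CommRing B] [IsDomain B] [Algebra A B] [FaithfulSMul A B] [Algebra.IsIntegral A B]

omit [UniqueFactorizationMonoid A] in
lemma minpoly_algebraMap_mul [IsIntegrallyClosed A] {a : A} (ha : a ≠ 0) (b : B) :
    minpoly A (algebraMap A B a * b) = scaleRoots (minpoly A b) a := by
  have hb : IsIntegral A b := Algebra.IsIntegral.isIntegral b
  have hab : IsIntegral A (algebraMap A B a * b) := Algebra.IsIntegral.isIntegral _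
  have hroot : aeval (algebraMap A B a * b) (scaleRoots (minpoly A b) a) = 0 :=
    scaleRoots_aeval_eq_zero (minpoly.aeval A b)
  have hm : (scaleRoots (minpoly A b) a).Monic :=
    (monic_scaleRoots_iff a).mpr (minpoly.monic hb)
  have hinj : Function.Injective (fun x : A => a * x) := fun x y h => mul_left_cancel₀ ha h
  have hne : (minpoly A (algebraMap A B a * b)).comp (C a * X) ≠ 0 := by
    intro h
    rw [comp_C_mul_X_eq_zero_iff] at h
    · exact minpoly.ne_zero hab h
    · exact mem_nonZeroDivisors_of_ne_zero ha
  have hdeg : (minpoly A b).natDegree ≤ (minpoly A (algebraMap A B a * b)).natDegree := by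
    refine (natDegree_le_natDegree
      (minpoly.IsIntegrallyClosed.degree_le_of_ne_zero (s := b) hne ?_)).trans ?_
    · rw [aeval_comp, map_mul, aeval_C, aeval_X, minpoly.aeval]
    · refine natDegree_comp_le.trans ?_
      exact (Nat.mul_le_mul_left _ ((natDegree_C_mul_le a X).trans natDegree_X_le)).trans
        (mul_one _).le
  refine (eq_of_monic_of_dvd_of_natDegree_le (minpoly.monic hab) hm
    (minpoly.isIntegrallyClosed_dvd hab hroot) ?_).symm
  rw [natDegree_scaleRoots]
  exact hdeg

/-- Going down: a height one prime of an integral extension lies over a principal prime. -/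
lemma dvd_of_algebraMap_mem {p : A} (hp : Prime p) (P : Ideal B) [P.IsPrime]
    (hP : ∀ N : Ideal B, N.IsPrime → N ≠ ⊥ → N ≤ P → N = P)
    (hpP : algebraMap A B p ∈ P) (a : A) (ha : algebraMap A B a ∈ P) : p ∣ a := by
  let M : Submonoid B :=
    { carrier := {x | ∃ (a : A) (b : B), ¬ p ∣ a ∧ b ∉ P ∧ x = algebraMap A B a * b}
      one_mem' := ⟨1, 1, hp.not_dvd_one, fun h => Ideal.IsPrime.ne_top ‹_›
        ((Ideal.eq_top_iff_one _).mpr h), by simp⟩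
      mul_mem' := by
        rintro _ _ ⟨a, b, ha, hb, rfl⟩ ⟨a', b', ha', hb', rfl⟩
        refine ⟨a * a', b * b', fun h => (hp.dvd_or_dvd h).elim ha ha',
          fun h => (Ideal.IsPrime.mem_or_mem ‹_› h).elim hb hb', ?_⟩
        rw [map_mul]; ring }
  have hdisj : Disjoint ((Ideal.span {algebraMap A B p} : Ideal B) : Set B) (M : Set B) := by
    rw [Set.disjoint_left]
    rintro x hx ⟨a, b, ha, hb, rfl⟩
    obtain ⟨c, hc⟩ := Ideal.mem_span_singleton.mp hx
    have ha0 : a ≠ 0 := fun h => ha (h ▸ dvd_zero p)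
    have e1 := minpoly_algebraMap_mul ha0 b
    have e2 := minpoly_algebraMap_mul hp.ne_zero c
    rw [← hc, e1] at e2
    have hnd : (minpoly A b).natDegree = (minpoly A c).natDegree := by
      have := congrArg natDegree e2
      simpa only [natDegree_scaleRoots] using this
    have h_int : IsIntegral A b := Algebra.IsIntegral.isIntegral b
    have hcoeff : ∀ i < (minpoly A b).natDegree, p ∣ (minpoly A b).coeff i := by
      intro i hi
      have := congrArg (fun q => coeff q i) e2
      simp only [coeff_scaleRoots] at this
      have hd : p ∣ (minpoly A b).coeff i * a ^ ((minpoly A b).natDegree - i) := by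
        rw [this, ← hnd]
        exact Dvd.dvd.mul_left (dvd_pow_self p (by omega)) _
      rcases hp.dvd_or_dvd hd with h | h
      · exact h
      · exact absurd (hp.dvd_of_dvd_pow h) ha
    have hz := minpoly.aeval A b
    rw [aeval_eq_sum_range, Finset.sum_range_succ, (minpoly.monic h_int).coeff_natDegree,
      one_smul] at hz
    apply hb
    apply Ideal.IsPrime.mem_of_pow_mem ‹P.IsPrime› (minpoly A b).natDegree
    rw [eq_neg_of_add_eq_zero_right hz]
    refine neg_mem (sum_mem fun i hi => ?_)
    obtain ⟨d, hd⟩ := hcoeff i (Finset.mem_range.mp hi)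
    rw [hd, Algebra.smul_def, map_mul, mul_assoc]
    exact P.mul_mem_right _ hpP
  obtain ⟨P₀, hP₀, hle, hd⟩ := Ideal.exists_le_prime_disjoint _ M hdisj
  have hle' : P₀ ≤ P := by
    intro x hx
    by_contra hxP
    exact Set.disjoint_left.mp hd hx ⟨1, x, hp.not_dvd_one, hxP, by simp⟩
  have hP₀p : algebraMap A B p ∈ P₀ := hle (Ideal.mem_span_singleton_self _)
  have hne : P₀ ≠ ⊥ := by
    rintro rfl
    rw [Ideal.mem_bot, FaithfulSMul.algebraMap_eq_zero_iff] at hP₀p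
    exact hp.ne_zero hP₀p
  have := hP P₀ hP₀ hne hle'
  subst this
  by_contra hpa
  exact Set.disjoint_left.mp hd ha ⟨a, 1, hpa, fun h => hP₀.ne_top
    ((Ideal.eq_top_iff_one _).mpr h), by simp⟩

end GoingDown

section Bounded

open Polynomial

/-- A derivation with bounded poles along a semilocal base has bounded logarithmic poles. -/
lemma Derivation.exists_logarithmic_bound {D₀ k F : Type*} [CommRing D₀] [IsDomain D₀]
    [IsDiscreteValuationRing D₀] [Field k] [Algebra D₀ k] [IsFractionRing D₀ k] [Field F]
    [Algebra k F] [Algebra D₀ F] [IsScalarTower D₀ k F] [FiniteDimensional k F]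
    [Algebra.IsSeparable k F] (D : Derivation ℤ F F)
    (hD : ∃ c : D₀, c ≠ 0 ∧ ∀ a : D₀, IsIntegral D₀ (c • D (algebraMap D₀ F a))) :
    ∃ c : D₀, c ≠ 0 ∧ ∀ g : F, IsIntegral D₀ (c • (D g / g)) := by
  have hinjF : Function.Injective (algebraMap D₀ F) := by
    rw [IsScalarTower.algebraMap_eq D₀ k F]
    exact (algebraMap k F).injective.comp (IsFractionRing.injective D₀ k)
  have : FaithfulSMul D₀ F := (faithfulSMul_iff_algebraMap_injective _ _).mpr hinjF
  let R := integralClosure D₀ F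
  have : Module.Finite D₀ R := IsIntegralClosure.finite D₀ k F R
  have : IsDedekindDomain R := integralClosure.isDedekindDomain D₀ k F
  have : IsFractionRing R F := IsIntegralClosure.isFractionRing_of_finite_extension D₀ k F R
  have : IsPrincipalIdealRing R := by
    apply IsPrincipalIdealRing.of_finite_maximals
    refine (IsDedekindDomain.primesOver_finite (IsLocalRing.maximalIdeal D₀) R).subset ?_
    intro M hM
    have hM' : M.IsMaximal := hM
    refine ⟨hM'.isPrime, ⟨?_⟩⟩
    exact (IsLocalRing.eq_maximalIdeal
      (Ideal.isMaximal_comap_of_isIntegral_of_isMaximal (R := D₀) M)).symm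
  obtain ⟨c₀, hc₀, hc⟩ := hD
  have smul_alg : ∀ (c : D₀) (x : F), c • x = algebraMap D₀ F c * x := fun c x =>
    Algebra.smul_def c x
  have int_smul : ∀ (c : D₀) {x : F}, IsIntegral D₀ x → IsIntegral D₀ (c • x) :=
    fun c x hx => hx.smul c
  -- uniform bound on the integral closure
  have hR : ∃ c : D₀, c ≠ 0 ∧ ∀ r : R, IsIntegral D₀ (c • D (r : F)) := by
    obtain ⟨s, hs⟩ := Module.Finite.fg_top (R := D₀) (M := R)
    classical
    obtain ⟨c₁, hc₁, h₁⟩ := exists_integral_multiples D₀ k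
      (s.image (fun r : R => D (r : F)))
    refine ⟨c₀ * c₁, mul_ne_zero hc₀ hc₁, fun r => ?_⟩
    have hr : r ∈ Submodule.span D₀ (s : Set R) := hs ▸ Submodule.mem_top
    induction hr using Submodule.span_induction with
    | mem x hx =>
      rw [mul_smul]
      exact int_smul _ (h₁ _ (Finset.mem_image_of_mem _ hx))
    | zero => simpa using isIntegral_zero
    | add x y _ _ hx hy =>
      rw [show ((x + y : R) : F) = x + y from rfl, map_add, smul_add]
      exact hx.add hy
    | smul a x _ hx =>
      have e : ((a • x : R) : F) = algebraMap D₀ F a * x := Algebra.smul_def a (x : F)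
      rw [e, Derivation.leibniz, smul_eq_mul, smul_eq_mul]
      have : (c₀ * c₁) • (algebraMap D₀ F a * D (x : F) + (x : F) * D (algebraMap D₀ F a)) =
          a • ((c₀ * c₁) • D (x : F)) + c₁ • ((x : F) * (c₀ • D (algebraMap D₀ F a))) := by
        simp only [smul_alg, map_mul]; ring
      rw [this]
      exact (int_smul _ hx).add (int_smul _ (x.2.mul (hc a)))
  obtain ⟨c, hc0, hcR⟩ := hR
  obtain ⟨π, hπ⟩ := IsDiscreteValuationRing.exists_irreducible D₀
  have logmul : ∀ x y : F, x ≠ 0 → y ≠ 0 → D (x * y) / (x * y) = D x / x + D y / y := by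
    intro x y hx hy
    rw [Derivation.leibniz, smul_eq_mul, smul_eq_mul]
    field_simp
    ring
  have hRlog : ∀ r : R, r ≠ 0 → IsIntegral D₀ ((c * π) • (D (r : F) / r)) := by
    intro r
    induction r using UniqueFactorizationMonoid.induction_on_prime with
    | h₁ => intro h; exact absurd rfl h
    | h₂ x hx =>
      intro _
      obtain ⟨u, rfl⟩ := hx
      have hu : ((u : R) : F) * ((u⁻¹ : Rˣ) : R) = 1 := by
        rw [← Subalgebra.coe_mul, Units.mul_inv]; rfl
      have : (c * π) • (D ((u : R) : F) / ((u : R) : F)) =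
          π • ((c • D ((u : R) : F)) * (((u⁻¹ : Rˣ) : R) : F)) := by
        rw [div_eq_mul_inv, ← eq_inv_of_mul_eq_one_right hu]
        simp only [smul_alg, map_mul]; ring
      rw [this]
      exact int_smul _ ((hcR _).mul (((u⁻¹ : Rˣ) : R)).2)
    | h₃ a x ha hx ih =>
      intro _
      have hx0 : (x : F) ≠ 0 := fun h => hx.ne_zero (Subtype.ext h)
      have ha0 : (a : F) ≠ 0 := fun h => ha (Subtype.ext h)
      rw [Subalgebra.coe_mul, logmul _ _ hx0 ha0, smul_add]
      refine IsIntegral.add ?_ (ih ha)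
      have hπx : x ∣ algebraMap D₀ R π := by
        have : (Ideal.span {x}).IsPrime := (Ideal.span_singleton_prime hx.ne_zero).mpr hx
        have hmax : (Ideal.span {x}).IsMaximal :=
          Ring.DimensionLEOne.maximalOfPrime (by simpa using hx.ne_zero) inferInstance
        have := IsLocalRing.eq_maximalIdeal
          (Ideal.isMaximal_comap_of_isIntegral_of_isMaximal (R := D₀) (Ideal.span {x}))
        rw [← Ideal.mem_span_singleton, ← Ideal.mem_comap, this]
        exact (IsLocalRing.mem_maximalIdeal _).mpr hπ.not_isUnit
      obtain ⟨w, hw⟩ := hπx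
      have hw' : algebraMap D₀ F π = x * w := congrArg Subtype.val hw
      have : (c * π) • (D (x : F) / x) = (c • D (x : F)) * w := by
        simp only [smul_alg, map_mul, hw']
        field_simp
      rw [this]
      exact (hcR x).mul w.2
  refine ⟨c * π, mul_ne_zero hc0 hπ.ne_zero, fun g => ?_⟩
  by_cases hg : g = 0
  · simpa [hg] using isIntegral_zero
  obtain ⟨a, b, hb, rfl⟩ := IsFractionRing.div_surjective (A := R) g
  have hb0 : b ≠ 0 := nonZeroDivisors.ne_zero hb
  have ha0 : a ≠ 0 := by rintro rfl; simp at hg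
  have hb' : (algebraMap R F b) ≠ 0 := (FaithfulSMul.algebraMap_eq_zero_iff R F).not.mpr hb0
  have ha' : (algebraMap R F a) ≠ 0 := (FaithfulSMul.algebraMap_eq_zero_iff R F).not.mpr ha0
  have := logmul (algebraMap R F a / algebraMap R F b) (algebraMap R F b) hg hb'
  rw [div_mul_cancel₀ _ hb'] at this
  rw [← sub_eq_iff_eq_add.mpr this, smul_sub]
  exact (hRlog a ha0).sub (hRlog b hb0)

end Bounded

section Shift

open Polynomial

variable {K ι : Type*} [Field K]

/-- Translation `x ↦ x + U v` of polynomials. -/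
noncomputable def shift (v : ι → K) : MvPolynomial ι K →ₐ[K] (MvPolynomial ι K)[X] :=
  MvPolynomial.aeval fun i => C (MvPolynomial.X i) + C (MvPolynomial.C (v i)) * X

/-- The derivative in the direction `v`. -/
noncomputable def dirDeriv (v : ι → K) :
    Derivation K (MvPolynomial ι K) (MvPolynomial ι K) :=
  MvPolynomial.mkDerivation K fun i => MvPolynomial.C (v i)

@[simp] lemma shift_X (v : ι → K) (i : ι) :
    shift v (MvPolynomial.X i) = C (MvPolynomial.X i) + C (MvPolynomial.C (v i)) * X := by
  simp [shift]

@[simp] lemma shift_C (v : ι → K) (c : K) : shift v (MvPolynomial.C c) = C (MvPolynomial.C c) :=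
  (shift v).commutes c

lemma shift_coeff_zero (v : ι → K) (a : MvPolynomial ι K) : (shift v a).coeff 0 = a := by
  rw [coeff_zero_eq_eval_zero]
  induction a using MvPolynomial.induction_on with
  | C c => simp
  | add a b ha hb => rw [map_add, eval_add, ha, hb]
  | mul_X a i ha => rw [map_mul, eval_mul, ha]; simp

lemma derivative_shift (v : ι → K) (a : MvPolynomial ι K) :
    derivative (shift v a) = shift v (dirDeriv v a) := by
  induction a using MvPolynomial.induction_on with
  | C c => rw [shift_C, derivative_C]; simp [dirDeriv]
  | add a b ha hb => rw [map_add, derivative_add, ha, hb, map_add, map_add]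
  | mul_X a i ha =>
    rw [map_mul, derivative_mul, ha, Derivation.leibniz, map_add, smul_eq_mul, smul_eq_mul,
      map_mul, map_mul, shift_X, dirDeriv, MvPolynomial.mkDerivation_X, shift_C]
    simp only [derivative_add, derivative_C, zero_add, derivative_C_mul, derivative_X, mul_one]
    ring

lemma factorial_mul_coeff_shift (v : ι → K) (i : ℕ) (a : MvPolynomial ι K) :
    (i.factorial : MvPolynomial ι K) * (shift v a).coeff i = (dirDeriv v)^[i] a := by
  induction i generalizing a with
  | zero => simp [shift_coeff_zero]
  | succ i ih =>
    rw [Function.iterate_succ_apply, ← ih, ← derivative_shift, coeff_derivative,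
      Nat.factorial_succ]
    push_cast; ring

lemma coeff_one_shift (v : ι → K) (a : MvPolynomial ι K) :
    (shift v a).coeff 1 = dirDeriv v a := by
  simpa using factorial_mul_coeff_shift v 1 a

/-- Polynomials of joint total degree at most `d`. -/
def JointDegreeLE (d : ℕ) (q : (MvPolynomial ι K)[X]) : Prop :=
  ∀ i, q.coeff i ≠ 0 → (q.coeff i).totalDegree + i ≤ d

lemma JointDegreeLE.add {d : ℕ} {q r : (MvPolynomial ι K)[X]} (hq : JointDegreeLE d q)
    (hr : JointDegreeLE d r) : JointDegreeLE d (q + r) := by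
  intro i hi
  rw [coeff_add] at hi ⊢
  have := MvPolynomial.totalDegree_add (q.coeff i) (r.coeff i)
  by_cases h1 : q.coeff i = 0
  · rw [h1, zero_add] at hi ⊢; exact hr i hi
  by_cases h2 : r.coeff i = 0
  · rw [h2, add_zero] at hi ⊢; exact hq i hi
  have := hq i h1
  have := hr i h2
  omega

lemma JointDegreeLE.sum {τ : Type*} {s : Finset τ} {d : ℕ} {q : τ → (MvPolynomial ι K)[X]}
    (h : ∀ i ∈ s, JointDegreeLE d (q i)) : JointDegreeLE d (∑ i ∈ s, q i) := by
  classical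
  induction s using Finset.induction_on with
  | empty => intro i hi; simp at hi
  | insert a s ha ih =>
    rw [Finset.sum_insert ha]
    exact (h a (Finset.mem_insert_self _ _)).add
      (ih fun i hi => h i (Finset.mem_insert_of_mem hi))

lemma JointDegreeLE.mul {d e : ℕ} {q r : (MvPolynomial ι K)[X]} (hq : JointDegreeLE d q)
    (hr : JointDegreeLE e r) : JointDegreeLE (d + e) (q * r) := by
  intro i hi
  rw [coeff_mul] at hi ⊢
  obtain ⟨x, hx, hx0⟩ := Finset.exists_ne_zero_of_sum_ne_zero hi
  have hxi := Finset.HasAntidiagonal.mem_antidiagonal.mp hx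
  have hi' : i ≤ d + e := by
    have := hq _ (left_ne_zero_of_mul hx0)
    have := hr _ (right_ne_zero_of_mul hx0)
    omega
  have : (∑ x ∈ Finset.HasAntidiagonal.antidiagonal i, q.coeff x.1 * r.coeff x.2).totalDegree ≤
      d + e - i := by
    refine MvPolynomial.totalDegree_finsetSum_le fun x hx => ?_
    have hxi := Finset.HasAntidiagonal.mem_antidiagonal.mp hx
    by_cases h1 : q.coeff x.1 = 0
    · simp [h1]
    by_cases h2 : r.coeff x.2 = 0
    · simp [h2]
    have := hq _ h1
    have := hr _ h2
    have := MvPolynomial.totalDegree_mul (q.coeff x.1) (r.coeff x.2)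
    omega
  omega

lemma JointDegreeLE.coeff_eq_zero {d i : ℕ} {q : (MvPolynomial ι K)[X]} (hq : JointDegreeLE d q)
    (hi : d < i) : q.coeff i = 0 := by
  by_contra h
  have := hq i h
  omega

lemma JointDegreeLE.coeff_mul_top {d e : ℕ} {q r : (MvPolynomial ι K)[X]}
    (hq : JointDegreeLE d q) (hr : JointDegreeLE e r) :
    (q * r).coeff (d + e) = q.coeff d * r.coeff e := by
  rw [coeff_mul]
  apply Finset.sum_eq_single (d, e)
  · rintro ⟨i, j⟩ hij hne
    have := Finset.HasAntidiagonal.mem_antidiagonal.mp hij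
    simp only at this ⊢
    rcases lt_trichotomy i d with h | h | h
    · rw [hr.coeff_eq_zero (by omega), mul_zero]
    · exact absurd (Prod.ext h (by omega)) hne
    · rw [hq.coeff_eq_zero h, zero_mul]
  · intro h
    simp at h

lemma shift_monomial_aux (v : ι → K) (m : ι →₀ ℕ) :
    JointDegreeLE m.degree (shift v (MvPolynomial.monomial m 1)) ∧
      (shift v (MvPolynomial.monomial m 1)).coeff m.degree =
        MvPolynomial.C (MvPolynomial.eval v (MvPolynomial.monomial m (1 : K))) := by
  induction m using Finsupp.induction_linear with
  | zero =>
    have : MvPolynomial.monomial (0 : ι →₀ ℕ) (1 : K) = 1 := rfl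
    rw [this, map_one, map_zero]
    refine ⟨fun i hi => ?_, by simp⟩
    obtain _ | i := i
    · simp
    · simp [coeff_one] at hi
  | add m n hm hn =>
    have : MvPolynomial.monomial (m + n) (1 : K) =
      MvPolynomial.monomial m 1 * MvPolynomial.monomial n 1 := by
      rw [MvPolynomial.monomial_mul, one_mul]
    rw [this, map_mul, map_add, map_mul, map_mul]
    exact ⟨hm.1.mul hn.1, by rw [hm.1.coeff_mul_top hn.1, hm.2, hn.2]⟩
  | single i k =>
    have hX : JointDegreeLE 1 (shift v (MvPolynomial.X i)) := by
      intro j hj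
      rw [shift_X] at hj ⊢
      obtain _ | _ | j := j
      · simp
      · simp
      · simp at hj
    induction k with
    | zero =>
      have : MvPolynomial.monomial (0 : ι →₀ ℕ) (1 : K) = 1 := rfl
      rw [Finsupp.single_zero, this, map_one, map_zero]
      refine ⟨fun i hi => ?_, by simp⟩
      obtain _ | i := i
      · simp
      · simp [coeff_one] at hi
    | succ k ih =>
      have : MvPolynomial.monomial (Finsupp.single i (k + 1)) (1 : K) =
        MvPolynomial.monomial (Finsupp.single i k) 1 * MvPolynomial.X i := by
        rw [MvPolynomial.X, MvPolynomial.monomial_mul, one_mul, Finsupp.single_add]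
      have hd : (Finsupp.single i (k + 1)).degree = (Finsupp.single i k).degree + 1 := by
        simp [Finsupp.single_add]
      rw [this, map_mul, hd, map_mul, map_mul]
      refine ⟨ih.1.mul hX, ?_⟩
      rw [ih.1.coeff_mul_top hX, ih.2]
      simp

lemma jointDegreeLE_shift (v : ι → K) {a : MvPolynomial ι K} {d : ℕ} (ha : a.totalDegree ≤ d) :
    JointDegreeLE d (shift v a) := by
  rw [a.as_sum, map_sum]
  refine JointDegreeLE.sum fun m hm => ?_
  rw [← mul_one (a.coeff m), ← MvPolynomial.C_mul_monomial, map_mul, shift_C]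
  intro i hi
  rw [coeff_C_mul] at hi ⊢
  have h1 := (shift_monomial_aux v m).1 i (right_ne_zero_of_mul hi)
  have h2 := MvPolynomial.totalDegree_mul (MvPolynomial.C (a.coeff m))
    ((shift v (MvPolynomial.monomial m 1)).coeff i)
  have h3 := MvPolynomial.le_totalDegree hm
  rw [MvPolynomial.totalDegree_C] at h2
  have h4 : m.degree = m.sum fun _ e => e := rfl
  omega

lemma coeff_shift_top (v : ι → K) {a : MvPolynomial ι K} {d : ℕ} (ha : a.totalDegree ≤ d) :
    (shift v a).coeff d =
      MvPolynomial.C (MvPolynomial.eval v (MvPolynomial.homogeneousComponent d a)) := by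
  rw [MvPolynomial.homogeneousComponent_apply]
  conv_lhs => rw [a.as_sum]
  rw [map_sum, finsetSum_coeff, map_sum, map_sum, Finset.sum_filter]
  refine Finset.sum_congr rfl fun m hm => ?_
  have e : shift v (MvPolynomial.monomial m (a.coeff m)) =
      C (MvPolynomial.C (a.coeff m)) * shift v (MvPolynomial.monomial m 1) := by
    rw [← shift_C v, ← map_mul, MvPolynomial.C_mul_monomial, mul_one]
  rw [e, coeff_C_mul]
  have h3 := MvPolynomial.le_totalDegree hm
  have h4 : m.degree = m.sum fun _ e => e := rfl
  split_ifs with h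
  · rw [← h, (shift_monomial_aux v m).2, ← map_mul]
    congr 1
    rw [← MvPolynomial.eval_C (f := v) (a.coeff m), ← map_mul, MvPolynomial.C_mul_monomial, mul_one,
      MvPolynomial.eval_C]
  · rw [(shift_monomial_aux v m).1.coeff_eq_zero (by omega), mul_zero]

lemma homogeneousComponent_totalDegree_ne_zero {a : MvPolynomial ι K} (ha : a ≠ 0) :
    MvPolynomial.homogeneousComponent a.totalDegree a ≠ 0 := by
  obtain ⟨m, hm, e⟩ := Finset.exists_mem_eq_sup a.support (MvPolynomial.support_nonempty.mpr ha)
    (fun s => s.sum fun _ e => e)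
  intro h
  have := congrArg (MvPolynomial.coeff m) h
  rw [MvPolynomial.coeff_homogeneousComponent,
    if_pos (by rw [MvPolynomial.totalDegree, e]; rfl)] at this
  exact MvPolynomial.mem_support_iff.mp hm this

lemma exists_sub_eval_ne_zero [Infinite K] {q : MvPolynomial ι K} (hq : q ≠ 0) (u : ι → K) :
    ∃ v w : ι → K, v - w = u ∧ MvPolynomial.eval v q ≠ 0 ∧ MvPolynomial.eval w q ≠ 0 := by
  let T : MvPolynomial ι K →ₐ[K] MvPolynomial ι K :=
    MvPolynomial.aeval fun i => MvPolynomial.X i + MvPolynomial.C (u i)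
  have hT : ∀ w, MvPolynomial.eval w (T q) = MvPolynomial.eval (w + u) q := by
    intro w
    rw [← MvPolynomial.coe_aeval_eq_eval, ← MvPolynomial.coe_aeval_eq_eval]
    change ((MvPolynomial.aeval w).comp T) q = MvPolynomial.aeval (w + u) q
    congr 1
    apply MvPolynomial.algHom_ext
    intro i
    simp [T]
  have hTq : T q ≠ 0 := by
    intro h
    apply hq
    apply MvPolynomial.funext
    intro w
    have := hT (w - u)
    rw [h, sub_add_cancel] at this
    rw [← this]; simp
  have : q * T q ≠ 0 := mul_ne_zero hq hTq
  obtain ⟨w, hw⟩ : ∃ w, MvPolynomial.eval w (q * T q) ≠ 0 := by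
    by_contra! h
    exact this (MvPolynomial.funext fun w => by rw [h w]; simp)
  rw [map_mul, hT] at hw
  exact ⟨w + u, w, by simp, right_ne_zero_of_mul hw, left_ne_zero_of_mul hw⟩

/-- The automorphism of `A[U]` extending the translation. -/
noncomputable def shiftAut (v : ι → K) : (MvPolynomial ι K)[X] →+* (MvPolynomial ι K)[X] :=
  eval₂RingHom (shift v).toRingHom X

lemma shiftAut_C (v : ι → K) (a : MvPolynomial ι K) : shiftAut v (C a) = shift v a := by
  simp [shiftAut]

lemma shiftAut_shift (v : ι → K) (a : MvPolynomial ι K) : shiftAut v (shift (-v) a) = C a := by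
  induction a using MvPolynomial.induction_on with
  | C c => rw [shift_C, shiftAut_C, shift_C]
  | add a b ha hb => rw [map_add, map_add, ha, hb, C_add]
  | mul_X a i ha =>
    rw [map_mul, map_mul, ha, shift_X, map_add, shiftAut_C, shift_X, map_mul, shiftAut_C, shift_C]
    have hX : shiftAut v X = X := eval₂_X _ _
    simp only [hX, Pi.neg_apply, map_neg, C_mul]
    ring

lemma shiftAut_neg (v : ι → K) (q : (MvPolynomial ι K)[X]) : shiftAut v (shiftAut (-v) q) = q := by
  induction q using Polynomial.induction_on' with
  | add p q hp hq => rw [map_add, map_add, hp, hq]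
  | monomial n a =>
    rw [← C_mul_X_pow_eq_monomial, map_mul, map_mul, shiftAut_C, shiftAut_shift, map_pow, map_pow]
    simp [shiftAut]

/-- The translation automorphism as an equivalence. -/
noncomputable def shiftEquiv (v : ι → K) : (MvPolynomial ι K)[X] ≃+* (MvPolynomial ι K)[X] :=
  RingEquiv.ofRingHom (shiftAut v) (shiftAut (-v))
    (RingHom.ext (shiftAut_neg v))
    (RingHom.ext fun q => by simpa using shiftAut_neg (-v) q)

lemma shiftEquiv_C (v : ι → K) (a : MvPolynomial ι K) : shiftEquiv v (C a) = shift v a :=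
  shiftAut_C v a

lemma prime_shift (v : ι → K) {p : MvPolynomial ι K} (hp : Prime p) : Prime (shift v p) := by
  rw [← shiftEquiv_C, MulEquiv.prime_iff (shiftEquiv v)]
  exact prime_C_iff.mpr hp

lemma shift_dvd_shift_iff (v : ι → K) {p a : MvPolynomial ι K} : shift v p ∣ shift v a ↔ p ∣ a := by
  rw [← shiftEquiv_C, ← shiftEquiv_C, map_dvd_iff]
  exact C_dvd_iff_dvd_coeff _ _ |>.trans ⟨fun h => by simpa using h 0, fun h i => by
    rw [coeff_C]; split_ifs
    · exact h
    · exact dvd_zero _⟩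

end Shift

section Conjugates

open Polynomial

variable {K ι : Type*} [Field K]

/-- The translated normalized equation of a hypersurface along the direction `v`. -/
noncomputable def linePoly (p : MvPolynomial ι K) (v : ι → K) : (MvPolynomial ι K)[X] :=
  C (MvPolynomial.C (MvPolynomial.eval v (MvPolynomial.homogeneousComponent p.totalDegree p))⁻¹) *
    shift v p

section

variable {p : MvPolynomial ι K} {v : ι → K}
  (hv : MvPolynomial.eval v (MvPolynomial.homogeneousComponent p.totalDegree p) ≠ 0)
include hv

omit hv in
lemma coeff_linePoly (i : ℕ) : (linePoly p v).coeff i =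
    MvPolynomial.C (MvPolynomial.eval v
      (MvPolynomial.homogeneousComponent p.totalDegree p))⁻¹ * (shift v p).coeff i :=
  coeff_C_mul _

lemma monic_linePoly_aux : (linePoly p v).Monic ∧ (linePoly p v).natDegree = p.totalDegree := by
  have h1 : (linePoly p v).coeff p.totalDegree = 1 := by
    rw [coeff_linePoly, coeff_shift_top v le_rfl, ← map_mul, inv_mul_cancel₀ hv, map_one]
  have h2 : (linePoly p v).natDegree ≤ p.totalDegree := by
    rw [natDegree_le_iff_coeff_eq_zero]
    intro i hi
    rw [coeff_linePoly, (jointDegreeLE_shift v le_rfl).coeff_eq_zero hi, mul_zero]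
  have h3 : (linePoly p v).natDegree = p.totalDegree :=
    le_antisymm h2 (le_natDegree_of_ne_zero (by rw [h1]; exact one_ne_zero))
  exact ⟨by rw [Monic, leadingCoeff, h3, h1], h3⟩

lemma monic_linePoly : (linePoly p v).Monic := (monic_linePoly_aux hv).1

lemma natDegree_linePoly : (linePoly p v).natDegree = p.totalDegree := (monic_linePoly_aux hv).2

lemma associated_linePoly : Associated (linePoly p v) (shift v p) := by
  have : IsUnit (C (MvPolynomial.C (MvPolynomial.eval v
      (MvPolynomial.homogeneousComponent p.totalDegree p))⁻¹) : (MvPolynomial ι K)[X]) :=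
    ((IsUnit.mk0 _ (inv_ne_zero hv)).map (MvPolynomial.C (σ := ι))).map
      (C (R := MvPolynomial ι K))
  exact associated_unit_mul_left _ _ this

lemma linePoly_dvd_shift_iff {a : MvPolynomial ι K} : linePoly p v ∣ shift v a ↔ p ∣ a :=
  (associated_linePoly hv).dvd_iff_dvd_left.trans (shift_dvd_shift_iff v)

end

lemma kapLift_unique {A E : Type*} [CommRing A] [Field E] (p : A) [Fact (Prime p)] (ψ : A →+* E)
    (h : ∀ a, ψ a = 0 ↔ p ∣ a) (χ : Kap p →+* E) (hχ : ∀ a, χ (toKap p a) = ψ a) :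
    χ = kapLift p ψ h := by
  ext c
  obtain ⟨a, b, hb, hab⟩ := Kap.exists_mul p c
  have hb' : ψ b ≠ 0 := fun h' => hb ((h b).mp h')
  have h1 := congrArg χ hab
  have h2 := congrArg (kapLift p ψ h) hab
  rw [map_mul, hχ, hχ] at h1
  rw [map_mul, kapLift_toKap, kapLift_toKap] at h2
  exact mul_right_cancel₀ hb' (h1.trans h2.symm)

/-- Evaluation of polynomials at the point `x + S v`. -/
noncomputable def evS {Ω : Type*} [CommRing Ω] (τ : MvPolynomial ι K →+* Ω) (v : ι → K) (S : Ω) :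
    MvPolynomial ι K →+* Ω :=
  (eval₂RingHom τ S).comp (shift v).toRingHom

lemma evS_apply {Ω : Type*} [CommRing Ω] (τ : MvPolynomial ι K →+* Ω) (v : ι → K) (S : Ω)
    (a : MvPolynomial ι K) : evS τ v S a = eval₂ τ S (shift v a) := rfl

lemma irreducible_map_linePoly {p : MvPolynomial ι K} (hp : Prime p) {v : ι → K}
    (hv : MvPolynomial.eval v (MvPolynomial.homogeneousComponent p.totalDegree p) ≠ 0) :
    Irreducible ((linePoly p v).map (algebraMap _ (FractionRing (MvPolynomial ι K)))) := by
  rw [← (monic_linePoly hv).irreducible_iff_irreducible_map_fraction_map]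
  exact (associated_linePoly hv).irreducible_iff.mpr (prime_shift v hp).irreducible

theorem exists_conjugates [CharZero K] (p : MvPolynomial ι K) [hp : Fact (Prime p)] (v : ι → K)
    (hv : MvPolynomial.eval v (MvPolynomial.homogeneousComponent p.totalDegree p) ≠ 0) :
    ∃ t : Kap p → FractionRing (MvPolynomial ι K),
      ∀ (Ω : Type*) [Field Ω] [IsAlgClosed Ω] (τ : FractionRing (MvPolynomial ι K) →+* Ω),
      ∃ (m : ℕ) (S : Fin m → Ω)
        (hS : ∀ j a, evS (τ.comp (algebraMap _ _)) v (S j) a = 0 ↔ p ∣ a),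
        ∏ j, (X - C (S j)) = (linePoly p v).map (τ.comp (algebraMap _ _)) ∧
        ∀ c, τ (t c) = ∑ j, kapLift p (evS (τ.comp (algebraMap _ _)) v (S j)) (hS j) c / S j := by
  classical
  have : Fact (Irreducible ((linePoly p v).map
    (algebraMap _ (FractionRing (MvPolynomial ι K))))) := ⟨irreducible_map_linePoly hp.out hv⟩
  set P := (linePoly p v).map (algebraMap _ (FractionRing (MvPolynomial ι K))) with hP
  have hPm : P.Monic := (monic_linePoly hv).map _
  let L := AdjoinRoot P
  let pb : PowerBasis (FractionRing (MvPolynomial ι K)) L := AdjoinRoot.powerBasis hPm.ne_zero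
  have hfd : FiniteDimensional (FractionRing (MvPolynomial ι K)) L := pb.finite
  let s : L := AdjoinRoot.root P
  have hgen : pb.gen = s := AdjoinRoot.powerBasis_gen _
  have hmin : minpoly (FractionRing (MvPolynomial ι K)) pb.gen = P :=
    AdjoinRoot.minpoly_powerBasis_gen_of_monic hPm
  have hker : ∀ a, evS ((AdjoinRoot.of P).comp (algebraMap _ _)) v s a = 0 ↔ p ∣ a := by
    intro a
    rw [evS_apply, ← eval₂_map, ← linePoly_dvd_shift_iff hv,
      ← map_dvd_map _ (FaithfulSMul.algebraMap_injective _ (FractionRing (MvPolynomial ι K)))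
        (monic_linePoly hv), ← hP, ← AdjoinRoot.mk_eq_zero, ← AdjoinRoot.aeval_eq]
    rfl
  refine ⟨fun c => Algebra.trace _ L (kapLift p _ hker c / s), ?_⟩
  intro Ω _ _ τ
  let _ := τ.toAlgebra
  have hcomp : ∀ e : L →ₐ[FractionRing (MvPolynomial ι K)] Ω, ∀ a,
      evS (τ.comp (algebraMap _ _)) v (e s) a =
        e (evS ((AdjoinRoot.of P).comp (algebraMap _ _)) v s a) := by
    intro e a
    have h1 : (e : L →+* Ω).comp (AdjoinRoot.of P) = τ := RingHom.ext e.commutes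
    rw [evS_apply, evS_apply, ← RingHom.coe_coe e, hom_eval₂, ← RingHom.comp_assoc, h1]
  have hS : ∀ (e : L →ₐ[FractionRing (MvPolynomial ι K)] Ω) a,
      evS (τ.comp (algebraMap _ _)) v (e s) a = 0 ↔ p ∣ a := by
    intro e a
    rw [hcomp, map_eq_zero, hker]
  let φ := (Fintype.equivFin (L →ₐ[FractionRing (MvPolynomial ι K)] Ω)).symm
  refine ⟨_, fun i => φ i s, fun i => hS (φ i), ?_, ?_⟩
  · rw [φ.prod_comp (fun e => X - C (e s)), ← map_map]
    have hmap : (minpoly (FractionRing (MvPolynomial ι K)) pb.gen).map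
        (algebraMap (FractionRing (MvPolynomial ι K)) Ω) = P.map τ := by rw [hmin]; rfl
    rw [← hP, ← hmap, ((IsAlgClosed.splits _).eq_prod_roots_of_monic
      ((minpoly.monic pb.isIntegral_gen).map _) : _ = _), ← hgen]
    have hnd : ((minpoly (FractionRing (MvPolynomial ι K)) pb.gen).aroots Ω).Nodup :=
      nodup_aroots_iff_of_splits (minpoly.ne_zero pb.isIntegral_gen) (IsAlgClosed.splits _) |>.mpr
        (Algebra.IsSeparable.isSeparable (FractionRing (MvPolynomial ι K)) pb.gen)
    rw [Fintype.prod_equiv pb.liftEquiv' _ (fun y => X - C (y : Ω))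
      (fun e => by rw [PowerBasis.liftEquiv'_apply_coe]),
      Finset.prod_mem_multiset _ _ (fun y => X - C y) (fun _ => rfl),
      Finset.prod_eq_multiset_prod, Multiset.toFinset_val, Multiset.dedup_eq_self.mpr hnd]
  · intro c
    change algebraMap _ Ω _ = _
    rw [trace_eq_sum_embeddings (K := FractionRing (MvPolynomial ι K)) (L := L) Ω,
      φ.sum_comp (fun e => kapLift p _ (hS e) c / e s)]
    refine Finset.sum_congr rfl fun e _ => ?_
    rw [map_div₀]
    congr 1
    exact RingHom.congr_fun (kapLift_unique p _ (hS e) ((e : L →+* Ω).comp (kapLift p _ hker))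
      fun a => by simp only [RingHom.comp_apply, kapLift_toKap, RingHom.coe_coe, hcomp]) c

end Conjugates

section ValuationPoly

open Polynomial

variable {Ω : Type*} [Field Ω] (V : ValuationSubring Ω)

lemma ValuationSubring.exists_map_eq {Q : Polynomial Ω} (hc : ∀ i, Q.coeff i ∈ V) :
    ∃ q : V[X], q.map (algebraMap V Ω) = Q :=
  (mem_lifts Q).mp ((lifts_iff_coeff_lifts Q).mpr fun i => ⟨⟨_, hc i⟩, rfl⟩)

lemma ValuationSubring.mem_of_root {Q : Polynomial Ω} (hQ : Q.Monic) (hc : ∀ i, Q.coeff i ∈ V)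
    {z : Ω}
    (hz : eval z Q = 0) : z ∈ V := by
  obtain ⟨q, rfl⟩ := V.exists_map_eq hc
  rw [eval_map] at hz
  exact V.mem_of_isIntegral_eval₂ (algebraMap V Ω) (fun a => a.2)
    (monic_of_injective Subtype.val_injective hQ) hz

lemma ValuationSubring.eval_mem {Q : Polynomial Ω} (hc : ∀ i, Q.coeff i ∈ V)
    {z : Ω} (hz : z ∈ V) :
    eval z Q ∈ V := by
  rw [eval_eq_sum_range]
  exact sum_mem fun i _ => V.mul_mem _ _ (hc _) (pow_mem hz _)

lemma ValuationSubring.coeff_mem_of_mul {f₁ f₂ : Polynomial Ω} (h₁ : f₁.Monic) (h₂ : f₂.Monic)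
    (h : ∀ i, (f₁ * f₂).coeff i ∈ V) (i : ℕ) : f₁.coeff i ∈ V := by
  obtain ⟨q, hq⟩ := V.exists_map_eq h
  have hqm : q.Monic :=
    monic_of_injective (f := algebraMap V Ω) Subtype.val_injective (by rw [hq]; exact h₁.mul h₂)
  obtain ⟨g, hg⟩ := IsIntegrallyClosed.eq_map_mul_C_of_dvd Ω hqm (g := f₁)
    (by rw [hq]; exact dvd_mul_right _ _)
  rw [h₁.leadingCoeff, C_1, mul_one] at hg
  rw [← hg, coeff_map]
  exact (g.coeff i).2

lemma eval_scaleRoots_mul {R : Type*} [CommRing R] (q : R[X]) (t z : R) :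
    eval (t * z) (q.scaleRoots t) = t ^ q.natDegree * eval z q :=
  scaleRoots_eval₂_mul (RingHom.id R) z t

lemma eval_derivative_scaleRoots_mul {R : Type*} [CommRing R] (q : R[X]) (t z : R) :
    t * eval (t * z) (derivative (q.scaleRoots t)) = t ^ q.natDegree * eval z (derivative q) := by
  have h : (q.scaleRoots t).comp (C t * X) = C (t ^ q.natDegree) * q := by
    ext i
    rw [comp_C_mul_X_coeff, coeff_scaleRoots, coeff_C_mul, mul_assoc, ← pow_add]
    by_cases hi : i ≤ q.natDegree
    · rw [Nat.sub_add_cancel hi, mul_comm]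
    · rw [coeff_eq_zero_of_natDegree_lt (not_le.mp hi), zero_mul, mul_zero]
  have := congrArg (fun w => eval z (derivative w)) h
  simpa only [derivative_comp, derivative_C_mul, derivative_X, mul_one, eval_mul, eval_C, eval_comp,
    eval_X] using this

lemma ValuationSubring.scale_eval_derivative_mem {f₁ f₂ : Polynomial Ω} (h₁ : f₁.Monic)
    (h₂ : f₂.Monic)
    {t z : Ω} (ht : t ∈ V) (hz : t * z ∈ V)
    (hc : ∀ i, ((f₁ * f₂).scaleRoots t).coeff i ∈ V) :
    t ^ (f₁ * f₂).natDegree * eval z (derivative f₁ * f₂) ∈ V := by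
  rw [mul_scaleRoots_of_noZeroDivisors] at hc
  have m₁ := (monic_scaleRoots_iff t).mpr h₁
  have m₂ := (monic_scaleRoots_iff t).mpr h₂
  have c₁ := V.coeff_mem_of_mul m₁ m₂ hc
  have c₂ := V.coeff_mem_of_mul m₂ m₁ (by rwa [mul_comm])
  have : t ^ (f₁ * f₂).natDegree * eval z (derivative f₁ * f₂) =
      (t * eval (t * z) (derivative (f₁.scaleRoots t))) * eval (t * z) (f₂.scaleRoots t) := by
    rw [eval_derivative_scaleRoots_mul, eval_scaleRoots_mul, h₁.natDegree_mul h₂, eval_mul]; ring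
  rw [this]
  refine V.mul_mem _ _ (V.mul_mem _ _ ht (V.eval_mem (fun i => ?_) hz)) (V.eval_mem c₂ hz)
  rw [coeff_derivative]
  exact V.mul_mem _ _ (c₁ _) (by exact_mod_cast natCast_mem V (i + 1))

lemma ValuationSubring.div_mem_of_root {Q : Polynomial Ω} {c z : Ω} (hz : eval z Q = 0)
    (h0 : Q.coeff 0 ≠ 0) (hc : ∀ i, c ^ i * (Q.coeff i / Q.coeff 0) ∈ V) : c / z ∈ V := by
  by_contra h
  have hz0 : z ≠ 0 := by rintro rfl; simp at h
  have hc0 : c ≠ 0 := by rintro rfl; simp at h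
  have hlt : V.valuation (z / c) < 1 := by
    rw [← V.valuation_le_one_iff, not_le, map_div₀, one_lt_div₀ (by simpa [zero_lt_iff] using hz0)]
      at h
    rwa [map_div₀, div_lt_one₀ (by simpa [zero_lt_iff] using hc0)]
  have h1 : (1 : Ω) = - ∑ i ∈ Finset.range Q.natDegree,
      c ^ (i + 1) * (Q.coeff (i + 1) / Q.coeff 0) * (z / c) ^ (i + 1) := by
    rw [eval_eq_sum_range, Finset.sum_range_succ'] at hz
    rw [eq_neg_iff_add_eq_zero, ← mul_right_inj' h0, mul_zero, ← hz, mul_add, Finset.mul_sum,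
      add_comm]
    congr 1
    · refine Finset.sum_congr rfl fun i _ => ?_
      have e : c ^ (i + 1) * (z / c) ^ (i + 1) = z ^ (i + 1) := by
        rw [← mul_pow, mul_div_cancel₀ _ hc0]
      rw [← e]
      field_simp
    · simp
  have h2 : V.valuation (∑ i ∈ Finset.range Q.natDegree,
      c ^ (i + 1) * (Q.coeff (i + 1) / Q.coeff 0) * (z / c) ^ (i + 1)) < 1 := by
    refine Valuation.map_sum_lt _ one_ne_zero fun i _ => ?_
    rw [map_mul, map_pow]
    exact (mul_le_of_le_one_left' ((V.valuation_le_one_iff _).mpr (hc (i + 1)))).trans_lt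
      (pow_lt_one₀ zero_le hlt (by omega))
  rw [← Valuation.map_neg, ← h1, map_one] at h2
  exact lt_irrefl _ h2

end ValuationPoly

section Scale

variable {K ι Ω : Type*} [Field K] [Field Ω]

lemma ValuationSubring.pow_mul_mem (V : ValuationSubring Ω) (ψ : MvPolynomial ι K →+* Ω)
    (hK : ∀ c, ψ (MvPolynomial.C c) ∈ V) {r : Ω} (hr : r ∈ V)
    (hx : ∀ i, r * ψ (MvPolynomial.X i) ∈ V) {a : MvPolynomial ι K} {N : ℕ}
    (ha : a.totalDegree ≤ N) : r ^ N * ψ a ∈ V := by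
  have key : ∀ m : ι →₀ ℕ, r ^ m.degree * ψ (MvPolynomial.monomial m 1) ∈ V := by
    intro m
    induction m using Finsupp.induction_linear with
    | zero =>
      have : MvPolynomial.monomial (0 : ι →₀ ℕ) (1 : K) = 1 := rfl
      rw [this]; simp
    | add m n hm hn =>
      have : MvPolynomial.monomial (m + n) (1 : K) =
        MvPolynomial.monomial m 1 * MvPolynomial.monomial n 1 := by
        rw [MvPolynomial.monomial_mul, one_mul]
      rw [this, map_mul, map_add, pow_add, mul_mul_mul_comm]
      exact V.mul_mem _ _ hm hn
    | single i k =>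
      rw [← MvPolynomial.X_pow_eq_monomial, map_pow, Finsupp.degree_single, ← mul_pow]
      exact pow_mem (hx i) _
  rw [a.as_sum, map_sum, Finset.mul_sum]
  refine sum_mem fun m hm => ?_
  have h3 := MvPolynomial.le_totalDegree hm
  have h4 : m.degree = m.sum fun _ e => e := rfl
  rw [← mul_one (a.coeff m), ← MvPolynomial.C_mul_monomial, map_mul,
    show N = (N - m.degree) + m.degree by omega, pow_add, mul_mul_mul_comm]
  exact V.mul_mem _ _ (V.mul_mem _ _ (pow_mem hr _) (hK _)) (key m)

end Scale

section ResElt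

open Polynomial

variable {K ι F : Type*} [Field K] [Field F] [Algebra (MvPolynomial ι K) F]

/-- The elements `G` built from the conjugates of the parameter of the hypersurface `p`
on the line with direction `v`. -/
def PrimElt.IsResElt (E : PrimElt (MvPolynomial ι K) F) (p : MvPolynomial ι K) [Fact (Prime p)]
    (v : ι → K) (g : Polynomial (Kap p)) (G : F) : Prop :=
  ∀ τ : F →+* AlgebraicClosure F, ∃ (m : ℕ) (S : Fin m → AlgebraicClosure F)
    (hS : ∀ j a, evS (τ.comp (algebraMap _ _)) v (S j) a = 0 ↔ p ∣ a),
    ∏ j, (X - C (S j)) = (linePoly p v).map (τ.comp (algebraMap _ _)) ∧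
    τ (aeval E.y (derivative E.f)) * τ G = - ∑ j,
      eval₂ (kapLift p (evS (τ.comp (algebraMap _ _)) v (S j)) (hS j)) (τ E.y) g / S j

lemma PrimElt.exists_isResElt [CharZero K] [FaithfulSMul (MvPolynomial ι K) F]
    (E : PrimElt (MvPolynomial ι K) F) (p : MvPolynomial ι K) [Fact (Prime p)] {v : ι → K}
    (hv : MvPolynomial.eval v (MvPolynomial.homogeneousComponent p.totalDegree p) ≠ 0)
    (g : Polynomial (Kap p)) : ∃ G, E.IsResElt p v g G := by
  obtain ⟨t, ht⟩ := exists_conjugates p v hv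
  let j : FractionRing (MvPolynomial ι K) →+* F :=
    IsFractionRing.lift (FaithfulSMul.algebraMap_injective (MvPolynomial ι K) F)
  have hj : j.comp (algebraMap _ _) = algebraMap _ _ :=
    RingHom.ext fun x =>
      IsFractionRing.lift_algebraMap (FaithfulSMul.algebraMap_injective (MvPolynomial ι K) F) x
  refine ⟨-(∑ i ∈ Finset.range (g.natDegree + 1), j (t (g.coeff i)) * E.y ^ i) /
    aeval E.y (derivative E.f), fun τ => ?_⟩
  obtain ⟨m, S, hS, h1, h2⟩ := ht (AlgebraicClosure F) (τ.comp j)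
  have hc : (τ.comp j).comp (algebraMap _ _) = τ.comp (algebraMap (MvPolynomial ι K) F) := by
    rw [RingHom.comp_assoc, hj]
  rw [← hc]
  refine ⟨m, S, hS, h1, ?_⟩
  rw [← map_mul, mul_div_cancel₀ _ E.sep, map_neg, map_sum, neg_inj]
  simp_rw [eval₂_eq_sum_range, Finset.sum_div]
  rw [Finset.sum_comm]
  refine Finset.sum_congr rfl fun i _ => ?_
  rw [map_mul, map_pow, ← RingHom.comp_apply, h2, Finset.sum_mul]
  refine Finset.sum_congr rfl fun i _ => ?_
  ring

/-- The exponent in the estimate of the residual elements. -/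
noncomputable def PrimElt.degBound (E : PrimElt (MvPolynomial ι K) F) : ℕ :=
  1 + E.f.support.sup fun i => (E.f.coeff i).totalDegree

lemma PrimElt.totalDegree_coeff_le (E : PrimElt (MvPolynomial ι K) F) (i : ℕ) :
    (E.f.coeff i).totalDegree ≤ E.degBound := by
  by_cases h : E.f.coeff i = 0
  · simp [h]
  · have := Finset.le_sup (f := fun i => (E.f.coeff i).totalDegree) (mem_support_iff.mpr h)
    exact this.trans (Nat.le_add_left _ _)

lemma evS_C {Ω : Type*} [CommRing Ω] (τ : MvPolynomial ι K →+* Ω) (v : ι → K) (S : Ω)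
    (a : K) : evS τ v S (MvPolynomial.C a) = τ (MvPolynomial.C a) := by
  rw [evS_apply, shift_C, eval₂_C]

lemma evS_X {Ω : Type*} [CommRing Ω] (τ : MvPolynomial ι K →+* Ω) (v : ι → K) (S : Ω)
    (i : ι) : evS τ v S (MvPolynomial.X i) =
      τ (MvPolynomial.X i) + τ (MvPolynomial.C (v i)) * S := by
  rw [evS_apply, shift_X, eval₂_add, eval₂_mul, eval₂_C, eval₂_C, eval₂_X]

variable [CharZero K]

lemma coeff_linePoly_div (p : MvPolynomial ι K) {v : ι → K}
    (hv : MvPolynomial.eval v (MvPolynomial.homogeneousComponent p.totalDegree p) ≠ 0)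
    {Ω : Type*} [Field Ω] (τ : MvPolynomial ι K →+* Ω) (i : ℕ) :
    τ ((linePoly p v).coeff i) / τ ((linePoly p v).coeff 0) =
      τ (MvPolynomial.C (i.factorial : K)⁻¹) * (τ ((dirDeriv v)^[i] p) / τ p) := by
  have h1 : τ (MvPolynomial.C (MvPolynomial.eval v
      (MvPolynomial.homogeneousComponent p.totalDegree p))⁻¹) ≠ 0 :=
    ((IsUnit.mk0 _ (inv_ne_zero hv)).map (MvPolynomial.C (σ := ι)) |>.map τ).ne_zero
  rw [coeff_linePoly, coeff_linePoly, shift_coeff_zero, map_mul, map_mul, mul_div_mul_left _ _ h1,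
    ← mul_div_assoc, ← map_mul]
  congr 2
  rw [← factorial_mul_coeff_shift, ← mul_assoc, ← map_natCast (MvPolynomial.C (R := K) (σ := ι)),
    ← map_mul, inv_mul_cancel₀ (by exact_mod_cast i.factorial_ne_zero), map_one, one_mul]

lemma PrimElt.IsResElt.bound [FaithfulSMul (MvPolynomial ι K) F]
    {E : PrimElt (MvPolynomial ι K) F} {p : MvPolynomial ι K}
    [hp : Fact (Prime p)] {v : ι → K}
    (hv : MvPolynomial.eval v (MvPolynomial.homogeneousComponent p.totalDegree p) ≠ 0)
    {f₁ f₂ : Polynomial (Kap p)} (h₁ : f₁.Monic) (h₂ : f₂.Monic)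
    (hf : E.f.map (toKap p) = f₁ * f₂) {G : F} (hG : E.IsResElt p v (derivative f₁ * f₂) G)
    (V : ValuationSubring (AlgebraicClosure F)) (τ : F →+* AlgebraicClosure F)
    {c r : AlgebraicClosure F} (hr : r ∈ V)
    (hK : ∀ a : K, τ (algebraMap (MvPolynomial ι K) F (MvPolynomial.C a)) ∈ V)
    (hx : ∀ i, r * τ (algebraMap (MvPolynomial ι K) F (MvPolynomial.X i)) ∈ V) (hy : r * τ E.y ∈ V)
    (hc : ∀ i, c ^ i * (τ (algebraMap _ F ((dirDeriv v)^[i] p)) / τ (algebraMap _ F p)) ∈ V) :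
    c * (r ^ E.degBound) ^ E.f.natDegree * (τ (aeval E.y (derivative E.f)) * τ G) ∈ V := by
  obtain ⟨m, S, hS, hprod, hτ⟩ := hG τ
  set ψ := τ.comp (algebraMap (MvPolynomial ι K) F) with hψ
  have hτp : ψ p ≠ 0 := by
    rw [hψ, RingHom.comp_apply, _root_.map_ne_zero, ne_eq, FaithfulSMul.algebraMap_eq_zero_iff]
    exact hp.out.ne_zero
  have hroot : ∀ j, eval (S j) ((linePoly p v).map ψ) = 0 := by
    intro j
    rw [← hprod, eval_prod]
    exact Finset.prod_eq_zero (Finset.mem_univ j) (by simp)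
  have hP0 : ψ ((linePoly p v).coeff 0) ≠ 0 := by
    rw [coeff_linePoly, shift_coeff_zero, map_mul]
    exact mul_ne_zero
      ((IsUnit.mk0 _ (inv_ne_zero hv)).map (MvPolynomial.C (σ := ι)) |>.map ψ).ne_zero
      hτp
  have hmon := (monic_linePoly hv).map ψ
  have hrS : ∀ j, r * S j ∈ V := by
    intro j
    refine V.mem_of_root ((monic_scaleRoots_iff r).mpr hmon) (fun i => ?_)
      (z := r * S j) (by rw [eval_scaleRoots_mul, hroot, mul_zero])
    rw [coeff_scaleRoots, (monic_linePoly hv).natDegree_map, natDegree_linePoly hv, coeff_map,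
      coeff_linePoly, map_mul, mul_assoc]
    refine V.mul_mem _ _ (hK _) ?_
    rw [mul_comm]
    by_cases h0 : (shift v p).coeff i = 0
    · rw [h0, map_zero, mul_zero]; exact zero_mem V
    · refine V.pow_mul_mem ψ hK hr hx ?_
      have := jointDegreeLE_shift v le_rfl i h0
      omega
  have hcS : ∀ j, c / S j ∈ V := by
    intro j
    refine V.div_mem_of_root (hroot j) (by rwa [coeff_map]) fun i => ?_
    rw [coeff_map, coeff_map, coeff_linePoly_div p hv, mul_left_comm]
    exact V.mul_mem _ _ (hK _) (hc i)
  rw [hτ, mul_neg, Finset.mul_sum]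
  refine neg_mem (sum_mem fun j _ => ?_)
  set χ := kapLift p (evS ψ v (S j)) (hS j) with hχ
  have hfχ : f₁.map χ * f₂.map χ = E.f.map (evS ψ v (S j)) := by
    rw [← Polynomial.map_mul, ← hf, map_map, hχ, kapLift_comp]
  have hN : (f₁.map χ * f₂.map χ).natDegree = E.f.natDegree := by
    rw [hfχ, E.monic.natDegree_map]
  have hxS : ∀ i, r * evS ψ v (S j) (MvPolynomial.X i) ∈ V := by
    intro i
    rw [evS_X, mul_add, mul_left_comm]
    exact add_mem (hx i) (V.mul_mem _ _ (hK _) (hrS j))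
  have hKS : ∀ a, evS ψ v (S j) (MvPolynomial.C a) ∈ V := by
    intro a
    rw [evS_C]; exact hK a
  have hry : r ^ E.degBound * τ E.y ∈ V := by
    rw [degBound, add_comm, pow_succ, mul_assoc]
    exact V.mul_mem _ _ (pow_mem hr _) hy
  have key := V.scale_eval_derivative_mem (h₁.map χ) (h₂.map χ) (pow_mem hr E.degBound) hry
    (fun i => by
      rw [coeff_scaleRoots, hN, hfχ, coeff_map]
      rcases lt_trichotomy i E.f.natDegree with hi | hi | hi
      · rw [show E.f.natDegree - i = (E.f.natDegree - i - 1) + 1 by omega, pow_succ,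
          mul_left_comm, mul_comm (evS ψ v (S j) _)]
        exact V.mul_mem _ _ (pow_mem (pow_mem hr _) _)
          (V.pow_mul_mem _ hKS hr hxS (E.totalDegree_coeff_le i))
      · rw [hi, coeff_natDegree, E.monic.leadingCoeff, map_one, Nat.sub_self]
        simp
      · rw [coeff_eq_zero_of_natDegree_lt hi, map_zero, zero_mul]
        exact zero_mem V)
  rw [hN, derivative_map, ← Polynomial.map_mul, eval_map] at key
  have := V.mul_mem _ _ (hcS j) key
  convert this using 1
  ring

end ResElt

section LocalRes

open Polynomial

lemma not_dvd_dirDeriv {K ι : Type*} [Field K] [CharZero K] {p : MvPolynomial ι K} (hp : Prime p)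
    {v : ι → K}
    (hv : MvPolynomial.eval v (MvPolynomial.homogeneousComponent p.totalDegree p) ≠ 0) :
    ¬ p ∣ dirDeriv v p := by
  intro h
  have hd : p.totalDegree ≠ 0 := by
    intro h0
    rw [MvPolynomial.totalDegree_eq_zero_iff_eq_C] at h0
    refine hp.not_isUnit ?_
    rw [h0]
    refine (IsUnit.mk0 _ ?_).map MvPolynomial.C
    intro h1
    rw [h1, map_zero] at h0
    exact hp.ne_zero h0
  have h0 : dirDeriv v p = 0 := by
    by_contra hne
    obtain ⟨q, hq⟩ := h
    have hq0 : q ≠ 0 := by rintro rfl; rw [mul_zero] at hq; exact hne hq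
    have h1 := MvPolynomial.totalDegree_mul_of_isDomain hp.ne_zero hq0
    rw [← coeff_one_shift] at hne
    have h2 := jointDegreeLE_shift v le_rfl 1 hne
    rw [coeff_one_shift, hq, h1] at h2
    omega
  have h1 := factorial_mul_coeff_shift v p.totalDegree p
  obtain ⟨d, hd'⟩ := Nat.exists_eq_succ_of_ne_zero hd
  rw [coeff_shift_top v le_rfl, hd', Function.iterate_succ_apply, h0,
    Function.iterate_fixed (map_zero (dirDeriv v)), ← hd', mul_eq_zero] at h1
  rcases h1 with h1 | h1
  · exact (Nat.factorial_ne_zero _) (by exact_mod_cast h1)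
  · rw [MvPolynomial.C_eq_zero] at h1; exact hv h1

variable {K ι : Type*} [Field K]

section

variable {Ω : Type*} [Field Ω] (V : ValuationSubring Ω) (ψ : MvPolynomial ι K →+* Ω)
  (hψ : ∀ a, ψ a ∈ V) (p : MvPolynomial ι K) [Fact (Prime p)] (v : ι → K)

include hψ in
lemma evS_mem {S : Ω} (hS : S ∈ V) (a : MvPolynomial ι K) : evS ψ v S a ∈ V :=
  V.eval₂_mem ψ hψ hS _

include hψ in
lemma valuation_evS_sub {S : Ω} (hS : V.valuation S < 1) (a : MvPolynomial ι K) :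
    V.valuation (evS ψ v S a - ψ a) < 1 := by
  have hSV : S ∈ V := (V.valuation_le_one_iff S).mp hS.le
  have : evS ψ v S a - ψ a = eval₂ ψ S (shift v a).divX * S := by
    rw [evS_apply]
    conv_lhs => rw [← divX_mul_X_add (shift v a)]
    rw [eval₂_add, eval₂_mul, eval₂_X, eval₂_C, shift_coeff_zero, add_sub_cancel_right]
  rw [this, map_mul]
  exact (mul_le_of_le_one_left' ((V.valuation_le_one_iff _).mpr
    (V.eval₂_mem ψ hψ hSV _))).trans_lt hS

lemma residue_evS {S : Ω} (hS : V.valuation S < 1) (a : MvPolynomial ι K) :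
    IsLocalRing.residue V ⟨evS ψ v S a, evS_mem V ψ hψ v ((V.valuation_le_one_iff S).mp hS.le) a⟩ =
      resHom V ψ hψ a := by
  rw [← sub_eq_zero]
  change IsLocalRing.residue V _ - IsLocalRing.residue V ⟨ψ a, hψ a⟩ = 0
  rw [← map_sub, V.residue_eq_zero_iff']
  exact valuation_evS_sub V ψ hψ v hS a

variable (hlt : ∀ a, V.valuation (ψ a) < 1 ↔ p ∣ a)

include hψ hlt in
lemma kapLift_evS_mem {S : Ω} (hS : V.valuation S < 1) (hS' : ∀ a, evS ψ v S a = 0 ↔ p ∣ a)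
    (c : Kap p) : kapLift p (evS ψ v S) hS' c ∈ V := by
  have hSV : S ∈ V := (V.valuation_le_one_iff S).mp hS.le
  obtain ⟨a, b, hb, h⟩ := Kap.exists_mul p c
  have h1 : V.valuation (evS ψ v S b) = 1 := by
    refine le_antisymm ((V.valuation_le_one_iff _).mpr (evS_mem V ψ hψ v hSV b))
      (not_lt.mp fun h1 => hb ?_)
    have h1' := (V.residue_eq_zero_iff' ⟨_, evS_mem V ψ hψ v hSV b⟩).mpr h1
    rwa [residue_evS V ψ hψ v hS, resHom_eq_zero_iff, hlt] at h1'
  have h2 := congrArg (fun x => V.valuation (kapLift p (evS ψ v S) hS' x)) h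
  simp only [map_mul, kapLift_toKap] at h2
  rw [h1, mul_one] at h2
  rw [← V.valuation_le_one_iff, h2, V.valuation_le_one_iff]
  exact evS_mem V ψ hψ v hSV a

lemma residue_eval₂_kapLift {S : Ω} (hS : V.valuation S < 1)
    (hS' : ∀ a, evS ψ v S a = 0 ↔ p ∣ a) {z : Ω} (hz : z ∈ V) (g : Polynomial (Kap p)) :
    eval₂ (kapLift p (resHom V ψ hψ) fun a => (resHom_eq_zero_iff V ψ hψ a).trans (hlt a))
      (IsLocalRing.residue V ⟨z, hz⟩) g = IsLocalRing.residue V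
        ⟨eval₂ (kapLift p (evS ψ v S) hS') z g,
          V.eval₂_mem _ (kapLift_evS_mem V ψ hψ p v hlt hS hS') hz g⟩ := by
  have h := residue_eval₂ V _ (kapLift_evS_mem V ψ hψ p v hlt hS hS') hz g
  rw [← h]
  congr 1
  refine (kapLift_unique p _ _ _ fun a => ?_).symm
  rw [← residue_evS V ψ hψ v hS a]
  change IsLocalRing.residue V _ = IsLocalRing.residue V _
  congr 1
  exact Subtype.ext (kapLift_toKap p _ hS' a)

end

lemma valuation_sum_conj_sub_lt_one [CharZero K] {Ω : Type*} [Field Ω] (V : ValuationSubring Ω)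
    (ψ : MvPolynomial ι K →+* Ω) (hψ : ∀ a, ψ a ∈ V) (p : MvPolynomial ι K) [hp : Fact (Prime p)]
    (hlt : ∀ a, V.valuation (ψ a) < 1 ↔ p ∣ a) (hp0 : ψ p ≠ 0) {v : ι → K}
    (hv : MvPolynomial.eval v (MvPolynomial.homogeneousComponent p.totalDegree p) ≠ 0)
    {m : ℕ} (S : Fin m → Ω) (hS : ∀ j a, evS ψ v (S j) a = 0 ↔ p ∣ a)
    (hprod : ∏ j, (X - C (S j)) = (linePoly p v).map ψ)
    {f : Polynomial (MvPolynomial ι K)} {f₁ f₂ : Polynomial (Kap p)} (h₁ : f₁.Monic) (h₂ : f₂.Monic)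
    (hf : f.map (toKap p) = f₁ * f₂) {z : Ω} (hz : z ∈ V) (w : V)
    (hw : eval₂ (kapLift p (resHom V _ hψ) fun a => (resHom_eq_zero_iff V _ hψ a).trans (hlt a))
      (IsLocalRing.residue V ⟨z, hz⟩) (derivative f₁ * f₂) = IsLocalRing.residue V w) :
    V.valuation (ψ p * (-∑ j, eval₂ (kapLift p (evS ψ v (S j)) (hS j)) z
      (derivative f₁ * f₂) / S j) - ψ (dirDeriv v p) * w) < 1 := by
  classical
  have hroot : ∀ j, eval₂ ψ (S j) (linePoly p v) = 0 := by
    intro j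
    rw [← eval_map, ← hprod, eval_prod]
    exact Finset.prod_eq_zero (Finset.mem_univ j) (by simp)
  have hSV : ∀ j, S j ∈ V := fun j => V.mem_of_isIntegral_eval₂ ψ hψ (monic_linePoly hv) (hroot j)
  let s : Fin m → V := fun j => ⟨S j, hSV j⟩
  let ρ := resHom V ψ hψ
  have hprodV : ∏ j, (X - C (s j)) =
      (linePoly p v).map (ψ.codRestrict V.toSubring hψ) := by
    apply map_injective (algebraMap V Ω) Subtype.val_injective
    rw [Polynomial.map_prod, map_map]
    simp only [Polynomial.map_sub, map_X, map_C]
    exact hprod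
  have hprodρ : ∏ j, (X - C (IsLocalRing.residue V (s j))) = (linePoly p v).map ρ := by
    have := congrArg (map (IsLocalRing.residue V)) hprodV
    rw [Polynomial.map_prod, map_map] at this
    simp only [Polynomial.map_sub, map_X, map_C] at this
    exact this
  have hρp : ρ p = 0 := (resHom_eq_zero_iff _ _ _ _).mpr ((hlt p).mpr dvd_rfl)
  have hρd : ρ (dirDeriv v p) ≠ 0 := by
    rw [ne_eq, resHom_eq_zero_iff, hlt]
    exact not_dvd_dirDeriv hp.out hv
  obtain ⟨c, hCu, hc⟩ : ∃ c : MvPolynomial ι K, IsUnit c ∧ ∀ i, (linePoly p v).coeff i =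
      c * (shift v p).coeff i :=
    ⟨_, (IsUnit.mk0 _ (inv_ne_zero hv)).map MvPolynomial.C, coeff_linePoly⟩
  obtain ⟨j₀, -, hj₀⟩ : ∃ j ∈ Finset.univ, -IsLocalRing.residue V (s j) = 0 := by
    rw [← Finset.prod_eq_zero_iff]
    have := congrArg (eval 0) hprodρ
    rw [eval_prod, ← coeff_zero_eq_eval_zero, coeff_map, hc, shift_coeff_zero,
      map_mul, hρp, mul_zero] at this
    simpa using this
  rw [neg_eq_zero] at hj₀
  have hsplit : ∏ j, (-S j) = -S j₀ * ∏ j ∈ Finset.univ.erase j₀, -S j :=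
    (Finset.mul_prod_erase _ _ (Finset.mem_univ j₀)).symm
  have hcoeff : ∏ j ∈ Finset.univ.erase j₀, (-IsLocalRing.residue V (s j)) =
      ρ c * ρ (dirDeriv v p) := by
    have := congrArg (fun q => coeff q 1) hprodρ
    rw [← Finset.mul_prod_erase _ _ (Finset.mem_univ j₀), hj₀, C_0, sub_zero] at this
    simp only [coeff_X_mul, coeff_map, hc, coeff_one_shift] at this
    rw [map_mul, coeff_zero_eq_eval_zero, eval_prod] at this
    simpa using this
  have hunit : ∀ j, j ≠ j₀ → V.valuation (S j) = 1 := by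
    intro j hj
    refine le_antisymm ((V.valuation_le_one_iff _).mpr (hSV j)) (not_lt.mp fun h => ?_)
    have h0 := (V.residue_eq_zero_iff' (s j)).mpr h
    have : ∏ j ∈ Finset.univ.erase j₀, (-IsLocalRing.residue V (s j)) = 0 :=
      Finset.prod_eq_zero (i := j) (by simp [hj]) (by rw [h0, neg_zero])
    rw [hcoeff] at this
    exact mul_ne_zero ((hCu.map ρ).ne_zero) hρd this
  have hS₀ : V.valuation (S j₀) < 1 := (V.residue_eq_zero_iff' (s j₀)).mp hj₀
  have hψp : V.valuation (ψ p) < 1 := (hlt p).mpr dvd_rfl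
  have hψc : V.valuation (ψ c) = 1 := by
    refine le_antisymm ((V.valuation_le_one_iff _).mpr (hψ c)) (not_lt.mp fun h => ?_)
    exact hp.out.not_isUnit (isUnit_of_dvd_unit ((hlt c).mp h) hCu)
  have hconst : ψ c * ψ p = - S j₀ * ∏ j ∈ Finset.univ.erase j₀, (- S j) := by
    have := congrArg (eval 0) hprod
    rw [eval_prod, ← coeff_zero_eq_eval_zero, coeff_map, hc, shift_coeff_zero,
      map_mul] at this
    rw [← this, ← hsplit]
    simp
  have hS₀0 : S j₀ ≠ 0 := by
    intro h0
    rw [h0, neg_zero, zero_mul] at hconst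
    exact mul_ne_zero ((hCu.map ψ).ne_zero) hp0 hconst
  set q : Fin m → Ω := fun j => eval₂ (kapLift p (evS ψ v (S j)) (hS j)) z (derivative f₁ * f₂)
    with hq
  have hqV : ∀ j, q j ∈ V := by
    intro j
    set χ := kapLift p (evS ψ v (S j)) (hS j) with hχ
    have hfχ : f₁.map χ * f₂.map χ = f.map (evS ψ v (S j)) := by
      rw [← Polynomial.map_mul, ← hf, map_map, hχ, kapLift_comp]
    have := V.scale_eval_derivative_mem (h₁.map χ) (h₂.map χ) (one_mem V)
      (by rwa [one_mul]) (fun i => by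
        rw [scaleRoots_one, hfχ, coeff_map]; exact evS_mem V ψ hψ v (hSV j) _)
    rwa [one_pow, one_mul, derivative_map, ← Polynomial.map_mul, eval_map] at this
  have hmain : V.valuation ((∏ j ∈ Finset.univ.erase j₀, (- S j)) * q j₀ -
      ψ c * (ψ (dirDeriv v p) * w)) < 1 := by
    have hqr := residue_eval₂_kapLift V ψ hψ p v hlt hS₀ (hS j₀) hz (derivative f₁ * f₂)
    rw [hw] at hqr
    have h0 : IsLocalRing.residue V ((∏ j ∈ Finset.univ.erase j₀, (- s j)) * ⟨q j₀, hqV j₀⟩ -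
        ⟨ψ c, hψ c⟩ * (⟨ψ (dirDeriv v p), hψ _⟩ * w)) = 0 := by
      rw [map_sub, map_mul, map_mul, map_mul, map_prod, ← hqr]
      simp only [map_neg]
      rw [hcoeff, sub_eq_zero, mul_assoc]
      rfl
    rw [V.residue_eq_zero_iff'] at h0
    convert h0 using 2
    push_cast
    simp [s]
  have hrest : V.valuation (∑ j ∈ Finset.univ.erase j₀, ψ c * (ψ p * (q j / S j))) < 1 := by
    refine Valuation.map_sum_lt _ one_ne_zero fun j hj => ?_
    rw [map_mul, map_mul, map_div₀, hψc, hunit j (Finset.ne_of_mem_erase hj), one_mul, div_one]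
    exact (mul_le_of_le_one_right' ((V.valuation_le_one_iff _).mpr (hqV j))).trans_lt hψp
  have hfin : ψ c * (ψ p * (-∑ j, q j / S j) - ψ (dirDeriv v p) * w) =
      ((∏ j ∈ Finset.univ.erase j₀, (- S j)) * q j₀ - ψ c * (ψ (dirDeriv v p) * w)) -
        ∑ j ∈ Finset.univ.erase j₀, ψ c * (ψ p * (q j / S j)) := by
    rw [← Finset.add_sum_erase _ _ (Finset.mem_univ j₀), ← Finset.mul_sum, ← Finset.mul_sum]
    have : ψ c * (ψ p * (q j₀ / S j₀)) = -((∏ j ∈ Finset.univ.erase j₀, (- S j)) * q j₀) := by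
      rw [← mul_assoc, hconst]
      field_simp
    linear_combination -this
  have := V.valuation.map_sub_lt hmain hrest
  rwa [← hfin, map_mul, hψc, one_mul] at this

end LocalRes

section Extend

variable {F Ω : Type*} [Field F] [Field Ω]

lemma ValuationSubring.exists_extension (φ : F →+* Ω) (O : ValuationSubring F) :
    ∃ V : ValuationSubring Ω, ∀ x, φ x ∈ V ↔ x ∈ O := by
  obtain ⟨V, hV, hloc⟩ := IsLocalRing.exists_factor_valuationRing (φ.comp O.subtype)
  refine ⟨V, fun x => ⟨fun hx => ?_, fun hx => hV ⟨x, hx⟩⟩⟩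
  by_contra hxO
  have hx' : x⁻¹ ∈ O := (O.mem_or_inv_mem x).resolve_left hxO
  have hx0 : x ≠ 0 := by rintro rfl; exact hxO O.zero_mem
  have h1 : IsUnit (((φ.comp O.subtype).codRestrict V.toSubring hV) ⟨x⁻¹, hx'⟩) := by
    refine IsUnit.of_mul_eq_one ⟨φ x, hx⟩ (Subtype.ext ?_)
    change φ x⁻¹ * φ x = 1
    rw [← map_mul, inv_mul_cancel₀ hx0, map_one]
  obtain ⟨u, hu⟩ := (hloc.map_nonunit _ h1).exists_right_inv
  apply hxO
  have h2 := congrArg Subtype.val hu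
  change x⁻¹ * (u : F) = 1 at h2
  have : x = u := by rw [← mul_one x, ← h2, mul_inv_cancel_left₀ hx0]
  exact this ▸ u.2

lemma ValuationSubring.valuation_lt_one_iff_inv (O : ValuationSubring F) (x : F) :
    O.valuation x < 1 ↔ x = 0 ∨ x⁻¹ ∉ O := by
  by_cases hx : x = 0
  · simp [hx]
  rw [← O.valuation_le_one_iff, map_inv₀, inv_le_one₀ (by
    rw [zero_lt_iff]; exact (Valuation.ne_zero_iff _).mpr hx), not_le]
  simp [hx]

lemma ValuationSubring.valuation_map_lt_one_iff {φ : F →+* Ω} {O : ValuationSubring F}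
    {V : ValuationSubring Ω} (h : ∀ x, φ x ∈ V ↔ x ∈ O) (x : F) :
    V.valuation (φ x) < 1 ↔ O.valuation x < 1 := by
  rw [valuation_lt_one_iff_inv, valuation_lt_one_iff_inv, ← map_inv₀, h, map_eq_zero]

lemma ValuationSubring.mul_mem_iff_of_unit (O : ValuationSubring F) {u x : F}
    (hu : O.valuation u = 1) : u * x ∈ O ↔ x ∈ O := by
  rw [← O.valuation_le_one_iff, map_mul, hu, one_mul, O.valuation_le_one_iff]

end Extend

section Log

open Polynomial

variable {K ι F : Type*} [Field K] [Field F] [Algebra (MvPolynomial ι K) F]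
  [FaithfulSMul (MvPolynomial ι K) F]

lemma dirDeriv_sub (v w : ι → K) (p : MvPolynomial ι K) :
    dirDeriv (v - w) p = dirDeriv v p - dirDeriv w p := by
  have : dirDeriv (v - w) = dirDeriv v - dirDeriv w :=
    MvPolynomial.derivation_ext fun i => by simp [dirDeriv, MvPolynomial.mkDerivation_X]
  rw [this]; rfl

namespace PrimElt.IsGood

variable {E : PrimElt (MvPolynomial ι K) F} {O : ValuationSubring F} {p : MvPolynomial ι K}

/-- The kernel of evaluation at the residue class of the generator determines a good place. -/
lemma eq_of_dvd {A : Type*} [CommRing A] [Algebra A F] [IsDomain A] [UniqueFactorizationMonoid A]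
    [FaithfulSMul A F] {E : PrimElt A F} {O O' : ValuationSubring F} {p : A} [Fact (Prime p)]
    (hO : E.IsGood O p) (hO' : E.IsGood O' p)
    (h : ∀ g : Polynomial (Kap p), eval₂ (kapLift p (resHom O (algebraMap A F) hO.mem)
      fun a => (resHom_eq_zero_iff _ _ _ a).trans (hO.lt_one a))
        (IsLocalRing.residue O ⟨E.y, hO.y_mem⟩) g = 0 ↔
      eval₂ (kapLift p (resHom O' (algebraMap A F) hO'.mem)
      fun a => (resHom_eq_zero_iff _ _ _ a).trans (hO'.lt_one a))
        (IsLocalRing.residue O' ⟨E.y, hO'.y_mem⟩) g = 0) : O = O' := by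
  refine hO.eq_of_center hO' fun a => ?_
  have := h (a.map (toKap p))
  rw [eval₂_map, eval₂_map, kapLift_comp, kapLift_comp, eval₂_resHom_eq_zero_iff,
    eval₂_resHom_eq_zero_iff] at this
  exact this

variable [CharZero K]

/-- At every good place other than `O`, the residual element is integral. -/
lemma isResElt_mem (hO : E.IsGood O p) [hp : Fact (Prime p)] {v : ι → K}
    (hv : MvPolynomial.eval v (MvPolynomial.homogeneousComponent p.totalDegree p) ≠ 0)
    {f₁ f₂ : Polynomial (Kap p)} (h₁ : f₁.Monic) (h₂ : f₂.Monic)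
    (hf : E.f.map (toKap p) = f₁ * f₂) {G : F} (hG : E.IsResElt p v (derivative f₁ * f₂) G)
    (w : F) (hw : w ∈ O) (hw' : 
      eval₂ (kapLift p (resHom O (algebraMap _ F) hO.mem) fun a =>
        (resHom_eq_zero_iff O _ hO.mem a).trans (hO.lt_one a))
      (IsLocalRing.residue O ⟨E.y, hO.y_mem⟩) (derivative f₁ * f₂) =
        IsLocalRing.residue O ⟨w, hw⟩) :
    aeval E.y (derivative E.f) * G - algebraMap _ F (dirDeriv v p) / algebraMap _ F p * w ∈ O := by
  let φ := algebraMap F (AlgebraicClosure F)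
  obtain ⟨V, hV⟩ := O.exists_extension φ
  have hV' := ValuationSubring.valuation_map_lt_one_iff hV
  obtain ⟨m, S, hS, hprod, hτ⟩ := hG φ
  let ψ := φ.comp (algebraMap (MvPolynomial ι K) F)
  have hψ : ∀ a, ψ a ∈ V := fun a => (hV _).mpr (hO.mem a)
  have hlt : ∀ a, V.valuation (ψ a) < 1 ↔ p ∣ a := fun a => (hV' _).trans (hO.lt_one a)
  have hp0 : ψ p ≠ 0 := (_root_.map_ne_zero φ).mpr hO.p_ne_zero
  -- the map of residue fields
  let ρ : IsLocalRing.ResidueField O →+* IsLocalRing.ResidueField V :=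
    Ideal.Quotient.lift _ ((IsLocalRing.residue V).comp
      ((φ.comp O.subtype).codRestrict V.toSubring fun x => (hV _).mpr x.2)) fun a ha => by
      change IsLocalRing.residue V ⟨φ a, _⟩ = 0
      rw [V.residue_eq_zero_iff']
      refine (hV' _).mpr ?_
      rw [← O.residue_eq_zero_iff']
      exact Ideal.Quotient.eq_zero_iff_mem.mpr ha
  have hρ : ∀ (x : F) (hx : x ∈ O), ρ (IsLocalRing.residue O ⟨x, hx⟩) =
      IsLocalRing.residue V ⟨φ x, (hV _).mpr hx⟩ := fun x hx => rfl
  have key := valuation_sum_conj_sub_lt_one V ψ hψ p hlt hp0 hv S hS hprod h₁ h₂ hf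
    (z := φ E.y) ((hV _).mpr hO.y_mem) ⟨φ w, (hV _).mpr hw⟩ (by
      have h3 := congrArg ρ hw'
      rw [hρ, hom_eval₂, hρ] at h3
      rw [← h3]
      congr 1
      symm
      refine kapLift_unique _ _ _ _ fun a => ?_
      rw [RingHom.comp_apply, kapLift_toKap]
      exact hρ _ (hO.mem a))
  rw [← hτ] at key
  change V.valuation (φ (algebraMap _ F p) * (φ _ * φ G) -
    φ (algebraMap _ F (dirDeriv v p)) * φ w) < 1 at key
  rw [← map_mul, ← map_mul, ← map_mul, ← map_sub, hV'] at key
  have h4 := hO.div_mem key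
  rw [sub_div, mul_div_cancel_left₀ _ hO.p_ne_zero, mul_div_right_comm] at h4
  exact h4

/-- For every constant vector field there is an element of `F` whose only pole among
the good places is `O`, with the polar part of a logarithmic derivative, and with bounds
depending only on logarithmic derivatives of an equation of `O`. -/
lemma exists_log (hO : E.IsGood O p) (u : ι → K) : ∃ G : F,
    (∀ (V : ValuationSubring (AlgebraicClosure F)) (τ : F →+* AlgebraicClosure F)
      (c r : AlgebraicClosure F), r ∈ V →
      (∀ a : K, τ (algebraMap (MvPolynomial ι K) F (MvPolynomial.C a)) ∈ V) →
      (∀ i, r * τ (algebraMap (MvPolynomial ι K) F (MvPolynomial.X i)) ∈ V) →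
      r * τ E.y ∈ V →
      (∀ v i, c ^ i * (τ (algebraMap _ F ((dirDeriv v)^[i] p)) / τ (algebraMap _ F p)) ∈ V) →
      c * (r ^ E.degBound) ^ E.f.natDegree * (τ (aeval E.y (derivative E.f)) * τ G) ∈ V) ∧
    (∀ O' q, E.IsGood O' q → O' ≠ O → G ∈ O') ∧
    G - algebraMap _ F (dirDeriv u p) / algebraMap _ F p ∈ O := by
  have hp : Fact (Prime p) := ⟨hO.prime⟩
  obtain ⟨v, w, hvw, hv, hw⟩ := exists_sub_eval_ne_zero
    (homogeneousComponent_totalDegree_ne_zero hO.prime.ne_zero) u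
  obtain ⟨f₁, f₂, h₁, h₂, hf, hker, hf₂⟩ := hO.exists_factor
  obtain ⟨G₁, hG₁⟩ := E.exists_isResElt p hv (derivative f₁ * f₂)
  obtain ⟨G₂, hG₂⟩ := E.exists_isResElt p hw (derivative f₁ * f₂)
  refine ⟨G₁ - G₂, ?_, ?_, ?_⟩
  · intro V τ c r hr hK hx hy hc
    have e₁ := hG₁.bound hv h₁ h₂ hf V τ hr hK hx hy (hc v)
    have e₂ := hG₂.bound hw h₁ h₂ hf V τ hr hK hx hy (hc w)
    have := sub_mem e₁ e₂
    rwa [← mul_sub, ← mul_sub, ← map_sub] at this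
  · intro O' q hO' hne
    suffices H : ∀ v : ι → K,
        MvPolynomial.eval v (MvPolynomial.homogeneousComponent p.totalDegree p) ≠ 0 →
        ∀ G, E.IsResElt p v (derivative f₁ * f₂) G → G ∈ O' from
      sub_mem (H v hv G₁ hG₁) (H w hw G₂ hG₂)
    intro v hv G hG
    rw [← O'.mul_mem_iff_of_unit hO'.unit]
    by_cases hq : q ∣ p
    · have hassoc : Associated q p := hO'.prime.associated_of_dvd hO.prime hq
      have hO'p : E.IsGood O' p :=
        ⟨hO.prime, hO'.mem, fun a => (hO'.lt_one a).trans hassoc.dvd_iff_dvd_left, hO'.unit⟩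
      have h := hO'p.isResElt_mem hv h₁ h₂ hf hG 0 O'.zero_mem ?_
      · rwa [mul_zero, sub_zero] at h
      · have h0 : IsLocalRing.residue O' ⟨0, O'.zero_mem⟩ = 0 := map_zero _
        rw [h0, eval₂_mul]
        by_contra hcon
        have hf₂' := right_ne_zero_of_mul hcon
        have hy0 : eval₂ (kapLift p (resHom O' (algebraMap _ F) hO'p.mem) fun a =>
            (resHom_eq_zero_iff O' _ hO'p.mem a).trans (hO'p.lt_one a))
            (IsLocalRing.residue O' ⟨E.y, hO'p.y_mem⟩) f₁ = 0 := by
          have h5 : eval₂ (kapLift p (resHom O' (algebraMap _ F) hO'p.mem) fun a =>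
            (resHom_eq_zero_iff O' _ hO'p.mem a).trans (hO'p.lt_one a))
            (IsLocalRing.residue O' ⟨E.y, hO'p.y_mem⟩) (E.f.map (toKap p)) = 0 := by
            rw [eval₂_map, kapLift_comp, eval₂_resHom_eq_zero_iff]
            have := E.root
            rw [aeval_def] at this
            rw [this, map_zero]
            exact zero_lt_one
          rw [hf, eval₂_mul] at h5
          exact (mul_eq_zero.mp h5).resolve_right hf₂'
        refine hne (hO.eq_of_dvd hO'p fun g => ?_).symm
        have hmax : Irreducible f₁ := by
          have hp1 : Prime f₁ := by
            refine ⟨h₁.ne_zero, fun hu => ?_, fun a b hab => ?_⟩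
            · have := (hker 1).mpr hu.dvd
              rw [eval₂_one] at this
              exact one_ne_zero this
            · rwa [← hker, ← hker, ← mul_eq_zero, ← eval₂_mul, hker]
          exact hp1.irreducible
        rw [hker]
        refine ⟨fun ⟨t, ht⟩ => by rw [ht, eval₂_mul, hy0, zero_mul], fun hg => ?_⟩
        by_contra hnd
        obtain ⟨s, t, hst⟩ := (hmax.coprime_iff_not_dvd).mpr hnd
        have h6 := congrArg (eval₂ (kapLift p (resHom O' (algebraMap _ F) hO'p.mem) fun a =>
            (resHom_eq_zero_iff O' _ hO'p.mem a).trans (hO'p.lt_one a))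
            (IsLocalRing.residue O' ⟨E.y, hO'p.y_mem⟩)) hst
        rw [eval₂_add, eval₂_mul, eval₂_mul, hy0, hg, mul_zero, mul_zero, add_zero,
          eval₂_one] at h6
        exact zero_ne_one h6
    · let φ := algebraMap F (AlgebraicClosure F)
      obtain ⟨V, hV⟩ := O'.exists_extension φ
      have h := hG.bound hv h₁ h₂ hf V φ (c := 1) (r := 1) V.one_mem
        (fun a => (hV _).mpr (hO'.mem _))
        (fun i => by rw [one_mul]; exact (hV _).mpr (hO'.mem _))
        (by rw [one_mul]; exact (hV _).mpr hO'.y_mem)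
        (fun i => by
          rw [one_pow, one_mul, ← map_div₀, hV, div_eq_inv_mul,
            O'.mul_mem_iff_of_unit (by rw [map_inv₀, hO'.algebraMap_eq_one hq, inv_one])]
          exact hO'.mem _)
      rwa [one_pow, one_pow, one_mul, one_mul, ← map_mul, hV] at h
  · have hw : eval₂ (kapLift p (resHom O (algebraMap _ F) hO.mem) fun a =>
        (resHom_eq_zero_iff O _ hO.mem a).trans (hO.lt_one a))
      (IsLocalRing.residue O ⟨E.y, hO.y_mem⟩) (derivative f₁ * f₂) =
        IsLocalRing.residue O ⟨aeval E.y (derivative E.f), hO.aeval_mem _⟩ := by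
      have h5 := residue_eval₂ O (algebraMap (MvPolynomial ι K) F) hO.mem hO.y_mem (derivative E.f)
      refine Eq.trans ?_ h5
      have h6 : eval₂ (resHom O (algebraMap (MvPolynomial ι K) F) hO.mem)
          (IsLocalRing.residue O ⟨E.y, hO.y_mem⟩) (derivative E.f) =
        eval₂ (kapLift p (resHom O (algebraMap _ F) hO.mem) fun a =>
        (resHom_eq_zero_iff O _ hO.mem a).trans (hO.lt_one a))
          (IsLocalRing.residue O ⟨E.y, hO.y_mem⟩) (derivative (E.f.map (toKap p))) := by
        rw [derivative_map, eval₂_map, kapLift_comp]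
      rw [h6, hf, derivative_mul, eval₂_add, eval₂_mul (p := f₁), (hker f₁).mpr dvd_rfl, zero_mul,
        add_zero]
    have e₁ := hO.isResElt_mem hv h₁ h₂ hf hG₁ _ (hO.aeval_mem _) hw
    have e₂ := hO.isResElt_mem ‹_› h₁ h₂ hf hG₂ _ (hO.aeval_mem _) hw
    have h := sub_mem e₁ e₂
    rw [← O.mul_mem_iff_of_unit hO.unit]
    convert h using 1
    rw [← hvw, dirDeriv_sub, map_sub]
    ring

end PrimElt.IsGood

end Log

section Derivations

open TensorProduct

lemma exists_derivation_extending {K ι F : Type*} [Field K] [CharZero K] [Field F] [Algebra K F]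
    [Algebra (MvPolynomial ι K) F] [IsScalarTower K (MvPolynomial ι K) F]
    [FaithfulSMul (MvPolynomial ι K) F] [Algebra.IsAlgebraic (MvPolynomial ι K) F] :
    ∃ D : ι → Derivation K F F, ∀ l a, D l (algebraMap (MvPolynomial ι K) F a) =
      algebraMap _ F (MvPolynomial.pderiv l a) := by
  let k := FractionRing (MvPolynomial ι K)
  let _ : Algebra k F := FractionRing.liftAlgebra _ _
  have : IsScalarTower (MvPolynomial ι K) k F := FractionRing.isScalarTower_liftAlgebra _ _
  have : Algebra.IsAlgebraic k F :=
    (IsFractionRing.comap_isAlgebraic_iff (A := MvPolynomial ι K)).mp inferInstance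
  have : CharZero k := charZero_of_injective_algebraMap (algebraMap K k).injective
  have e₁ : Algebra.FormallyEtale (MvPolynomial ι K) k :=
    Algebra.FormallyEtale.of_isLocalization (nonZeroDivisors _)
  have e₂ : Algebra.FormallyEtale k F := Algebra.FormallyEtale.of_isSeparable k F
  have e : Algebra.FormallyEtale (MvPolynomial ι K) F := Algebra.FormallyEtale.comp _ k F
  let T := KaehlerDifferential.tensorKaehlerEquivOfFormallyEtale K (MvPolynomial ι K) F
  let d : ι → Derivation K (MvPolynomial ι K) F := fun l =>
    (Algebra.linearMap (MvPolynomial ι K) F).compDer (MvPolynomial.pderiv l)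
  let L : ι → (Ω[F⁄K] →ₗ[F] F) := fun l =>
    ((d l).liftKaehlerDifferential.liftBaseChange F) ∘ₗ T.symm.toLinearMap
  refine ⟨fun l => (L l).compDer (KaehlerDifferential.D K F), fun l a => ?_⟩
  change (d l).liftKaehlerDifferential.liftBaseChange F
    (T.symm (KaehlerDifferential.D K F (algebraMap _ F a))) = _
  rw [KaehlerDifferential.tensorKaehlerEquivOfFormallyEtale_symm_D_algebraMap,
    LinearMap.liftBaseChange_tmul, one_smul, Derivation.liftKaehlerDifferential_comp_D]
  rfl

end Derivations

section DirDeriv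

variable {K ι : Type*} [Field K]

lemma dirDeriv_single [DecidableEq ι] (l : ι) (a : MvPolynomial ι K) :
    dirDeriv (Pi.single l 1) a = MvPolynomial.pderiv l a := by
  have : dirDeriv (K := K) (Pi.single l 1) = MvPolynomial.pderiv l :=
    MvPolynomial.derivation_ext fun i => by
      rw [dirDeriv, MvPolynomial.mkDerivation_X, MvPolynomial.pderiv_X, Pi.single_apply,
        Pi.single_apply]
      split_ifs <;> simp
  rw [this]

lemma Derivation.sum_apply' {κ A M : Type*} [CommRing A] [Algebra K A] [AddCommGroup M]
    [Module A M] [Module K M] (s : Finset κ) (D : κ → Derivation K A M) (a : A) :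
    (∑ i ∈ s, D i) a = ∑ i ∈ s, D i a := by
  rw [← Derivation.coeFnAddMonoidHom_apply, map_sum, Finset.sum_apply]
  rfl

/-- The chain rule. -/
lemma Derivation.apply_algHom_eq_sum [Fintype ι] {F : Type*} [Field F] [Algebra K F]
    (D : Derivation K F F) (ψ : MvPolynomial ι K →ₐ[K] F) (a : MvPolynomial ι K) :
    D (ψ a) = ∑ l, ψ (MvPolynomial.pderiv l a) * D (ψ (MvPolynomial.X l)) := by
  classical
  induction a using MvPolynomial.induction_on with
  | C c =>
    rw [← MvPolynomial.algebraMap_eq, AlgHom.commutes, Derivation.map_algebraMap]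
    exact (Finset.sum_eq_zero fun l _ => by
      rw [Derivation.map_algebraMap, map_zero, zero_mul]).symm
  | add a b ha hb => simp only [map_add, ha, hb, add_mul, Finset.sum_add_distrib]
  | mul_X a i ha =>
    rw [map_mul, Derivation.leibniz, ha, smul_eq_mul, smul_eq_mul]
    simp only [Derivation.leibniz, MvPolynomial.pderiv_X, smul_eq_mul, map_add, map_mul, add_mul,
      Finset.sum_add_distrib, Finset.mul_sum]
    congr 1
    · rw [Finset.sum_eq_single i]
      · simp
      · intro j _ hj
        rw [Pi.single_eq_of_ne' hj]; simp
      · simp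
    · exact Finset.sum_congr rfl fun l _ => by ring

lemma dirDeriv_eq_sum [Fintype ι] (v : ι → K) (a : MvPolynomial ι K) :
    dirDeriv v a = ∑ l, MvPolynomial.C (v l) * MvPolynomial.pderiv l a := by
  classical
  have : dirDeriv v = ∑ l, MvPolynomial.C (v l) • MvPolynomial.pderiv (R := K) l :=
    MvPolynomial.derivation_ext fun i => by
      rw [Derivation.sum_apply', dirDeriv, MvPolynomial.mkDerivation_X, Finset.sum_eq_single i]
      · rw [Derivation.smul_apply, MvPolynomial.pderiv_X_self, smul_eq_mul, mul_one]
      · intro j _ hj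
        rw [Derivation.smul_apply, MvPolynomial.pderiv_X_of_ne hj.symm, smul_zero]
      · simp
  rw [this, Derivation.sum_apply']
  rfl

lemma exists_not_dvd_pderiv [CharZero K] [Fintype ι] {p : MvPolynomial ι K} (hp : Prime p) :
    ∃ l, ¬ p ∣ MvPolynomial.pderiv l p := by
  obtain ⟨v, w, -, hv, -⟩ := exists_sub_eval_ne_zero
    (homogeneousComponent_totalDegree_ne_zero hp.ne_zero) 0
  by_contra! h
  apply not_dvd_dirDeriv hp hv
  rw [dirDeriv_eq_sum]
  exact Finset.dvd_sum fun l _ => (h l).mul_left _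

end DirDeriv

section GoodDerivations

open Polynomial

variable {K ι F : Type*} [Field K] [Field F] [Algebra K F] [Algebra (MvPolynomial ι K) F]
  [IsScalarTower K (MvPolynomial ι K) F]

omit [IsScalarTower K (MvPolynomial ι K) F] in
lemma Derivation.apply_aeval_sub_mem (D : Derivation K F F) (z : F) (T : AddSubgroup F)
    (hT : ∀ (a : MvPolynomial ι K) (i : ℕ), D (algebraMap _ F a) * z ^ i ∈ T)
    (h : Polynomial (MvPolynomial ι K)) : D (aeval z h) - aeval z (derivative h) * D z ∈ T := by
  induction h using Polynomial.induction_on' with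
  | add p q hp hq =>
    have := T.add_mem hp hq
    rw [map_add, map_add, map_add, map_add]
    convert this using 1
    ring
  | monomial i a =>
    have := hT a i
    rw [aeval_monomial, derivative_monomial, aeval_monomial, Derivation.leibniz,
      Derivation.leibniz_pow, smul_eq_mul, smul_eq_mul, smul_eq_mul, nsmul_eq_mul, map_mul,
      _root_.map_natCast (algebraMap (MvPolynomial ι K) F)]
    convert this using 1
    ring

omit [IsScalarTower K (MvPolynomial ι K) F] in
/-- A derivation vanishing on the coordinate ring of affine space vanishes. -/
lemma PrimElt.derivation_eq_zero [FaithfulSMul (MvPolynomial ι K) F]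
    (E : PrimElt (MvPolynomial ι K) F) (D : Derivation K F F)
    (hD : ∀ a : MvPolynomial ι K, D (algebraMap _ F a) = 0) (g : F) : D g = 0 := by
  have h := D.apply_aeval_sub_mem (ι := ι) E.y ⊥ (fun a i => by rw [hD, zero_mul]; exact rfl)
  have hy : D E.y = 0 := by
    have := h E.f
    rw [E.root, map_zero, zero_sub, AddSubgroup.mem_bot, neg_eq_zero] at this
    exact (mul_eq_zero.mp this).resolve_left E.sep
  obtain ⟨q, a, ha, hq⟩ := E.gen g
  have h1 := h q
  rw [hy, mul_zero, sub_zero, ← hq, Derivation.leibniz, hD, smul_zero, zero_add,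
    AddSubgroup.mem_bot, smul_eq_mul] at h1
  refine (mul_eq_zero.mp h1).resolve_left ?_
  rwa [FaithfulSMul.algebraMap_eq_zero_iff]

/-- A derivation regular on affine space preserves good places. -/
lemma PrimElt.IsGood.derivation_mem [Fintype ι] [FaithfulSMul (MvPolynomial ι K) F]
    {E : PrimElt (MvPolynomial ι K) F} {O : ValuationSubring F} {p : MvPolynomial ι K}
    (hO : E.IsGood O p) (D : Derivation K F F)
    (hD : ∀ l, D (algebraMap _ F (MvPolynomial.X l : MvPolynomial ι K)) ∈ O) {g : F} (hg : g ∈ O) :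
    D g ∈ O := by
  have hA : ∀ a : MvPolynomial ι K, D (algebraMap _ F a) ∈ O := by
    intro a
    have := D.apply_algHom_eq_sum (IsScalarTower.toAlgHom K (MvPolynomial ι K) F) a
    simp only [IsScalarTower.coe_toAlgHom'] at this
    rw [this]
    exact sum_mem fun l _ => mul_mem (hO.mem _) (hD l)
  have h := D.apply_aeval_sub_mem (ι := ι) E.y O.toSubring.toAddSubgroup
    (fun a i => O.mul_mem _ _ (hA a) (pow_mem hO.y_mem i))
  have hy : D E.y ∈ O := by
    have := h E.f
    rw [E.root, map_zero, zero_sub] at this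
    exact (O.mul_mem_iff_of_unit hO.unit).mp (neg_mem_iff.mp this)
  have hp : ∀ q : Polynomial (MvPolynomial ι K), D (aeval E.y q) ∈ O := fun q => by
    have := O.add_mem _ _ (h q) (O.mul_mem _ _ (hO.aeval_mem (derivative q)) hy)
    rwa [sub_add_cancel] at this
  obtain ⟨q, b, hb, hq⟩ := hO.exists_frac hg
  have h1 := hp q
  rw [← hq, Derivation.leibniz, smul_eq_mul, smul_eq_mul] at h1
  have h2 := O.sub_mem h1 (O.mul_mem _ _ hg (hp b))
  rw [add_sub_cancel_left] at h2
  exact (O.mul_mem_iff_of_unit hb).mp h2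

end GoodDerivations

section Trdeg

variable {K ι F : Type*} [Field K] [Field F] [Algebra K F] [Finite ι]

lemma trdeg_eq_of_isAlgebraic_mvPolynomial [Algebra (MvPolynomial ι K) F]
    [IsScalarTower K (MvPolynomial ι K) F] [FaithfulSMul (MvPolynomial ι K) F]
    [Algebra.IsAlgebraic (MvPolynomial ι K) F] : Algebra.trdeg K F = Nat.card ι := by
  have := ((IsTranscendenceBasis.mvPolynomial ι K).algebraMap_comp
    (A := F)).lift_cardinalMk_eq_trdeg
  rw [← Cardinal.lift_inj, ← this, Cardinal.lift_natCast]
  simp [Nat.card, Cardinal.cast_toNat_of_lt_aleph0 (Cardinal.mk_lt_aleph0 (α := ι))]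

lemma isAlgebraic_of_trdeg_eq (h : Algebra.trdeg K F = Nat.card ι)
    (ψ : MvPolynomial ι K →ₐ[K] F) (hψ : Function.Injective ψ) :
    let _ := ψ.toRingHom.toAlgebra
    Algebra.IsAlgebraic (MvPolynomial ι K) F := by
  let _ := ψ.toRingHom.toAlgebra
  have : IsScalarTower K (MvPolynomial ι K) F := .of_algebraMap_eq fun x => (ψ.commutes x).symm
  have : FaithfulSMul (MvPolynomial ι K) F := (faithfulSMul_iff_algebraMap_injective _ _).mpr hψ
  have h1 := lift_trdeg_add_eq K (MvPolynomial ι K) F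
  have h2 : Algebra.trdeg K (MvPolynomial ι K) = Nat.card ι := by
    rw [MvPolynomial.trdeg_of_isDomain]
    simp [Nat.card, Cardinal.cast_toNat_of_lt_aleph0 (Cardinal.mk_lt_aleph0 (α := ι))]
  rw [h, h2, Cardinal.lift_natCast, Cardinal.lift_natCast] at h1
  have h3 : Algebra.trdeg (MvPolynomial ι K) F = 0 := by
    rw [← Cardinal.lift_eq_zero]
    exact Cardinal.eq_of_add_eq_add_left (h1.trans (add_zero _).symm) (Cardinal.natCast_lt_aleph0)
  exact trdeg_eq_zero_iff.mp h3

lemma exists_derivation_algHom [CharZero K] (h : Algebra.trdeg K F = Nat.card ι)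
    (ψ : MvPolynomial ι K →ₐ[K] F) (hψ : Function.Injective ψ) :
    ∃ D : ι → Derivation K F F, ∀ l a, D l (ψ a) = ψ (MvPolynomial.pderiv l a) := by
  have halg := isAlgebraic_of_trdeg_eq h ψ hψ
  let _ := ψ.toRingHom.toAlgebra
  have : IsScalarTower K (MvPolynomial ι K) F := .of_algebraMap_eq fun x => (ψ.commutes x).symm
  have : FaithfulSMul (MvPolynomial ι K) F := (faithfulSMul_iff_algebraMap_injective _ _).mpr hψ
  exact exists_derivation_extending

lemma exists_isIntegralElem_mul (h : Algebra.trdeg K F = Nat.card ι)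
    (ψ : MvPolynomial ι K →ₐ[K] F) (hψ : Function.Injective ψ) (z : F) :
    ∃ d ≠ 0, ψ.toRingHom.IsIntegralElem (ψ d * z) := by
  have halg := isAlgebraic_of_trdeg_eq h ψ hψ
  let _ := ψ.toRingHom.toAlgebra
  have : FaithfulSMul (MvPolynomial ι K) F := (faithfulSMul_iff_algebraMap_injective _ _).mpr hψ
  obtain ⟨d, hd, hi⟩ := (halg.isAlgebraic z).exists_integral_multiple
  exact ⟨d, hd, by rwa [Algebra.smul_def] at hi⟩

end Trdeg

section IntegralBounds

lemma isIntegral_of_forall_valuationSubring {D₀ Ω : Type*} [CommRing D₀] [Field Ω] [Algebra D₀ Ω]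
    {x : Ω} (h : ∀ V : ValuationSubring Ω, (∀ a, algebraMap D₀ Ω a ∈ V) → x ∈ V) :
    IsIntegral D₀ x := by
  by_contra hx
  let R := (integralClosure D₀ Ω).toSubring
  have hR : IsIntegrallyClosedIn R Ω :=
    inferInstanceAs (IsIntegrallyClosedIn (integralClosure D₀ Ω) Ω)
  obtain ⟨V, hV, hxV⟩ := Subring.exists_le_valuationSubring_of_isIntegrallyClosedIn (R := R) hx
  exact hxV (h V fun a => hV isIntegral_algebraMap)

variable {K D₀ k F : Type*} [Field K] [CommRing D₀] [IsDomain D₀]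
  [IsDiscreteValuationRing D₀] [Field k] [Algebra D₀ k] [IsFractionRing D₀ k] [Field F]
  [Algebra k F] [Algebra D₀ F] [IsScalarTower D₀ k F] [FiniteDimensional k F]
  [Algebra.IsSeparable k F] [Algebra K F] [Algebra K D₀] [IsScalarTower K D₀ F]

variable (k) in
include k in
lemma exists_logarithmic_bound_iterate {κ : Type*} [Fintype κ] (D : κ → Derivation K F F)
    (hD : ∀ l, ∃ c : D₀, c ≠ 0 ∧ ∀ a : D₀, IsIntegral D₀ (c • D l (algebraMap D₀ F a))) :
    ∃ c : D₀, c ≠ 0 ∧ ∀ (v : κ → K) (g : F) (i : ℕ),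
      IsIntegral D₀ (c ^ i • (((fun z => ∑ l, v l • D l z)^[i] g) / g)) := by
  have h (l) : ∃ c : D₀, c ≠ 0 ∧ ∀ g : F, IsIntegral D₀ (c • (D l g / g)) :=
    ((D l).restrictScalars ℤ).exists_logarithmic_bound (k := k) (hD l)
  choose c hc0 hc using h
  have h1 (v : κ → K) (g : F) : IsIntegral D₀ ((∏ l, c l) • ((∑ l, v l • D l g) / g)) := by
    classical
    rw [Finset.sum_div, Finset.smul_sum]
    refine IsIntegral.sum _ fun l _ => ?_
    rw [← Finset.prod_erase_mul _ _ (Finset.mem_univ l), mul_smul, smul_div_assoc,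
      smul_comm (c l), smul_comm _ (v l), ← algebraMap_smul D₀ (v l)]
    exact ((hc l g).smul _).smul _
  refine ⟨∏ l, c l, Finset.prod_ne_zero_iff.mpr fun l _ => hc0 l, fun v g i => ?_⟩
  induction i with
  | zero =>
    rw [pow_zero, one_smul, Function.iterate_zero, id]
    rcases eq_or_ne g 0 with rfl | hg
    · rw [div_zero]; exact isIntegral_zero
    · rw [div_self hg]; exact isIntegral_one
  | succ i ih =>
    rw [Function.iterate_succ_apply']
    set h := (fun z => ∑ l, v l • D l z)^[i] g
    rcases eq_or_ne h 0 with h0 | h0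
    · simp [h0, isIntegral_zero]
    · have := (h1 v h).mul ih
      rwa [smul_mul_smul_comm, div_mul_div_cancel₀ h0, ← pow_succ'] at this

end IntegralBounds

section LogBounded

variable {K ι F : Type*} [Field K] [Field F] [Algebra (MvPolynomial ι K) F]

/-- The poles of `G` are controlled by those of the logarithmic derivatives of `p`, along every
embedding of `F` in an algebraic closure. -/
def PrimElt.LogBounded (E : PrimElt (MvPolynomial ι K) F) (p : MvPolynomial ι K) (G : F) : Prop :=
  ∀ (V : ValuationSubring (AlgebraicClosure F)) (τ : F →+* AlgebraicClosure F)
    (c r : AlgebraicClosure F), r ∈ V →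
    (∀ a : K, τ (algebraMap (MvPolynomial ι K) F (MvPolynomial.C a)) ∈ V) →
    (∀ i, r * τ (algebraMap (MvPolynomial ι K) F (MvPolynomial.X i)) ∈ V) →
    r * τ E.y ∈ V →
    (∀ v i, c ^ i * (τ (algebraMap _ F ((dirDeriv v)^[i] p)) / τ (algebraMap _ F p)) ∈ V) →
    c * (r ^ E.degBound) ^ E.f.natDegree *
      (τ (Polynomial.aeval E.y (Polynomial.derivative E.f)) * τ G) ∈ V

variable [Fintype ι] [FaithfulSMul (MvPolynomial ι K) F] [Algebra K F]
  [IsScalarTower K (MvPolynomial ι K) F]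

lemma PrimElt.derivation_apply_eq_sum (E : PrimElt (MvPolynomial ι K) F)
    {D : ι → Derivation K F F} (hD : ∀ l a, D l (algebraMap (MvPolynomial ι K) F a) =
      algebraMap _ F (MvPolynomial.pderiv l a)) (D' : Derivation K F F) (g : F) :
    D' g = ∑ m, D m g * D' (algebraMap (MvPolynomial ι K) F (MvPolynomial.X m)) := by
  have := E.derivation_eq_zero
    (D' - ∑ m, D' (algebraMap (MvPolynomial ι K) F (MvPolynomial.X m)) • D m) (fun a => by
      rw [Derivation.sub_apply, Derivation.sum_apply', sub_eq_zero]
      refine (D'.apply_algHom_eq_sum (IsScalarTower.toAlgHom K (MvPolynomial ι K) F) a).trans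
        (Finset.sum_congr rfl fun m _ => ?_)
      rw [Derivation.smul_apply, hD, smul_eq_mul, mul_comm]
      rfl) g
  rw [Derivation.sub_apply, Derivation.sum_apply', sub_eq_zero] at this
  rw [this]
  exact Finset.sum_congr rfl fun m _ => mul_comm _ _

variable {D₀ k : Type*} [CommRing D₀] [IsDomain D₀]
  [IsDiscreteValuationRing D₀] [Field k] [Algebra D₀ k] [IsFractionRing D₀ k]
  [Algebra k F] [Algebra D₀ F] [IsScalarTower D₀ k F] [FiniteDimensional k F]
  [Algebra.IsSeparable k F] [Algebra K D₀] [IsScalarTower K D₀ F]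

variable (k) in
omit [IsDiscreteValuationRing D₀] [FiniteDimensional k F] in
include k in
lemma exists_smul_isIntegral_finset (s : Finset F) :
    ∃ c : D₀, c ≠ 0 ∧ ∀ z ∈ s, IsIntegral D₀ (c • z) := by
  have : Algebra.IsAlgebraic D₀ F := (IsFractionRing.comap_isAlgebraic_iff (A := D₀) (K := k)).mpr
    inferInstance
  obtain ⟨c, hc, h⟩ := Algebra.IsAlgebraic.exists_integral_multiples D₀ s
  exact ⟨c, hc, h⟩

variable (k) (D₀) in
include k in
lemma PrimElt.exists_logBounded_bound (E : PrimElt (MvPolynomial ι K) F)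
    {D : ι → Derivation K F F} (hD : ∀ l a, D l (algebraMap (MvPolynomial ι K) F a) =
      algebraMap _ F (MvPolynomial.pderiv l a))
    (hstab : ∀ l (x : D₀), ∃ x' : D₀, D l (algebraMap D₀ F x) = algebraMap D₀ F x')
    (ρ : F →ₐ[K] F) {D' : ι → Derivation K F F}
    (hD' : ∀ l a, D' l (ρ (algebraMap (MvPolynomial ι K) F a)) =
      ρ (algebraMap _ F (MvPolynomial.pderiv l a))) :
    ∃ c : D₀, c ≠ 0 ∧ ∀ p G, E.LogBounded p G → IsIntegral D₀ (c • ρ G) := by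
  classical
  obtain ⟨c, hc0, hc⟩ := exists_logarithmic_bound_iterate (K := K) (D₀ := D₀) k D' fun l => by
    obtain ⟨c, hc0, hc⟩ := exists_smul_isIntegral_finset (D₀ := D₀) k (Finset.univ.image fun m =>
      D' l (algebraMap (MvPolynomial ι K) F (MvPolynomial.X m)))
    refine ⟨c, hc0, fun a => ?_⟩
    rw [E.derivation_apply_eq_sum hD, Finset.smul_sum]
    refine IsIntegral.sum _ fun m _ => ?_
    obtain ⟨x', hx'⟩ := hstab m a
    rw [hx', ← mul_smul_comm]
    exact isIntegral_algebraMap.mul (hc _ (Finset.mem_image_of_mem _ (Finset.mem_univ m)))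
  obtain ⟨r, hr0, hr⟩ := exists_smul_isIntegral_finset (D₀ := D₀) k (insert (ρ E.y)
    (Finset.univ.image fun m => ρ (algebraMap (MvPolynomial ι K) F (MvPolynomial.X m))))
  obtain ⟨d, hd0, hd⟩ := exists_smul_isIntegral_finset (D₀ := D₀) k
    {(ρ (Polynomial.aeval E.y (Polynomial.derivative E.f)))⁻¹}
  refine ⟨d * (c * (r ^ E.degBound) ^ E.f.natDegree), mul_ne_zero hd0 (mul_ne_zero hc0
    (pow_ne_zero _ (pow_ne_zero _ hr0))), fun p G hG => ?_⟩
  have hit (v : ι → K) (i : ℕ) (a : MvPolynomial ι K) :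
      (fun z => ∑ l, v l • D' l z)^[i] (ρ (algebraMap _ F a)) =
        ρ (algebraMap _ F ((dirDeriv v)^[i] a)) := by
    induction i generalizing a with
    | zero => rfl
    | succ i ih =>
      rw [Function.iterate_succ_apply, Function.iterate_succ_apply, ← ih, dirDeriv_eq_sum]
      congr 1
      simp only [hD', map_sum, map_mul]
      refine Finset.sum_congr rfl fun l _ => ?_
      rw [Algebra.smul_def, ← MvPolynomial.algebraMap_eq, ← IsScalarTower.algebraMap_apply,
        AlgHom.commutes]
  rw [← isIntegral_algebraMap_iff (A := F) (B := AlgebraicClosure F)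
    (algebraMap F (AlgebraicClosure F)).injective]
  refine isIntegral_of_forall_valuationSubring fun V hV => ?_
  have h_int {z : F} (hz : IsIntegral D₀ z) : algebraMap F (AlgebraicClosure F) z ∈ V := by
    obtain ⟨q, hq, h⟩ := hz
    refine V.mem_of_isIntegral_eval₂ (algebraMap D₀ (AlgebraicClosure F)) hV hq ?_
    have := congrArg (algebraMap F (AlgebraicClosure F)) h
    rwa [Polynomial.hom_eval₂, map_zero, ← IsScalarTower.algebraMap_eq] at this
  have key := hG V ((algebraMap F (AlgebraicClosure F)).comp ρ.toRingHom)
    (algebraMap D₀ _ c) (algebraMap D₀ _ r) (hV _) ?_ ?_ ?_ ?_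
  · have hdV := h_int (hd _ (Finset.mem_singleton_self _))
    have hne : ρ (Polynomial.aeval E.y (Polynomial.derivative E.f)) ≠ 0 :=
      (_root_.map_ne_zero ρ).mpr E.sep
    have := mul_mem hdV key
    convert this using 1
    simp only [Algebra.smul_def, map_mul, map_pow, RingHom.comp_apply, AlgHom.toRingHom_eq_coe,
      RingHom.coe_coe, map_inv₀, ← IsScalarTower.algebraMap_apply D₀ F (AlgebraicClosure F)]
    have hne' := (_root_.map_ne_zero (algebraMap F (AlgebraicClosure F))).mpr hne
    field_simp
  · intro a
    have : algebraMap (MvPolynomial ι K) F (MvPolynomial.C a) =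
        algebraMap D₀ F (algebraMap K D₀ a) := by
      rw [← MvPolynomial.algebraMap_eq, ← IsScalarTower.algebraMap_apply,
        ← IsScalarTower.algebraMap_apply]
    rw [← MvPolynomial.algebraMap_eq, ← IsScalarTower.algebraMap_apply, RingHom.comp_apply]
    change algebraMap F _ (ρ _) ∈ V
    rw [AlgHom.commutes, IsScalarTower.algebraMap_apply K D₀ F,
      ← IsScalarTower.algebraMap_apply D₀ F (AlgebraicClosure F)]
    exact hV _
  · intro i
    have := h_int (hr _ (Finset.mem_insert_of_mem
      (Finset.mem_image_of_mem _ (Finset.mem_univ i))))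
    rwa [Algebra.smul_def, map_mul, ← IsScalarTower.algebraMap_apply] at this
  · have := h_int (hr _ (Finset.mem_insert_self _ _))
    rwa [Algebra.smul_def, map_mul, ← IsScalarTower.algebraMap_apply] at this
  · intro v i
    have := h_int (hc v (ρ (algebraMap _ F p)) i)
    rwa [hit, Algebra.smul_def, map_mul, ← IsScalarTower.algebraMap_apply, map_pow, map_div₀]
      at this

end LogBounded

section DVR

lemma isDiscreteValuationRing_of_zpow {K k : Type*} [Field K] [Field k] [Algebra K k]
    (D : Subalgebra K k) {π : k} (hπ : π ∈ D) (hπ' : π⁻¹ ∉ D)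
    (h : ∀ x : k, x ≠ 0 → ∃ m : ℤ, ∃ u ∈ D, u⁻¹ ∈ D ∧ x = π ^ m * u) :
    IsDiscreteValuationRing D ∧ IsFractionRing D k := by
  have hπ0 : π ≠ 0 := by
    rintro rfl
    exact hπ' (by rw [inv_zero]; exact D.zero_mem)
  have h' (x : k) (hx : x ∈ D) (hx0 : x ≠ 0) : ∃ m : ℕ, ∃ u ∈ D, u⁻¹ ∈ D ∧ x = π ^ m * u := by
    obtain ⟨m, u, hu, hu', rfl⟩ := h x hx0
    obtain ⟨n, rfl | rfl⟩ := m.eq_nat_or_neg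
    · exact ⟨n, u, hu, hu', by rw [zpow_natCast]⟩
    · rcases n with - | n
      · exact ⟨0, u, hu, hu', by simp⟩
      · refine absurd ?_ hπ'
        have hu0 : u ≠ 0 := right_ne_zero_of_mul hx0
        have := D.mul_mem (D.mul_mem hx hu') (D.pow_mem hπ n)
        convert this using 1
        rw [mul_assoc _ u, mul_inv_cancel₀ hu0, mul_one, zpow_neg, zpow_natCast]
        field_simp
        ring
  constructor
  · refine IsDiscreteValuationRing.ofHasUnitMulPowIrreducibleFactorization
      ⟨⟨π, hπ⟩, ⟨fun hu => ?_, fun a b hab => ?_⟩, fun {x} hx => ?_⟩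
    · obtain ⟨u, hu⟩ := hu
      refine hπ' ?_
      have h1 : π * ((↑u⁻¹ : D) : k) = 1 := by
        have := congrArg (Subtype.val : D → k) u.mul_inv
        rwa [hu] at this
      rw [inv_eq_of_mul_eq_one_right h1]
      exact (↑u⁻¹ : D).2
    · have hab' : π = a * b := congrArg Subtype.val hab
      have ha0 : (a : k) ≠ 0 := fun h0 => hπ0 (by rw [hab', h0, zero_mul])
      have hb0 : (b : k) ≠ 0 := fun h0 => hπ0 (by rw [hab', h0, mul_zero])
      have hunit (x : D) (hx : (x : k)⁻¹ ∈ D) (hx0 : (x : k) ≠ 0) : IsUnit x :=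
        IsUnit.of_mul_eq_one ⟨_, hx⟩ (Subtype.ext (mul_inv_cancel₀ hx0))
      obtain ⟨m, u, hu, hu', hau⟩ := h' a a.2 ha0
      obtain ⟨n, w, hw, hw', hbw⟩ := h' b b.2 hb0
      rcases m with - | m
      · exact .inl (hunit a (by rw [hau]; simpa using hu') ha0)
      rcases n with - | n
      · exact .inr (hunit b (by rw [hbw]; simpa using hw') hb0)
      refine absurd ?_ hπ'
      have : π⁻¹ = π ^ (m + n) * (u * w) := by
        rw [inv_eq_iff_eq_inv, eq_comm, inv_eq_iff_eq_inv]
        refine eq_inv_of_mul_eq_one_left ?_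
        rw [hau, hbw] at hab'
        refine mul_left_cancel₀ hπ0 ?_
        rw [mul_one]
        linear_combination -hab'
      rw [this]
      exact D.mul_mem (D.pow_mem hπ _) (D.mul_mem hu hw)
    · obtain ⟨m, u, hu, hu', hxu⟩ := h' x x.2 (fun h0 => hx (Subtype.ext h0))
      have hu0 : u ≠ 0 := by
        rintro rfl
        exact hx (Subtype.ext (by rw [hxu, mul_zero]; rfl))
      exact ⟨m, ⟨⟨u, hu⟩, ⟨_, hu'⟩, Subtype.ext (mul_inv_cancel₀ hu0),
        Subtype.ext (inv_mul_cancel₀ hu0)⟩, Subtype.ext hxu.symm⟩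
  · refine IsFractionRing.of_field D k fun z => ?_
    rcases eq_or_ne z 0 with rfl | hz
    · exact ⟨0, 1, by simp⟩
    obtain ⟨m, u, hu, hu', rfl⟩ := h z hz
    obtain ⟨n, rfl | rfl⟩ := m.eq_nat_or_neg
    · exact ⟨⟨_, D.mul_mem (D.pow_mem hπ n) hu⟩, 1, by
        rw [map_one, div_one, zpow_natCast]; rfl⟩
    · exact ⟨⟨u, hu⟩, ⟨_, D.pow_mem hπ n⟩, by
        rw [zpow_neg, zpow_natCast, mul_comm, ← div_eq_mul_inv]; rfl⟩

variable {K ι : Type*} (k : Type*) [Field K] [Field k] [Algebra (MvPolynomial ι K) k] [Algebra K k]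
  [IsScalarTower K (MvPolynomial ι K) k] [IsFractionRing (MvPolynomial ι K) k]

/-- The local ring of affine space along a prime divisor. -/
def localSubalgebra {q : MvPolynomial ι K} (hq : Prime q) : Subalgebra K k where
  carrier := {x | ∃ a b : MvPolynomial ι K, ¬ q ∣ b ∧ x * algebraMap _ k b = algebraMap _ k a}
  mul_mem' := by
    rintro x y ⟨a, b, hb, h⟩ ⟨a', b', hb', h'⟩
    refine ⟨a * a', b * b', fun hd => (hq.dvd_or_dvd hd).elim hb hb', ?_⟩
    rw [map_mul, map_mul, mul_mul_mul_comm, h, h']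
  add_mem' := by
    rintro x y ⟨a, b, hb, h⟩ ⟨a', b', hb', h'⟩
    refine ⟨a * b' + a' * b, b * b', fun hd => (hq.dvd_or_dvd hd).elim hb hb', ?_⟩
    rw [map_mul, map_add, map_mul, map_mul, ← h, ← h']
    ring
  algebraMap_mem' c := ⟨MvPolynomial.C c, 1, hq.not_dvd_one, by
    rw [map_one, mul_one, ← MvPolynomial.algebraMap_eq, ← IsScalarTower.algebraMap_apply]⟩

/-- The local ring of projective space along the hyperplane at infinity. -/
def infinitySubalgebra : Subalgebra K k where
  carrier := {x | ∃ a b : MvPolynomial ι K, b ≠ 0 ∧ a.totalDegree ≤ b.totalDegree ∧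
    x * algebraMap _ k b = algebraMap _ k a}
  mul_mem' := by
    rintro x y ⟨a, b, hb, hd, h⟩ ⟨a', b', hb', hd', h'⟩
    refine ⟨a * a', b * b', mul_ne_zero hb hb', ?_, ?_⟩
    · rw [MvPolynomial.totalDegree_mul_of_isDomain hb hb']
      exact (MvPolynomial.totalDegree_mul _ _).trans (add_le_add hd hd')
    · rw [map_mul, map_mul, mul_mul_mul_comm, h, h']
  add_mem' := by
    rintro x y ⟨a, b, hb, hd, h⟩ ⟨a', b', hb', hd', h'⟩
    refine ⟨a * b' + a' * b, b * b', mul_ne_zero hb hb', ?_, ?_⟩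
    · rw [MvPolynomial.totalDegree_mul_of_isDomain hb hb']
      refine (MvPolynomial.totalDegree_add _ _).trans (max_le ?_ ?_)
      · exact (MvPolynomial.totalDegree_mul _ _).trans (by gcongr)
      · exact (MvPolynomial.totalDegree_mul _ _).trans (by rw [add_comm]; gcongr)
    · rw [map_mul, map_add, map_mul, map_mul, ← h, ← h']
      ring
  algebraMap_mem' c := ⟨MvPolynomial.C c, 1, one_ne_zero, by simp, by
    rw [map_one, mul_one, ← MvPolynomial.algebraMap_eq, ← IsScalarTower.algebraMap_apply]⟩

omit [Algebra K k] [IsScalarTower K (MvPolynomial ι K) k] in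
lemma mvPolynomial_exists_fraction (x : k) : ∃ a b : MvPolynomial ι K, b ≠ 0 ∧
    x = algebraMap _ k a / algebraMap _ k b := by
  obtain ⟨a, b, hb, rfl⟩ := IsFractionRing.div_surjective (MvPolynomial ι K) x
  exact ⟨a, b, nonZeroDivisors.ne_zero hb, rfl⟩

lemma isDiscreteValuationRing_localSubalgebra {q : MvPolynomial ι K} (hq : Prime q) :
    IsDiscreteValuationRing (localSubalgebra k hq) ∧ IsFractionRing (localSubalgebra k hq) k := by
  have hinj := IsFractionRing.injective (MvPolynomial ι K) k
  have hne {a : MvPolynomial ι K} (ha : a ≠ 0) : algebraMap _ k a ≠ 0 :=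
    (map_ne_zero_iff _ hinj).mpr ha
  refine isDiscreteValuationRing_of_zpow _ (π := algebraMap _ k q)
    ⟨q, 1, hq.not_dvd_one, by rw [map_one, mul_one]⟩ ?_ fun x hx => ?_
  · rintro ⟨a, b, hb, h⟩
    rw [inv_mul_eq_iff_eq_mul₀ (hne hq.ne_zero), ← map_mul] at h
    exact hb ⟨a, hinj h⟩
  · obtain ⟨a, b, hb, rfl⟩ := mvPolynomial_exists_fraction (K := K) (ι := ι) k x
    have ha : a ≠ 0 := by
      rintro rfl
      simp at hx
    obtain ⟨i, a', ha', rfl⟩ := WfDvdMonoid.max_power_factor ha hq.irreducible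
    obtain ⟨j, b', hb', rfl⟩ := WfDvdMonoid.max_power_factor hb hq.irreducible
    have ha0 := hne (right_ne_zero_of_mul ha)
    have hb0 := hne (right_ne_zero_of_mul hb)
    refine ⟨i - j, algebraMap _ k a' / algebraMap _ k b', ⟨a', b', hb', div_mul_cancel₀ _ hb0⟩,
      ⟨b', a', ha', by rw [inv_div, div_mul_cancel₀ _ ha0]⟩, ?_⟩
    have := hne hq.ne_zero
    rw [zpow_sub₀ this, zpow_natCast, zpow_natCast, map_mul, map_mul, map_pow, map_pow]
    field_simp

lemma isDiscreteValuationRing_infinitySubalgebra [Nonempty ι] :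
    IsDiscreteValuationRing (infinitySubalgebra (K := K) (ι := ι) k) ∧
      IsFractionRing (infinitySubalgebra (K := K) (ι := ι) k) k := by
  have hinj := IsFractionRing.injective (MvPolynomial ι K) k
  have hne {a : MvPolynomial ι K} (ha : a ≠ 0) : algebraMap _ k a ≠ 0 :=
    (map_ne_zero_iff _ hinj).mpr ha
  obtain ⟨i₀⟩ := ‹Nonempty ι›
  let X : MvPolynomial ι K := MvPolynomial.X i₀
  have hX : X ≠ 0 := MvPolynomial.X_ne_zero i₀
  have hXd : X.totalDegree = 1 := MvPolynomial.totalDegree_X i₀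
  have hXk := hne hX
  refine isDiscreteValuationRing_of_zpow _ (π := (algebraMap _ k X)⁻¹)
    ⟨1, X, hX, by simp, by rw [map_one, inv_mul_cancel₀ hXk]⟩ ?_ fun x hx => ?_
  · rintro ⟨a, b, hb, hd, h⟩
    rw [inv_inv, ← map_mul] at h
    rw [← hinj h, MvPolynomial.totalDegree_mul_of_isDomain hX hb, hXd] at hd
    omega
  · obtain ⟨a, b, hb, rfl⟩ := mvPolynomial_exists_fraction (K := K) (ι := ι) k x
    have ha : a ≠ 0 := by
      rintro rfl
      simp at hx
    have ha0 := hne ha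
    have hb0 := hne hb
    have hda : (a * X ^ b.totalDegree).totalDegree = a.totalDegree + b.totalDegree := by
      rw [MvPolynomial.totalDegree_mul_of_isDomain ha (pow_ne_zero _ hX),
        MvPolynomial.totalDegree_X_pow]
    have hdb : (b * X ^ a.totalDegree).totalDegree = b.totalDegree + a.totalDegree := by
      rw [MvPolynomial.totalDegree_mul_of_isDomain hb (pow_ne_zero _ hX),
        MvPolynomial.totalDegree_X_pow]
    have ha' : a * X ^ b.totalDegree ≠ 0 := mul_ne_zero ha (pow_ne_zero _ hX)
    have hb' : b * X ^ a.totalDegree ≠ 0 := mul_ne_zero hb (pow_ne_zero _ hX)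
    refine ⟨b.totalDegree - a.totalDegree,
      algebraMap _ k (a * X ^ b.totalDegree) / algebraMap _ k (b * X ^ a.totalDegree),
      ⟨a * X ^ b.totalDegree, b * X ^ a.totalDegree, hb', by rw [hda, hdb, add_comm],
        div_mul_cancel₀ _ (hne hb')⟩,
      ⟨b * X ^ a.totalDegree, a * X ^ b.totalDegree, ha', by rw [hda, hdb, add_comm],
        by rw [inv_div, div_mul_cancel₀ _ (hne ha')]⟩, ?_⟩
    rw [zpow_sub₀ (inv_ne_zero hXk), zpow_natCast, zpow_natCast, map_mul, map_mul, map_pow, map_pow]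
    field_simp
    rw [← mul_pow, ← mul_pow, one_div_mul_cancel hXk, one_pow, one_pow]

lemma totalDegree_pderiv_le (l : ι) (a : MvPolynomial ι K) :
    (MvPolynomial.pderiv l a).totalDegree ≤ a.totalDegree := by
  classical
  rcases eq_or_ne (MvPolynomial.pderiv l a) 0 with h | h
  · rw [h]; simp
  rw [← dirDeriv_single, ← coeff_one_shift] at h ⊢
  exact (Nat.le_add_right _ _).trans (jointDegreeLE_shift (Pi.single l 1) le_rfl 1 h)

section

variable {k} {F : Type*} [Field F] [Algebra k F] [Algebra (MvPolynomial ι K) F]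
  [IsScalarTower (MvPolynomial ι K) k F] [Algebra K F]

omit [Algebra K k] [IsScalarTower K (MvPolynomial ι K) k] in
lemma Derivation.apply_eq_div {D : Derivation K F F} {l : ι}
    (hD : ∀ a : MvPolynomial ι K, D (algebraMap _ F a) = algebraMap _ F (MvPolynomial.pderiv l a))
    {x : k} {a b : MvPolynomial ι K} (hb : b ≠ 0)
    (h : x * algebraMap _ k b = algebraMap _ k a) :
    ∃ x' : k, D (algebraMap k F x) = algebraMap k F x' ∧ x' * algebraMap _ k (b * b) =
      algebraMap _ k (b * MvPolynomial.pderiv l a - a * MvPolynomial.pderiv l b) := by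
  have hb0 : algebraMap _ k b ≠ 0 :=
    (map_ne_zero_iff _ (IsFractionRing.injective (MvPolynomial ι K) k)).mpr hb
  have hbF := (_root_.map_ne_zero (algebraMap k F)).mpr hb0
  refine ⟨_, ?_, div_mul_cancel₀ _ (by rw [map_mul]; exact mul_ne_zero hb0 hb0)⟩
  have h1 := congrArg (fun z => D (algebraMap k F z)) h
  have h2 := congrArg (algebraMap k F) h
  simp only [map_mul, D.leibniz, ← IsScalarTower.algebraMap_apply, hD, smul_eq_mul] at h1 h2 ⊢
  rw [map_div₀, eq_div_iff (by rw [map_mul]; exact mul_ne_zero hbF hbF)]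
  simp only [map_mul, map_sub, ← IsScalarTower.algebraMap_apply]
  linear_combination algebraMap _ F b * h1 - algebraMap _ F (MvPolynomial.pderiv l b) * h2

lemma localSubalgebra_stable {D : ι → Derivation K F F}
    (hD : ∀ l (a : MvPolynomial ι K), D l (algebraMap _ F a) =
      algebraMap _ F (MvPolynomial.pderiv l a))
    {q : MvPolynomial ι K} (hq : Prime q) (l : ι) (x : localSubalgebra k hq) :
    ∃ x' : localSubalgebra k hq,
      D l (algebraMap (localSubalgebra k hq) F x) = algebraMap (localSubalgebra k hq) F x' := by
  obtain ⟨x, a, b, hb, h⟩ := x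
  obtain ⟨x', h1, h2⟩ := (D l).apply_eq_div (hD l) (by rintro rfl; exact hb (dvd_zero q)) h
  exact ⟨⟨x', _, _, fun hd => (hq.dvd_or_dvd hd).elim hb hb, h2⟩, h1⟩

lemma infinitySubalgebra_stable {D : ι → Derivation K F F}
    (hD : ∀ l (a : MvPolynomial ι K), D l (algebraMap _ F a) =
      algebraMap _ F (MvPolynomial.pderiv l a))
    (l : ι) (x : infinitySubalgebra (K := K) (ι := ι) k) :
    ∃ x' : infinitySubalgebra (K := K) (ι := ι) k,
      D l (algebraMap (infinitySubalgebra (K := K) (ι := ι) k) F x) =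
        algebraMap (infinitySubalgebra (K := K) (ι := ι) k) F x' := by
  obtain ⟨x, a, b, hb, hd, h⟩ := x
  obtain ⟨x', h1, h2⟩ := (D l).apply_eq_div (hD l) hb h
  refine ⟨⟨x', _, _, mul_ne_zero hb hb, ?_, h2⟩, h1⟩
  rw [MvPolynomial.totalDegree_mul_of_isDomain hb hb]
  refine (MvPolynomial.totalDegree_sub _ _).trans (max_le ?_ ?_)
  · exact (MvPolynomial.totalDegree_mul _ _).trans
      (add_le_add le_rfl ((totalDegree_pderiv_le _ _).trans hd))
  · exact (MvPolynomial.totalDegree_mul _ _).trans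
      (add_le_add hd (totalDegree_pderiv_le _ _))

end

lemma exists_algebraMap_eq_of_mem_localSubalgebra {x : k}
    (h : ∀ (q : MvPolynomial ι K) (hq : Prime q), x ∈ localSubalgebra k hq) :
    ∃ a : MvPolynomial ι K, algebraMap _ k a = x := by
  have hinj := IsFractionRing.injective (MvPolynomial ι K) k
  obtain ⟨a, b, hab, rfl⟩ := IsFractionRing.exists_reduced_fraction (MvPolynomial ι K) x
  have hb0 : (b : MvPolynomial ι K) ≠ 0 := nonZeroDivisors.ne_zero b.2
  by_cases hb : IsUnit (b : MvPolynomial ι K)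
  · obtain ⟨u, hu⟩ := hb
    refine ⟨a * ↑u⁻¹, ?_⟩
    rw [eq_comm, IsLocalization.mk'_eq_iff_eq_mul, ← map_mul, ← hu, mul_assoc, u.inv_mul, mul_one]
  · obtain ⟨q, hq, hqb⟩ := WfDvdMonoid.exists_irreducible_factor hb hb0
    obtain ⟨a', b', hb', hx⟩ := h q hq.prime
    have : a * b' = a' * b := by
      apply hinj
      rw [map_mul, map_mul, ← hx, mul_right_comm, IsLocalization.mk'_spec]
    rcases hq.prime.dvd_or_dvd (this ▸ hqb.mul_left a') with h1 | h1
    · exact (hq.not_isUnit (hab h1 hqb)).elim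
    · exact (hb' h1).elim

lemma exists_totalDegree_le_of_mul_mem {β : k} (hβ : β ≠ 0) : ∃ M : ℕ, ∀ a : MvPolynomial ι K,
    β * algebraMap _ k a ∈ infinitySubalgebra (K := K) (ι := ι) k → a.totalDegree ≤ M := by
  have hinj := IsFractionRing.injective (MvPolynomial ι K) k
  obtain ⟨s, t, ht, rfl⟩ := mvPolynomial_exists_fraction (K := K) (ι := ι) k β
  have hs : s ≠ 0 := by
    rintro rfl
    simp at hβ
  refine ⟨t.totalDegree, fun c hc => ?_⟩
  rcases eq_or_ne c 0 with rfl | hc0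
  · simp
  obtain ⟨a, b, hb, hd, h⟩ := hc
  have ht0 := (map_ne_zero_iff _ hinj).mpr ht
  have h1 : s * c * b = a * t := by
    apply hinj
    rw [map_mul, map_mul, map_mul, ← h]
    field_simp
  have ha : a ≠ 0 := by
    rintro rfl
    rw [zero_mul] at h1
    exact mul_ne_zero (mul_ne_zero hs hc0) hb h1
  have h2 := congrArg MvPolynomial.totalDegree h1
  rw [MvPolynomial.totalDegree_mul_of_isDomain (mul_ne_zero hs hc0) hb,
    MvPolynomial.totalDegree_mul_of_isDomain hs hc0,
    MvPolynomial.totalDegree_mul_of_isDomain ha ht] at h2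
  omega

end DVR

section Bounded

variable {K k F : Type*} [Field K] [Field k] [Algebra K k] [Field F] [Algebra k F] [Algebra K F]
  [IsScalarTower K k F]

/-- The elements of `T` have bounded denominators with respect to `D`. -/
def IsBoundedOver (D : Subalgebra K k) (T : Set F) : Prop :=
  ∃ c : D, c ≠ 0 ∧ ∀ ξ ∈ T, IsIntegral D (c • ξ)

variable {D : Subalgebra K k} {T T' : Set F}

omit [Algebra K F] [IsScalarTower K k F] in
lemma IsBoundedOver.mono (h : IsBoundedOver D T) (hT : T' ⊆ T) : IsBoundedOver D T' :=
  let ⟨c, hc, h⟩ := h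
  ⟨c, hc, fun ξ hξ => h ξ (hT hξ)⟩

omit [Algebra K F] [IsScalarTower K k F] in
lemma IsBoundedOver.union (h : IsBoundedOver D T) (h' : IsBoundedOver D T') :
    IsBoundedOver D (T ∪ T') := by
  obtain ⟨c, hc, h⟩ := h
  obtain ⟨c', hc', h'⟩ := h'
  refine ⟨c * c', mul_ne_zero hc hc', ?_⟩
  rintro ξ (hξ | hξ)
  · rw [mul_comm, mul_smul]
    exact (h ξ hξ).smul c'
  · rw [mul_smul]
    exact (h' ξ hξ).smul c

omit [Algebra K F] [IsScalarTower K k F] in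
lemma IsBoundedOver.iUnion {ι : Type*} [Finite ι] {T : ι → Set F}
    (h : ∀ i, IsBoundedOver D (T i)) : IsBoundedOver D (⋃ i, T i) := by
  classical
  cases nonempty_fintype ι
  choose c hc h using h
  refine ⟨∏ i, c i, Finset.prod_ne_zero_iff.mpr fun i _ => hc i, fun ξ hξ => ?_⟩
  obtain ⟨i, hi⟩ := Set.mem_iUnion.mp hξ
  rw [← Finset.prod_erase_mul _ _ (Finset.mem_univ i), mul_smul]
  exact (h i ξ hi).smul _

omit [Algebra K F] [IsScalarTower K k F] in
lemma IsBoundedOver.mul_left [IsFractionRing D k] [FiniteDimensional k F]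
    (h : IsBoundedOver D T) (J : F) : IsBoundedOver D ((fun ξ => J * ξ) '' T) := by
  obtain ⟨c, hc, h⟩ := h
  have : Algebra.IsAlgebraic D F := (IsFractionRing.comap_isAlgebraic_iff (A := D) (K := k)).mpr
    inferInstance
  obtain ⟨c', hc', h'⟩ := Algebra.IsAlgebraic.exists_integral_multiples D {J}
  refine ⟨c' * c, mul_ne_zero hc' hc, ?_⟩
  rintro _ ⟨ξ, hξ, rfl⟩
  rw [← smul_mul_smul_comm]
  exact (h' J (Finset.mem_singleton_self J)).mul (h ξ hξ)

lemma IsBoundedOver.span (h : IsBoundedOver D T) :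
    IsBoundedOver D (Submodule.span K T : Set F) := by
  obtain ⟨c, hc, h⟩ := h
  refine ⟨c, hc, fun ξ hξ => ?_⟩
  induction hξ using Submodule.span_induction with
  | mem x hx => exact h x hx
  | zero => rw [smul_zero]; exact isIntegral_zero
  | add x y _ _ hx hy => rw [smul_add]; exact hx.add hy
  | smul a x _ hx =>
    have : c • a • x = (algebraMap K D a) • c • x := by
      rw [smul_comm c, ← algebraMap_smul k a (c • x)]
      rfl
    rw [this]
    exact hx.smul _

end Bounded

section FiniteDimensional

variable {K ι F : Type*} {k : Type*} [Field K] [Field k] [Algebra (MvPolynomial ι K) k]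
  [Algebra K k] [IsScalarTower K (MvPolynomial ι K) k] [IsFractionRing (MvPolynomial ι K) k]
  [Field F] [Algebra k F] [Algebra (MvPolynomial ι K) F] [IsScalarTower (MvPolynomial ι K) k F]

omit [IsFractionRing (MvPolynomial ι K) k] in
lemma isIntegral_localSubalgebra_of_isIntegral {q : MvPolynomial ι K} (hq : Prime q) {x : F}
    (hx : IsIntegral (MvPolynomial ι K) x) : IsIntegral (localSubalgebra k hq) x :=
  IsIntegral.map_of_comp_eq
    ((algebraMap (MvPolynomial ι K) k).codRestrict (localSubalgebra k hq) fun a =>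
      ⟨a, 1, hq.not_dvd_one, by rw [map_one, mul_one]⟩) (RingHom.id F)
    (RingHom.ext fun a => (IsScalarTower.algebraMap_apply (MvPolynomial ι K) k F a).symm) hx

omit [IsFractionRing (MvPolynomial ι K) k] in
lemma localSubalgebra_eq_of_associated {q q' : MvPolynomial ι K} (hq : Prime q) (hq' : Prime q')
    (h : Associated q q') : localSubalgebra k hq = localSubalgebra k hq' := by
  ext x
  simp only [localSubalgebra, Subalgebra.mem_mk, Subsemiring.mem_mk]
  change (∃ a b, ¬ q ∣ b ∧ _) ↔ (∃ a b, ¬ q' ∣ b ∧ _)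
  simp only [h.dvd_iff_dvd_left]

lemma PrimElt.isIntegral_localSubalgebra [FiniteDimensional k F]
    (E : PrimElt (MvPolynomial ι K) F) :
    ∃ a : MvPolynomial ι K, a ≠ 0 ∧ ∀ (ξ : F) (q : MvPolynomial ι K) (hq : Prime q), ¬ q ∣ a →
      (∀ O : ValuationSubring F, E.IsGood O q → ξ ∈ O) → IsIntegral (localSubalgebra k hq) ξ := by
  have hinjk := IsFractionRing.injective (MvPolynomial ι K) k
  have hinj : Function.Injective (algebraMap (MvPolynomial ι K) F) := by
    rw [IsScalarTower.algebraMap_eq (MvPolynomial ι K) k F]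
    exact (algebraMap k F).injective.comp hinjk
  obtain ⟨h, a, ha, hE⟩ := E.gen (Polynomial.aeval E.y (Polynomial.derivative E.f))⁻¹
  refine ⟨a, ha, fun ξ q hq hqa hξ => isIntegral_of_forall_valuationSubring fun V hV => ?_⟩
  have hA (b : MvPolynomial ι K) : algebraMap _ F b ∈ V := by
    rw [IsScalarTower.algebraMap_apply (MvPolynomial ι K) k F]
    exact hV ⟨algebraMap _ k b, b, 1, hq.not_dvd_one, by rw [map_one, mul_one]⟩
  have hunit (b : MvPolynomial ι K) (hb : ¬ q ∣ b) : V.valuation (algebraMap _ F b) = 1 := by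
    have hb0 : b ≠ 0 := by rintro rfl; exact hb (dvd_zero q)
    have hbk := (map_ne_zero_iff _ hinjk).mpr hb0
    have hbF := (map_ne_zero_iff _ hinj).mpr hb0
    refine le_antisymm ((V.valuation_le_one_iff _).mpr (hA b)) ?_
    have h1 : (algebraMap (MvPolynomial ι K) F b)⁻¹ ∈ V := by
      rw [IsScalarTower.algebraMap_apply (MvPolynomial ι K) k F, ← map_inv₀]
      exact hV ⟨(algebraMap _ k b)⁻¹, 1, b, hb, by rw [map_one, inv_mul_cancel₀ hbk]⟩
    rw [← V.valuation_le_one_iff, map_inv₀] at h1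
    exact (inv_le_one₀ (zero_lt_iff.mpr ((map_ne_zero _).mpr hbF))).mp h1
  have hy : E.y ∈ V := V.mem_of_isIntegral_eval₂ _ hA E.monic E.root
  have haeval (g : Polynomial (MvPolynomial ι K)) : Polynomial.aeval E.y g ∈ V :=
    V.eval₂_mem _ hA hy g
  by_cases hvq : V.valuation (algebraMap _ F q) < 1
  · refine hξ V ⟨hq, hA, fun b => ⟨fun hb => ?_, ?_⟩, ?_⟩
    · by_contra hqb
      exact hb.ne (hunit b hqb)
    · rintro ⟨c, rfl⟩
      rw [map_mul, map_mul]
      exact (mul_le_of_le_one_right' ((V.valuation_le_one_iff _).mpr (hA c))).trans_lt hvq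
    · have h1 : algebraMap _ F a = Polynomial.aeval E.y (Polynomial.derivative E.f) *
          Polynomial.aeval E.y h := by
        rw [← hE, mul_inv_cancel_left₀ E.sep]
      refine le_antisymm ((V.valuation_le_one_iff _).mpr (haeval _)) ?_
      rw [← hunit a hqa, h1, map_mul]
      exact mul_le_of_le_one_right' ((V.valuation_le_one_iff _).mpr (haeval _))
  · have hvq' : V.valuation (algebraMap _ F q) = 1 :=
      le_antisymm ((V.valuation_le_one_iff _).mpr (hA q)) (not_lt.mp hvq)
    have hall (b : MvPolynomial ι K) (hb : b ≠ 0) : V.valuation (algebraMap _ F b) = 1 := by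
      obtain ⟨m, b', hb', rfl⟩ := WfDvdMonoid.max_power_factor hb hq.irreducible
      rw [map_mul, map_pow, map_mul, map_pow, hvq', hunit b' hb', one_pow, one_mul]
    have hk (x : k) : algebraMap k F x ∈ V := by
      obtain ⟨a, b, hb, rfl⟩ := mvPolynomial_exists_fraction (K := K) (ι := ι) k x
      rw [← V.valuation_le_one_iff, map_div₀, ← IsScalarTower.algebraMap_apply,
        ← IsScalarTower.algebraMap_apply, map_div₀, hall b hb, div_one, V.valuation_le_one_iff]
      exact hA a
    obtain ⟨g, hg, hg0⟩ := Algebra.IsIntegral.isIntegral (R := k) ξ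
    exact V.mem_of_isIntegral_eval₂ _ hk hg hg0

lemma IsBoundedOver.exists_isIntegral_mul {q : MvPolynomial ι K} {hq : Prime q} {T : Set F}
    (h : IsBoundedOver (localSubalgebra k hq) T) : ∃ a : MvPolynomial ι K, a ≠ 0 ∧ ∀ ξ ∈ T,
      IsIntegral (localSubalgebra k hq) (algebraMap _ F a * ξ) := by
  obtain ⟨⟨c, a, b, hb, hab⟩, hc, h⟩ := h
  have hb0 : b ≠ 0 := by rintro rfl; exact hb (dvd_zero q)
  refine ⟨a, ?_, fun ξ hξ => ?_⟩
  · rintro rfl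
    rw [map_zero, mul_eq_zero] at hab
    rcases hab with rfl | hab
    · exact hc rfl
    · exact hb0 (IsFractionRing.injective (MvPolynomial ι K) k (by rw [hab, map_zero]))
  · have h1 : algebraMap _ F a * ξ = algebraMap _ F b *
        ((⟨c, a, b, hb, hab⟩ : localSubalgebra k hq) • ξ) := by
      have h2 := congrArg (algebraMap k F) hab
      rw [map_mul, ← IsScalarTower.algebraMap_apply, ← IsScalarTower.algebraMap_apply] at h2
      rw [← h2, Algebra.smul_def]
      change _ = _ * (algebraMap k F c * _)
      ring
    rw [h1]
    exact (isIntegral_localSubalgebra_of_isIntegral hq isIntegral_algebraMap).mul (h ξ hξ)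

variable [Algebra K F] [IsScalarTower K k F]

theorem PrimElt.finiteDimensional [CharZero K] [Finite ι] [Nonempty ι] [FiniteDimensional k F]
    (E : PrimElt (MvPolynomial ι K) F) {a₁ : MvPolynomial ι K} (ha₁ : a₁ ≠ 0)
    (T : Submodule K F)
    (hT : ∀ (q : MvPolynomial ι K) (hq : Prime q), IsBoundedOver (localSubalgebra k hq) (T : Set F))
    (hT' : IsBoundedOver (infinitySubalgebra (K := K) (ι := ι) k) (T : Set F))
    (hgood : ∀ ξ ∈ T, ∀ (O : ValuationSubring F) (p : MvPolynomial ι K), E.IsGood O p →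
      ¬ p ∣ a₁ → ξ ∈ O) :
    FiniteDimensional K T := by
  classical
  have hinjk := IsFractionRing.injective (MvPolynomial ι K) k
  have hinj : Function.Injective (algebraMap (MvPolynomial ι K) F) := by
    rw [IsScalarTower.algebraMap_eq (MvPolynomial ι K) k F]
    exact (algebraMap k F).injective.comp hinjk
  have : CharZero k := charZero_of_injective_algebraMap (algebraMap K k).injective
  obtain ⟨a₂, ha₂, hloc⟩ := E.isIntegral_localSubalgebra (k := k)
  obtain ⟨α, hα, hαT⟩ : ∃ α : MvPolynomial ι K, α ≠ 0 ∧ ∀ ξ ∈ T, ∀ (q : MvPolynomial ι K)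
      (hq : Prime q), IsIntegral (localSubalgebra k hq) (algebraMap _ F α * ξ) := by
    have key (m : Multiset (MvPolynomial ι K)) : ∃ α : MvPolynomial ι K, α ≠ 0 ∧
        ∀ ξ ∈ T, ∀ q ∈ m, ∀ (hq : Prime q),
          IsIntegral (localSubalgebra k hq) (algebraMap _ F α * ξ) := by
      induction m using Multiset.induction with
      | empty => exact ⟨1, one_ne_zero, fun ξ _ q hq => (Multiset.notMem_zero q hq).elim⟩
      | cons p m ih =>
        obtain ⟨α, hα, h⟩ := ih
        by_cases hp : Prime p
        · obtain ⟨a, ha, h'⟩ := (hT p hp).exists_isIntegral_mul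
          refine ⟨a * α, mul_ne_zero ha hα, fun ξ hξ q hqm hq => ?_⟩
          rcases Multiset.mem_cons.mp hqm with rfl | hqm
          · rw [mul_comm a, map_mul, mul_assoc]
            exact (isIntegral_localSubalgebra_of_isIntegral hq isIntegral_algebraMap).mul (h' ξ hξ)
          · rw [map_mul, mul_assoc]
            exact (isIntegral_localSubalgebra_of_isIntegral hq isIntegral_algebraMap).mul
              (h ξ hξ q hqm hq)
        · refine ⟨α, hα, fun ξ hξ q hqm hq => ?_⟩
          rcases Multiset.mem_cons.mp hqm with rfl | hqm
          · exact absurd hq hp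
          · exact h ξ hξ q hqm hq
    obtain ⟨α, hα, h⟩ := key (UniqueFactorizationMonoid.factors (a₁ * a₂))
    refine ⟨α, hα, fun ξ hξ q hq => ?_⟩
    by_cases hqa : q ∣ a₁ * a₂
    · obtain ⟨q', hq', hass⟩ := UniqueFactorizationMonoid.exists_mem_factors_of_dvd
        (mul_ne_zero ha₁ ha₂) hq.irreducible hqa
      have := h ξ hξ q' hq' (hass.prime hq)
      rwa [localSubalgebra_eq_of_associated hq (hass.prime hq) hass]
    · exact (isIntegral_localSubalgebra_of_isIntegral hq isIntegral_algebraMap).mul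
        (hloc ξ q hq (fun hd => hqa (hd.mul_left _))
          fun O hO => hgood ξ hξ O q hO fun hd => hqa (hd.mul_right _))
  obtain ⟨s, b, hb⟩ := FiniteDimensional.exists_is_basis_integral (MvPolynomial ι K) k F
  obtain ⟨hdvr, hfrac⟩ := isDiscreteValuationRing_infinitySubalgebra (K := K) (ι := ι) k
  obtain ⟨c, hc, hcT⟩ := hT'
  obtain ⟨γ, hγ, hγb⟩ :=
    exists_smul_isIntegral_finset k (D₀ := infinitySubalgebra (K := K) (ι := ι) k)
    (F := F) (Finset.univ.image b)
  have hαk := (map_ne_zero_iff _ hinjk).mpr hα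
  have hαF := (map_ne_zero_iff _ hinj).mpr hα
  have hc' : (c : k) ≠ 0 := fun h => hc (Subtype.ext h)
  have hγ' : (γ : k) ≠ 0 := fun h => hγ (Subtype.ext h)
  obtain ⟨M, hM⟩ := exists_totalDegree_le_of_mul_mem (K := K) (ι := ι) k
    (β := c * γ / algebraMap _ k α) (div_ne_zero (mul_ne_zero hc' hγ') hαk)
  let Φ (i : s) : F →ₗ[K] k := ((Algebra.trace k F).restrictScalars K).comp
    (LinearMap.mulLeft K (algebraMap _ F α * b i))
  let N := (MvPolynomial.restrictTotalDegree ι K M).map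
    (IsScalarTower.toAlgHom K (MvPolynomial ι K) k).toLinearMap
  have hmem (ξ : T) (i : s) : Φ i ξ ∈ N := by
    have hΦ : Φ i ξ = Algebra.trace k F (algebraMap _ F α * b i * ξ) := rfl
    obtain ⟨a, ha⟩ := exists_algebraMap_eq_of_mem_localSubalgebra (K := K) (ι := ι) k
      (x := Φ i ξ) fun q hq => by
        obtain ⟨hdvr, hfrac⟩ := isDiscreteValuationRing_localSubalgebra k hq
        have h1 : IsIntegral (localSubalgebra k hq) (Φ i ξ) := by
          rw [hΦ]
          apply Algebra.isIntegral_trace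
          rw [mul_right_comm]
          exact (hαT ξ ξ.2 q hq).mul (isIntegral_localSubalgebra_of_isIntegral hq (hb i))
        obtain ⟨x, hx⟩ := IsIntegrallyClosed.isIntegral_iff.mp h1
        rw [← hx]
        exact x.2
    refine ⟨a, (MvPolynomial.mem_restrictTotalDegree _ _ _).mpr (hM a ?_), ha⟩
    have h1 : IsIntegral (infinitySubalgebra (K := K) (ι := ι) k)
        (c * γ / algebraMap _ k α * algebraMap _ k a) := by
      rw [ha, hΦ, ← smul_eq_mul, ← map_smul]
      apply Algebra.isIntegral_trace
      have h2 : (c * γ / algebraMap _ k α : k) • (algebraMap _ F α * b i * ξ) =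
          (c • (ξ : F)) * (γ • b i) := by
        rw [Algebra.smul_def, Algebra.smul_def, Algebra.smul_def, map_div₀, map_mul,
          ← IsScalarTower.algebraMap_apply]
        change _ = algebraMap k F c * _ * (algebraMap k F γ * _)
        field_simp
      rw [h2]
      exact (hcT ξ ξ.2).mul (hγb (b i) (Finset.mem_image_of_mem _ (Finset.mem_univ i)))
    obtain ⟨x, hx⟩ := IsIntegrallyClosed.isIntegral_iff.mp h1
    rw [← hx]
    exact x.2
  let Ψ : T →ₗ[K] (s → N) := LinearMap.pi fun i => ((Φ i).comp T.subtype).codRestrict N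
    fun ξ => hmem ξ i
  have : FiniteDimensional K N := Module.Finite.map _ _
  refine FiniteDimensional.of_injective Ψ ((injective_iff_map_eq_zero Ψ).mpr fun ξ hξ => ?_)
  have h0 (i : s) : Algebra.traceForm k F (algebraMap _ F α * ξ) (b i) = 0 := by
    have : Φ i ξ = 0 := congrArg (fun g => ((g i : N) : k)) hξ
    rw [Algebra.traceForm_apply, mul_right_comm]
    exact this
  have h1 : algebraMap (MvPolynomial ι K) F α * ξ = 0 := by
    refine (traceForm_nondegenerate k F).1 _ fun z => ?_
    have : Algebra.traceForm k F (algebraMap _ F α * ξ) = 0 := b.ext fun i => h0 i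
    rw [this, LinearMap.zero_apply]
  exact Subtype.ext ((mul_eq_zero.mp h1).resolve_left hαF)

end FiniteDimensional

section Center

variable {B F : Type*} [CommRing B] [Field F]

/-- The center of a valuation ring on a ring mapping into it. -/
def ValuationSubring.center (O : ValuationSubring F) (φ : B →+* F) (h : ∀ x, φ x ∈ O) :
    Ideal B where
  carrier := {x | O.valuation (φ x) < 1}
  add_mem' := fun {x y} hx hy => by
    rw [Set.mem_ofPred_eq, map_add]
    exact O.valuation.map_add_lt hx hy
  zero_mem' := by
    rw [Set.mem_ofPred_eq, map_zero, map_zero]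
    exact zero_lt_one
  smul_mem' := fun x y hy => by
    rw [Set.mem_ofPred_eq, smul_eq_mul, map_mul, map_mul]
    exact (mul_le_of_le_one_left' ((O.valuation_le_one_iff _).mpr (h x))).trans_lt hy

lemma ValuationSubring.mem_center {O : ValuationSubring F} {φ : B →+* F} {h : ∀ x, φ x ∈ O}
    {x : B} : x ∈ O.center φ h ↔ O.valuation (φ x) < 1 :=
  Iff.rfl

instance ValuationSubring.isPrime_center (O : ValuationSubring F) (φ : B →+* F)
    (h : ∀ x, φ x ∈ O) : (O.center φ h).IsPrime where
  ne_top' hne := by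
    have := (Ideal.eq_top_iff_one _).mp hne
    rw [ValuationSubring.mem_center, map_one, map_one] at this
    exact lt_irrefl _ this
  mem_or_mem' := fun {x y} hxy => by
    rw [ValuationSubring.mem_center, map_mul, map_mul] at hxy
    by_contra! hne
    have h1 (z : B) (hz : z ∉ O.center φ h) : O.valuation (φ z) = 1 :=
      le_antisymm ((O.valuation_le_one_iff _).mpr (h z)) (not_lt.mp hz)
    rw [h1 x hne.1, h1 y hne.2, one_mul] at hxy
    exact lt_irrefl _ hxy

end Center

section IntegralSubring

variable {A F : Type*} [CommRing A] [Field F]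

/-- The subring of elements integral over a ring homomorphism. -/
def RingHom.integralSubring (ψ : A →+* F) : Subring F :=
  let _ := ψ.toAlgebra
  (integralClosure A F).toSubring

lemma RingHom.mem_integralSubring {ψ : A →+* F} {x : F} :
    x ∈ ψ.integralSubring ↔ ψ.IsIntegralElem x :=
  Iff.rfl

variable [IsDomain A] [UniqueFactorizationMonoid A]

lemma RingHom.dvd_of_center {ψ : A →+* F} (hψ : Function.Injective ψ) (O : ValuationSubring F)
    (hO : ∀ a, ψ a ∈ O)
    (hN : ∀ (N : Ideal ψ.integralSubring) [N.IsPrime], (∀ x ∈ N, O.valuation (x : F) < 1) → N ≠ ⊥ →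
      ∀ x : ψ.integralSubring, O.valuation (x : F) < 1 → x ∈ N)
    {p : A} (hp : Prime p) (hp' : O.valuation (ψ p) < 1) {a : A} (ha : O.valuation (ψ a) < 1) :
    p ∣ a := by
  let B := ψ.integralSubring
  have hB (x : B) : (x : F) ∈ O := by
    obtain ⟨g, hg, hg0⟩ := RingHom.mem_integralSubring.mp x.2
    exact O.mem_of_isIntegral_eval₂ ψ hO hg hg0
  let _ : Algebra A B := (ψ.codRestrict B fun a => ψ.isIntegralElem_map).toAlgebra
  have hval (a : A) : ((algebraMap A B a : B) : F) = ψ a := rfl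
  have : FaithfulSMul A B := (faithfulSMul_iff_algebraMap_injective _ _).mpr fun a b hab =>
    hψ (congrArg (Subtype.val : B → F) hab)
  have : Algebra.IsIntegral A B := ⟨fun x => by
    obtain ⟨g, hg, hg0⟩ := RingHom.mem_integralSubring.mp x.2
    refine ⟨g, hg, Subtype.ext ?_⟩
    have := Polynomial.hom_eval₂ g (algebraMap A B) B.subtype x
    exact this.trans hg0⟩
  let P : Ideal B := O.center B.subtype hB
  have hP (x : B) : x ∈ P ↔ O.valuation (x : F) < 1 := Iff.rfl
  have : P.IsPrime := O.isPrime_center B.subtype hB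
  refine dvd_of_algebraMap_mem hp P (fun N hNp hN0 hNP => le_antisymm hNP fun x hx => ?_)
    ((hP _).mpr hp') a ((hP _).mpr ha)
  exact hN N (fun y hy => (hP y).mp (hNP hy)) hN0 x ((hP x).mp hx)

end IntegralSubring

section Pullback

variable {K ι F : Type*} [Field K] [Field F] [Algebra K F] [Algebra (MvPolynomial ι K) F]

omit [Algebra K F] in
lemma PrimElt.exists_forall_mem (E : PrimElt (MvPolynomial ι K) F) (s : Finset F) :
    ∃ a : MvPolynomial ι K, a ≠ 0 ∧ ∀ z ∈ s, ∀ (O : ValuationSubring F) (p : MvPolynomial ι K),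
      E.IsGood O p → ¬ p ∣ a → z ∈ O := by
  classical
  induction s using Finset.induction with
  | empty => exact ⟨1, one_ne_zero, fun z hz => (Finset.notMem_empty z hz).elim⟩
  | insert x s _ ih =>
    obtain ⟨a, ha, h⟩ := ih
    obtain ⟨g, b, hb, hg⟩ := E.gen x
    refine ⟨a * b, mul_ne_zero ha hb, fun z hz O p hO hp => ?_⟩
    rcases Finset.mem_insert.mp hz with rfl | hz
    · rw [← O.valuation_le_one_iff]
      have := (O.valuation_le_one_iff _).mpr (hO.aeval_mem g)
      rwa [← hg, map_mul, hO.algebraMap_eq_one fun hd => hp (hd.mul_left _), mul_one] at this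
    · exact h z hz O p hO fun hd => hp (hd.mul_right _)

variable [FaithfulSMul (MvPolynomial ι K) F] [IsScalarTower K (MvPolynomial ι K) F]

/-- Pulling back a good place which is not in the branch locus. -/
lemma PrimElt.exists_comap [CharZero K] [Fintype ι] [Algebra.IsAlgebraic (MvPolynomial ι K) F]
    (E : PrimElt (MvPolynomial ι K) F) (σ : F →ₐ[K] F) : ∃ a : MvPolynomial ι K, a ≠ 0 ∧
      ∀ (O : ValuationSubring F) (p : MvPolynomial ι K), E.IsGood O p → ¬ p ∣ a →
        O.comap (σ : F →+* F) = ⊤ ∨ (∃ p', E.IsGood (O.comap (σ : F →+* F)) p') ∧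
          ∀ p', E.IsGood (O.comap (σ : F →+* F)) p' → ∃ u : F, O.valuation u = 1 ∧
            σ (algebraMap _ F p') = algebraMap _ F p * u := by
  classical
  let ψ : MvPolynomial ι K →ₐ[K] F := σ.comp (IsScalarTower.toAlgHom K (MvPolynomial ι K) F)
  have hψ' (a : MvPolynomial ι K) : ψ a = σ (algebraMap _ F a) := rfl
  have hψ : Function.Injective ψ :=
    σ.toRingHom.injective.comp (FaithfulSMul.algebraMap_injective (MvPolynomial ι K) F)
  have htr := trdeg_eq_of_isAlgebraic_mvPolynomial (K := K) (ι := ι) (F := F)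
  obtain ⟨D', hD'⟩ := exists_derivation_algHom htr ψ hψ
  have h_int (z : F) := exists_isIntegralElem_mul htr ψ hψ z
  obtain ⟨d, hd, hdX, hdy⟩ : ∃ d ≠ 0, (∀ i, ψ.toRingHom.IsIntegralElem
      (ψ d * algebraMap (MvPolynomial ι K) F (MvPolynomial.X i))) ∧
      ψ.toRingHom.IsIntegralElem (ψ d * E.y) := by
    choose d hd h using fun i => h_int (algebraMap (MvPolynomial ι K) F (MvPolynomial.X i))
    obtain ⟨d', hd', h'⟩ := h_int E.y
    refine ⟨(∏ i, d i) * d', mul_ne_zero (Finset.prod_ne_zero_iff.mpr fun i _ => hd i) hd',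
      fun i => ?_, ?_⟩
    · rw [← Finset.mul_prod_erase _ _ (Finset.mem_univ i), mul_assoc, map_mul, mul_right_comm]
      exact ψ.toRingHom.integralSubring.mul_mem (h i) ψ.toRingHom.isIntegralElem_map
    · rw [map_mul, mul_assoc]
      exact ψ.toRingHom.integralSubring.mul_mem ψ.toRingHom.isIntegralElem_map h'
  have hψd : ψ d ≠ 0 := (map_ne_zero_iff _ hψ).mpr hd
  obtain ⟨a, ha, h⟩ := E.exists_forall_mem
    (Finset.univ.image (fun i => ψ (MvPolynomial.X i)) ∪
      Finset.univ.image (fun i : ι × ι =>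
        D' i.1 (algebraMap (MvPolynomial ι K) F (MvPolynomial.X i.2))) ∪
      {(ψ d)⁻¹, (σ (Polynomial.aeval E.y (Polynomial.derivative E.f)))⁻¹})
  refine ⟨a, ha, fun O p hO hpa => ?_⟩
  replace h := fun z hz => h z hz O p hO hpa
  have hK (c : K) : algebraMap K F c ∈ O := by
    rw [IsScalarTower.algebraMap_apply K (MvPolynomial ι K) F]
    exact hO.mem _
  have hA (b : MvPolynomial ι K) : ψ b ∈ O := by
    induction b using MvPolynomial.induction_on with
    | C c => rw [← MvPolynomial.algebraMap_eq, AlgHom.commutes]; exact hK c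
    | add p q hp hq => rw [map_add]; exact O.add_mem _ _ hp hq
    | mul_X p i hp =>
      rw [map_mul]
      exact O.mul_mem _ _ hp (h _ (by simp))
  have hM (i j : ι) : D' i (algebraMap (MvPolynomial ι K) F (MvPolynomial.X j)) ∈ O :=
    h _ (Finset.mem_union_left _ (Finset.mem_union_right _
      (Finset.mem_image_of_mem _ (Finset.mem_univ (i, j)))))
  have hdinv : (ψ d)⁻¹ ∈ O := h _ (by simp)
  have hfinv : (σ (Polynomial.aeval E.y (Polynomial.derivative E.f)))⁻¹ ∈ O := h _ (by simp)
  have hvd : O.valuation (ψ d) = 1 := by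
    refine le_antisymm ((O.valuation_le_one_iff _).mpr (hA d)) ?_
    rw [← O.valuation_le_one_iff, map_inv₀] at hdinv
    exact (inv_le_one₀ (zero_lt_iff.mpr ((map_ne_zero _).mpr hψd))).mp hdinv
  let O' := O.comap (σ : F →+* F)
  have hOO' (x : F) : (σ : F →+* F) x ∈ O ↔ x ∈ O' := Iff.rfl
  have hlt (x : F) : O.valuation (σ x) < 1 ↔ O'.valuation x < 1 :=
    ValuationSubring.valuation_map_lt_one_iff hOO' x
  have hy : E.y ∈ O' := O'.mem_of_isIntegral_eval₂ (algebraMap _ F) hA E.monic E.root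
  have haeval (g : Polynomial (MvPolynomial ι K)) : Polynomial.aeval E.y g ∈ O' :=
    O'.eval₂_mem _ hA hy g
  let P : Ideal (MvPolynomial ι K) := O.center ψ.toRingHom hA
  have hP (x : MvPolynomial ι K) : x ∈ P ↔ O.valuation (ψ x) < 1 := Iff.rfl
  have hPp : P.IsPrime := inferInstance
  by_cases hP0 : P = ⊥
  · refine .inl (eq_top_iff.mpr fun x _ => ?_)
    change x ∈ O'
    obtain ⟨g, b, hb, hg⟩ := E.gen x
    have hvb : O'.valuation (algebraMap _ F b) = 1 := by
      refine le_antisymm ((O'.valuation_le_one_iff _).mpr (hA b)) (not_lt.mp fun hlt' => hb ?_)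
      rw [← hlt] at hlt'
      have := (hP b).mpr hlt'
      rwa [hP0] at this
    rw [← O'.valuation_le_one_iff]
    have := (O'.valuation_le_one_iff _).mpr (haeval g)
    rwa [← hg, map_mul, hvb, mul_one] at this
  obtain ⟨p', hp'P, hp'⟩ := hPp.exists_mem_prime_of_ne_bot hP0
  have hBint : ∀ z ∈ ψ.toRingHom.integralSubring, z ∈ O := fun z hz => by
    obtain ⟨g, hg, hg0⟩ := RingHom.mem_integralSubring.mp hz
    exact O.mem_of_isIntegral_eval₂ ψ.toRingHom hA hg hg0
  have hpow (g : Polynomial (MvPolynomial ι K)) :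
      ∃ N : ℕ, ψ d ^ N * Polynomial.aeval E.y g ∈ ψ.toRingHom.integralSubring := by
    let B := ψ.toRingHom.integralSubring
    have hdB : ψ d ∈ B := ψ.toRingHom.isIntegralElem_map
    have hadd {z w : F} (hz : ∃ N : ℕ, ψ d ^ N * z ∈ B) (hw : ∃ N : ℕ, ψ d ^ N * w ∈ B) :
        ∃ N : ℕ, ψ d ^ N * (z + w) ∈ B := by
      obtain ⟨N, hN⟩ := hz
      obtain ⟨M, hM⟩ := hw
      refine ⟨N + M, ?_⟩
      rw [mul_add, pow_add, mul_right_comm, mul_assoc _ _ w]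
      exact B.add_mem (B.mul_mem hN (B.pow_mem hdB M)) (B.mul_mem (B.pow_mem hdB N) hM)
    have hmul {z w : F} (hz : ∃ N : ℕ, ψ d ^ N * z ∈ B) (hw : ∃ N : ℕ, ψ d ^ N * w ∈ B) :
        ∃ N : ℕ, ψ d ^ N * (z * w) ∈ B := by
      obtain ⟨N, hN⟩ := hz
      obtain ⟨M, hM⟩ := hw
      refine ⟨N + M, ?_⟩
      rw [pow_add, mul_mul_mul_comm]
      exact B.mul_mem hN hM
    have hpowA (b : MvPolynomial ι K) : ∃ N : ℕ, ψ d ^ N * algebraMap _ F b ∈ B := by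
      induction b using MvPolynomial.induction_on with
      | C c =>
        refine ⟨0, ?_⟩
        rw [pow_zero, one_mul, ← MvPolynomial.algebraMap_eq, ← IsScalarTower.algebraMap_apply,
          ← ψ.commutes]
        exact ψ.toRingHom.isIntegralElem_map
      | add p q hp hq => rw [map_add]; exact hadd hp hq
      | mul_X p i hp =>
        rw [map_mul]
        exact hmul hp ⟨1, by rw [pow_one]; exact hdX i⟩
    induction g using Polynomial.induction_on with
    | C c => rw [Polynomial.aeval_C]; exact hpowA c
    | add p q hp hq => rw [map_add]; exact hadd hp hq
    | monomial n a hn =>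
      rw [pow_succ, ← mul_assoc, map_mul, Polynomial.aeval_X]
      exact hmul hn ⟨1, by rw [pow_one]; exact hdy⟩
  have hdvd (b : MvPolynomial ι K) : O'.valuation (algebraMap _ F b) < 1 ↔ p' ∣ b := by
    rw [← hlt]
    constructor
    · refine fun hb => ψ.toRingHom.dvd_of_center hψ O hA (fun N _ hN hN0 => ?_) hp'
        ((hP p').mp hp'P) hb
      refine hO.eq_bot_of_lt_center _ hBint (fun g hg => ?_) N hN hN0
      obtain ⟨h', b, hb, hg⟩ := hO.exists_frac hg
      obtain ⟨M, hM⟩ := hpow b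
      obtain ⟨N, hN⟩ := hpow h'
      have hdB : ψ d ∈ ψ.toRingHom.integralSubring := ψ.toRingHom.isIntegralElem_map
      refine ⟨ψ d ^ (N + M) * Polynomial.aeval E.y b, ?_, ?_, ?_⟩
      · rw [pow_add, mul_assoc]
        exact Subring.mul_mem _ (Subring.pow_mem _ hdB N) hM
      · rw [map_mul, map_pow, hvd, hb, one_pow, one_mul]
      · rw [mul_assoc, mul_comm _ g, hg, add_comm, pow_add, mul_assoc]
        exact Subring.mul_mem _ (Subring.pow_mem _ hdB M) hN
    · rintro ⟨c, rfl⟩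
      exact (hP _).mp (P.mul_mem_right c hp'P)
  have hgood : E.IsGood O' p' := by
    refine ⟨hp', hA, hdvd, ?_⟩
    refine le_antisymm ((O'.valuation_le_one_iff _).mpr (haeval _)) (not_lt.mp fun h1 => ?_)
    rcases (O'.valuation_lt_one_iff_inv _).mp h1 with h1 | h1
    · exact E.sep h1
    · refine h1 ?_
      change σ _ ∈ O
      rwa [map_inv₀]
  have hpF : algebraMap _ F p ≠ 0 := hO.p_ne_zero
  refine .inr ⟨⟨p', hgood⟩, fun p' hgood => ?_⟩
  have hp' := (hlt _).mpr hgood.p_lt_one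
  have hw := hO.div_mem hp'
  refine ⟨σ (algebraMap _ F p') / algebraMap _ F p, ?_, (mul_div_cancel₀ _ hpF).symm⟩
  refine le_antisymm ((O.valuation_le_one_iff _).mpr hw) (not_lt.mp fun hw1 => ?_)
  obtain ⟨l, hl⟩ := exists_not_dvd_pderiv hgood.prime
  refine hl ((hgood.lt_one _).mp ((hlt _).mp ?_))
  have h1 : σ (algebraMap _ F (MvPolynomial.pderiv l p')) =
      D' l (algebraMap _ F p * (σ (algebraMap _ F p') / algebraMap _ F p)) := by
    rw [mul_div_cancel₀ _ hpF, ← hψ', ← hψ', hD']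
  rw [h1, Derivation.leibniz, smul_eq_mul, smul_eq_mul]
  have hDm {g : F} (hg : g ∈ O) := (O.valuation_le_one_iff _).mpr
    (hO.derivation_mem (D' l) (hM l) hg)
  refine O.valuation.map_add_lt ?_ ?_
  · rw [map_mul]
    exact (mul_le_of_le_one_right' (hDm hw)).trans_lt hO.p_lt_one
  · rw [map_mul]
    exact (mul_le_of_le_one_right' (hDm (hO.mem p))).trans_lt hw1

end Pullback

section Semilinear

variable {K F V κ : Type*} [Field K] [Field F] [Algebra K F] [AddCommGroup V] [Module K V]
  [Module F V] [IsScalarTower K F V]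

/-- Linearly independent fixed vectors stay so after extending scalars from the fixed field. -/
lemma LinearIndependent.of_semilinear_fixed (σ : F →+* F)
    (hσ : ∀ g, σ g = g → ∃ c, g = algebraMap K F c) (Φ : V →+ V)
    (hΦ : ∀ (c : F) v, Φ (c • v) = σ c • Φ v) {x : κ → V} (hx : ∀ i, Φ (x i) = x i)
    (h : LinearIndependent K x) : LinearIndependent F x := by
  classical
  rw [linearIndependent_iff'] at h ⊢
  intro s
  induction s using Finset.induction with
  | empty => simp
  | insert j s hj ih =>
    intro g hg
    by_cases hgj : g j = 0
    · rw [Finset.sum_insert hj, hgj, zero_smul, zero_add] at hg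
      intro i hi
      rcases Finset.mem_insert.mp hi with rfl | hi
      · exact hgj
      · exact ih g hg i hi
    · exfalso
      have h1 : x j + ∑ i ∈ s, ((g j)⁻¹ * g i) • x i = 0 := by
        rw [Finset.sum_insert hj] at hg
        have := congrArg (fun v => (g j)⁻¹ • v) hg
        simpa [smul_add, Finset.smul_sum, smul_smul, hgj] using this
      have h2 := congrArg Φ h1
      simp only [map_add, map_sum, hΦ, hx, map_zero] at h2
      have h3 : ∑ i ∈ s, (σ ((g j)⁻¹ * g i) - (g j)⁻¹ * g i) • x i = 0 := by
        simp only [sub_smul, Finset.sum_sub_distrib]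
        rw [sub_eq_zero]
        exact add_left_cancel (h2.trans h1.symm)
      have h4 : ∀ i, ∃ c : K, i ∈ s → (g j)⁻¹ * g i = algebraMap K F c := fun i => by
        by_cases hi : i ∈ s
        · obtain ⟨c, hc⟩ := hσ _ (sub_eq_zero.mp (ih _ h3 i hi))
          exact ⟨c, fun _ => hc⟩
        · exact ⟨0, fun h => absurd h hi⟩
      choose c hc using h4
      have h5 := h (insert j s) (fun i => if i = j then 1 else c i) (by
        rw [Finset.sum_insert hj, if_pos rfl, one_smul]
        refine Eq.trans (congrArg _ (Finset.sum_congr rfl fun i hi => ?_)) h1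
        rw [if_neg (fun hij : i = j => hj (hij ▸ hi)), hc i hi, algebraMap_smul]) j
        (Finset.mem_insert_self _ _)
      rw [if_pos rfl] at h5
      exact one_ne_zero h5

lemma finite_fixed_of_semilinear [FiniteDimensional F V] (σ : F →+* F)
    (hσ : ∀ g, σ g = g → ∃ c, g = algebraMap K F c) (Φ : V →ₗ[K] V)
    (hΦ : ∀ (c : F) v, Φ (c • v) = σ c • Φ v) :
    FiniteDimensional K (LinearMap.ker (Φ - LinearMap.id)) := by
  let b := Module.Basis.ofVectorSpace K (LinearMap.ker (Φ - LinearMap.id))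
  have h : LinearIndependent K fun i => (b i : V) :=
    b.linearIndependent.map' (LinearMap.ker (Φ - LinearMap.id)).subtype (Submodule.ker_subtype _)
  have h' := h.of_semilinear_fixed σ hσ Φ.toAddMonoidHom hΦ fun i => sub_eq_zero.mp (b i).2
  have := h'.finite
  exact Module.Finite.of_basis b

end Semilinear

section Core

variable {K ι F : Type*} [Field K] [Field F] [Algebra K F] [Algebra (MvPolynomial ι K) F]

lemma PrimElt.finiteDimensional_fractionRing {A k : Type*} [CommRing A] [IsDomain A] [Field k]
    [Algebra A k] [IsFractionRing A k] [Algebra A F] [Algebra k F] [IsScalarTower A k F]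
    (E : PrimElt A F) : FiniteDimensional k F := by
  have hy : IsIntegral k E.y := IsIntegral.tower_top (R := A) ⟨E.f, E.monic, E.root⟩
  have := IntermediateField.adjoin.finiteDimensional hy
  have htop : IntermediateField.adjoin k {E.y} = ⊤ := by
    refine eq_top_iff.mpr fun g _ => ?_
    obtain ⟨h, a, ha, hg⟩ := E.gen g
    have ha' : algebraMap A F a ≠ 0 := by
      rw [IsScalarTower.algebraMap_apply A k F, _root_.map_ne_zero]
      exact (map_ne_zero_iff _ (IsFractionRing.injective A k)).mpr ha
    rw [eq_div_of_mul_eq ha' hg]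
    refine div_mem ?_ ?_
    · rw [← Polynomial.aeval_map_algebraMap k]
      exact IntermediateField.algebra_adjoin_le_adjoin k _
        (Polynomial.aeval_mem_adjoin_singleton k E.y)
    · rw [IsScalarTower.algebraMap_apply A k F]
      exact IntermediateField.algebraMap_mem _ _
  rw [htop] at this
  exact LinearEquiv.finiteDimensional IntermediateField.topEquiv.toLinearEquiv

variable [FaithfulSMul (MvPolynomial ι K) F] [IsScalarTower K (MvPolynomial ι K) F]

/-- The elements with bounded poles at bad places and no poles at good places form a
finite-dimensional space. -/
lemma PrimElt.finiteDimensional_of_logBounded [CharZero K] [Fintype ι] [Nonempty ι]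
    [Algebra.IsAlgebraic (MvPolynomial ι K) F] (E : PrimElt (MvPolynomial ι K) F)
    (σ : F →ₐ[K] F) (J : ι → ι → F) {a : MvPolynomial ι K} (ha : a ≠ 0) (T : Submodule K F)
    (hT : T ≤ Submodule.span K ({g | ∃ p, E.LogBounded p g} ∪
      ⋃ l : ι × ι, (fun g => J l.1 l.2 * g) '' (σ '' {g | ∃ p, E.LogBounded p g})))
    (hgood : ∀ ξ ∈ T, ∀ (O : ValuationSubring F) (p : MvPolynomial ι K), E.IsGood O p →
      ¬ p ∣ a → ξ ∈ O) :
    FiniteDimensional K T := by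
  let k := FractionRing (MvPolynomial ι K)
  let _ : Algebra k F := FractionRing.liftAlgebra _ _
  have : IsScalarTower (MvPolynomial ι K) k F := FractionRing.isScalarTower_liftAlgebra _ _
  have : IsScalarTower K k F := .of_algebraMap_eq fun x => by
    rw [IsScalarTower.algebraMap_apply K (MvPolynomial ι K) k, ← IsScalarTower.algebraMap_apply
      (MvPolynomial ι K) k F, ← IsScalarTower.algebraMap_apply]
  have : CharZero k := charZero_of_injective_algebraMap (algebraMap K k).injective
  have : FiniteDimensional k F := E.finiteDimensional_fractionRing
  obtain ⟨D, hD⟩ := exists_derivation_extending (K := K) (ι := ι) (F := F)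
  obtain ⟨D', hD'⟩ := exists_derivation_algHom
    (trdeg_eq_of_isAlgebraic_mvPolynomial (K := K) (ι := ι) (F := F))
    (σ.comp (IsScalarTower.toAlgHom K (MvPolynomial ι K) F))
    (σ.toRingHom.injective.comp (FaithfulSMul.algebraMap_injective (MvPolynomial ι K) F))
  have key (D₀ : Subalgebra K k) [IsDiscreteValuationRing D₀] [IsFractionRing D₀ k]
      (hstab : ∀ l (x : D₀), ∃ x' : D₀, D l (algebraMap D₀ F x) = algebraMap D₀ F x') :
      IsBoundedOver D₀ (T : Set F) := by
    obtain ⟨c, hc, h⟩ := E.exists_logBounded_bound D₀ k hD hstab (AlgHom.id K F) hD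
    obtain ⟨c', hc', h'⟩ := E.exists_logBounded_bound D₀ k hD hstab σ hD'
    have h₁ : IsBoundedOver D₀ {g | ∃ p, E.LogBounded p g} := ⟨c, hc, fun g ⟨p, hg⟩ => h p g hg⟩
    have h₂ : IsBoundedOver D₀ (σ '' {g | ∃ p, E.LogBounded p g}) := ⟨c', hc', by
      rintro _ ⟨g, ⟨p, hg⟩, rfl⟩
      exact h' p g hg⟩
    have h₃ : IsBoundedOver D₀ (⋃ l : ι × ι,
        (fun g => J l.1 l.2 * g) '' (σ '' {g | ∃ p, E.LogBounded p g})) :=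
      .iUnion fun l => h₂.mul_left (J l.1 l.2)
    have h₄ := (h₁.union h₃).span
    exact h₄.mono hT
  refine E.finiteDimensional (k := k) ha T (fun q hq => ?_) ?_ hgood
  · obtain ⟨_, _⟩ := isDiscreteValuationRing_localSubalgebra k hq
    exact key _ fun l x => localSubalgebra_stable hD hq l x
  · obtain ⟨_, _⟩ := isDiscreteValuationRing_infinitySubalgebra (K := K) (ι := ι) k
    exact key _ fun l x => infinitySubalgebra_stable hD l x

end Core

section LogPart

variable {K ι F : Type*} [Field K] [Field F] [Algebra K F] [Algebra (MvPolynomial ι K) F]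
  [FaithfulSMul (MvPolynomial ι K) F] {E : PrimElt (MvPolynomial ι K) F}
  {O : ValuationSubring F} {p q : MvPolynomial ι K}

omit [Algebra K F] [FaithfulSMul (MvPolynomial ι K) F] in
lemma PrimElt.IsGood.associated (hp : E.IsGood O p) (hq : E.IsGood O q) : Associated p q :=
  associated_of_dvd_dvd ((hp.lt_one q).mp hq.p_lt_one) ((hq.lt_one p).mp hp.p_lt_one)

omit [Algebra K F] in
lemma PrimElt.IsGood.pderiv_div_sub_mem (hp : E.IsGood O p) (hq : E.IsGood O q) (l : ι) :
    algebraMap _ F (MvPolynomial.pderiv l p) / algebraMap _ F p -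
      algebraMap _ F (MvPolynomial.pderiv l q) / algebraMap _ F q ∈ O := by
  obtain ⟨c, d, hcd, rfl⟩ : ∃ c d : MvPolynomial ι K, c * d = 1 ∧ q * c = p := by
    obtain ⟨c, hc⟩ := (hp.associated hq).symm
    exact ⟨c, (c⁻¹ : (MvPolynomial ι K)ˣ), Units.mul_inv c, hc⟩
  have hc : algebraMap (MvPolynomial ι K) F c * algebraMap (MvPolynomial ι K) F d = 1 := by
    rw [← map_mul, hcd, map_one]
  have hc0 := left_ne_zero_of_mul_eq_one hc
  have hq0 := hq.p_ne_zero
  have : algebraMap _ F (MvPolynomial.pderiv l (q * c)) / algebraMap _ F (q * c) -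
      algebraMap _ F (MvPolynomial.pderiv l q) / algebraMap _ F q =
      algebraMap (MvPolynomial ι K) F (MvPolynomial.pderiv l c * d) := by
    rw [Derivation.leibniz, smul_eq_mul, smul_eq_mul, map_add, map_mul, map_mul, map_mul, map_mul,
      eq_inv_of_mul_eq_one_right hc]
    field_simp
    ring
  rw [this]
  exact hp.mem _

/-- Logarithmic derivatives of a uniformizer are transported by the chain rule. -/
lemma PrimElt.IsGood.log_transport [Fintype ι] [IsScalarTower K (MvPolynomial ι K) F]
    (hO : E.IsGood O p) {σ : F →ₐ[K] F} {u : F}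
    (hu : O.valuation u = 1) (hσ : σ (algebraMap _ F q) = algebraMap _ F p * u) {l : ι}
    {D : Derivation K F F} (hD : ∀ a, D (algebraMap (MvPolynomial ι K) F a) =
      algebraMap _ F (MvPolynomial.pderiv l a))
    (hJ : ∀ m, D (σ (algebraMap (MvPolynomial ι K) F (MvPolynomial.X m))) ∈ O) {η : ι → F}
    (hη : ∀ m, η m - algebraMap _ F (MvPolynomial.pderiv m q) / algebraMap _ F q ∈
      O.comap (σ : F →+* F)) :
    ∑ m, σ (η m) * D (σ (algebraMap (MvPolynomial ι K) F (MvPolynomial.X m))) -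
      algebraMap _ F (MvPolynomial.pderiv l p) / algebraMap _ F p ∈ O := by
  have hu0 : u ≠ 0 := by
    rintro rfl
    rw [map_zero] at hu
    exact zero_ne_one hu
  have hp0 := hO.p_ne_zero
  have hsum := D.apply_algHom_eq_sum
    (σ.comp (IsScalarTower.toAlgHom K (MvPolynomial ι K) F)) q
  simp only [AlgHom.comp_apply, IsScalarTower.coe_toAlgHom'] at hsum
  have hDu : D u / u ∈ O := by
    rw [div_eq_mul_inv]
    refine O.mul_mem _ _ (hO.derivation_mem D (fun m => ?_) ?_) ?_
    · rw [hD]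
      exact hO.mem _
    · exact (O.valuation_le_one_iff _).mp hu.le
    · rw [← O.valuation_le_one_iff, map_inv₀, hu, inv_one]
  have h1 : ∑ m, σ (algebraMap _ F (MvPolynomial.pderiv m q) / algebraMap _ F q) *
      D (σ (algebraMap (MvPolynomial ι K) F (MvPolynomial.X m))) =
      algebraMap _ F (MvPolynomial.pderiv l p) / algebraMap _ F p + D u / u := by
    simp only [map_div₀, div_mul_eq_mul_div, ← Finset.sum_div]
    rw [← hsum, hσ, Derivation.leibniz, hD, smul_eq_mul, smul_eq_mul]
    field_simp
    ring
  have h2 : ∑ m, σ (η m) * D (σ (algebraMap (MvPolynomial ι K) F (MvPolynomial.X m))) -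
      algebraMap _ F (MvPolynomial.pderiv l p) / algebraMap _ F p =
      ∑ m, σ (η m - algebraMap _ F (MvPolynomial.pderiv m q) / algebraMap _ F q) *
        D (σ (algebraMap (MvPolynomial ι K) F (MvPolynomial.X m))) + D u / u := by
    simp only [map_sub, sub_mul, Finset.sum_sub_distrib]
    rw [h1]
    ring
  rw [h2]
  exact O.add_mem _ _ (O.toSubring.sum_mem fun m _ => O.mul_mem _ _ (hη m) (hJ m)) hDu

lemma PrimElt.exists_polarPart [CharZero K] [IsScalarTower K (MvPolynomial ι K) F]
    (E : PrimElt (MvPolynomial ι K) F) (Z : Set (ValuationSubring F)) (hfin : Z.Finite)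
    (hgood : ∀ O ∈ Z, ∃ p, E.IsGood O p) : ∃ η : ι → F,
    (∀ l, η l ∈ Submodule.span K {g | ∃ p, E.LogBounded p g}) ∧
    (∀ O p, E.IsGood O p → O ∉ Z → ∀ l, η l ∈ O) ∧
    (∀ O p, E.IsGood O p → O ∈ Z → ∀ l,
      η l - algebraMap _ F (MvPolynomial.pderiv l p) / algebraMap _ F p ∈ O) := by
  classical
  have h (O : ValuationSubring F) (l : ι) : ∃ G : F, O ∈ Z → (∃ p, E.LogBounded p G) ∧
      (∀ O' q, E.IsGood O' q → O' ≠ O → G ∈ O') ∧ ∀ p, E.IsGood O p →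
        G - algebraMap _ F (MvPolynomial.pderiv l p) / algebraMap _ F p ∈ O := by
    by_cases hO : O ∈ Z
    · obtain ⟨q, hq⟩ := hgood O hO
      obtain ⟨G, h1, h2, h3⟩ := hq.exists_log (Pi.single l 1)
      refine ⟨G, fun _ => ⟨⟨q, h1⟩, h2, fun p hp => ?_⟩⟩
      rw [dirDeriv_single] at h3
      rw [← sub_add_sub_cancel _ (algebraMap _ F (MvPolynomial.pderiv l q) / algebraMap _ F q)]
      exact O.add_mem _ _ h3 (hq.pderiv_div_sub_mem hp l)
    · exact ⟨0, fun h => absurd h hO⟩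
  choose G hG using h
  refine ⟨fun l => ∑ O ∈ hfin.toFinset, G O l, fun l => ?_, fun O p hO hZ l => ?_,
    fun O p hO hZ l => ?_⟩
  · exact Submodule.sum_mem _ fun O hO =>
      Submodule.subset_span (hG O l (hfin.mem_toFinset.mp hO)).1
  · refine O.toSubring.sum_mem fun O' hO' => ?_
    have hO' := hfin.mem_toFinset.mp hO'
    exact (hG O' l hO').2.1 O p hO fun h => hZ (h ▸ hO')
  · beta_reduce
    rw [← Finset.add_sum_erase _ _ (hfin.mem_toFinset.mpr hZ), add_sub_right_comm]
    refine O.add_mem _ _ ((hG O l hZ).2.2 p hO) (O.toSubring.sum_mem fun O' hO' => ?_)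
    obtain ⟨hne, hO'⟩ := Finset.mem_erase.mp hO'
    exact (hG O' l (hfin.mem_toFinset.mp hO')).2.1 O p hO hne.symm

end LogPart

section CoreTheorem

variable {K ι F : Type*} [Field K] [CharZero K] [Fintype ι] [Field F] [Algebra K F]
  [Algebra (MvPolynomial ι K) F] [FaithfulSMul (MvPolynomial ι K) F]
  [IsScalarTower K (MvPolynomial ι K) F]

omit [CharZero K] [Algebra K F] [FaithfulSMul (MvPolynomial ι K) F] [Fintype ι]
  [IsScalarTower K (MvPolynomial ι K) F] in
lemma PrimElt.IsGood.nonempty {E : PrimElt (MvPolynomial ι K) F} {O : ValuationSubring F}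
    {p : MvPolynomial ι K} (hO : E.IsGood O p) : Nonempty ι := by
  by_contra h
  rw [not_nonempty_iff] at h
  refine hO.prime.not_isUnit ?_
  rw [MvPolynomial.eq_C_of_isEmpty p]
  refine (isUnit_iff_ne_zero.mpr fun h0 => hO.prime.ne_zero ?_).map _
  rw [MvPolynomial.eq_C_of_isEmpty p, h0, map_zero]

omit [Algebra K F] [IsScalarTower K (MvPolynomial ι K) F] in
lemma PrimElt.IsGood.exists_pderiv_div_notMem {E : PrimElt (MvPolynomial ι K) F}
    {O : ValuationSubring F} {p : MvPolynomial ι K} (hO : E.IsGood O p) :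
    ∃ l, algebraMap _ F (MvPolynomial.pderiv l p) / algebraMap _ F p ∉ O := by
  obtain ⟨l, hl⟩ := exists_not_dvd_pderiv hO.prime
  refine ⟨l, fun h => hl ((hO.lt_one _).mp ?_)⟩
  rw [← div_mul_cancel₀ (algebraMap _ F (MvPolynomial.pderiv l p)) hO.p_ne_zero, map_mul]
  exact (mul_le_of_le_one_left' ((O.valuation_le_one_iff _).mpr h)).trans_lt hO.p_lt_one

/-- The span of infinitely many polar parts is infinite-dimensional. -/
lemma PrimElt.not_fg_span_of_polarParts (E : PrimElt (MvPolynomial ι K) F) {I : Type*}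
    {Z : I → Set (ValuationSubring F)} (hfin : ∀ i, (Z i).Finite)
    (hgood : ∀ i, ∀ O ∈ Z i, ∃ p, E.IsGood O p) (hinf : (⋃ i, Z i).Infinite)
    {η : I → ι → F} (h₁ : ∀ i O p, E.IsGood O p → O ∉ Z i → ∀ l, η i l ∈ O)
    (h₂ : ∀ i O p, E.IsGood O p → O ∈ Z i → ∀ l,
      η i l - algebraMap _ F (MvPolynomial.pderiv l p) / algebraMap _ F p ∈ O) :
    ¬ (Submodule.span K (Set.range η)).FG := by
  classical
  intro hfg
  obtain ⟨t, ht, hspan⟩ := Submodule.fg_span_iff_fg_span_finset_subset _ |>.mp hfg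
  have : Nonempty I := by
    obtain ⟨_, hO⟩ := hinf.nonempty
    exact (Set.mem_iUnion.mp hO).nonempty
  choose! i hi using fun x (hx : x ∈ t) => ht hx
  have hfinite : (⋃ x ∈ t, Z (i x)).Finite := t.finite_toSet.biUnion fun x _ => hfin _
  obtain ⟨O, hO, hO'⟩ := hinf.exists_notMem_finite hfinite
  obtain ⟨m, hm⟩ := Set.mem_iUnion.mp hO
  obtain ⟨p, hp⟩ := hgood m O hm
  obtain ⟨l, hl⟩ := hp.exists_pderiv_div_notMem
  apply hl
  have hη : η m l ∈ O := by
    have : η m ∈ Submodule.span K (t : Set (ι → F)) :=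
      hspan ▸ Submodule.subset_span (Set.mem_range_self m)
    generalize η m = v at this ⊢
    induction this using Submodule.span_induction with
    | mem x hx =>
      have hxO : O ∉ Z (i x) := fun h => hO' (Set.mem_biUnion (Finset.mem_coe.mpr hx) h)
      rw [← hi x hx]
      exact h₁ _ O p hp hxO l
    | zero => exact O.zero_mem
    | add x y _ _ hx hy => exact O.add_mem _ _ hx hy
    | smul c x _ hx =>
      rw [Pi.smul_apply, Algebra.smul_def, IsScalarTower.algebraMap_apply K (MvPolynomial ι K) F]
      exact O.mul_mem _ _ (hp.mem _) hx
  have := O.sub_mem hη (h₂ m O p hp hm l)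
  rwa [sub_sub_cancel] at this

/-- An endomorphism preserving infinitely many finite sets of good places fixes a nonconstant
element. -/
theorem PrimElt.exists_fixed_of_infinite [Algebra.IsAlgebraic (MvPolynomial ι K) F]
    (E : PrimElt (MvPolynomial ι K) F) (σ : F →ₐ[K] F) {I : Type*}
    (Z : I → Set (ValuationSubring F)) (hfin : ∀ i, (Z i).Finite)
    (hgood : ∀ i, ∀ O ∈ Z i, ∃ p, E.IsGood O p) (hinf : (⋃ i, Z i).Infinite)
    {a₀ : MvPolynomial ι K} (ha₀ : a₀ ≠ 0)
    (hinv : ∀ i O p, E.IsGood O p → ¬ p ∣ a₀ → (O ∈ Z i ↔ O.comap (σ : F →+* F) ∈ Z i)) :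
    ∃ g : F, σ g = g ∧ ∀ c, g ≠ algebraMap K F c := by
  classical
  by_contra! hσ
  obtain ⟨O, hO⟩ := hinf.nonempty
  obtain ⟨i₀, hi₀⟩ := Set.mem_iUnion.mp hO
  obtain ⟨p₀, hp₀⟩ := hgood i₀ O hi₀
  have := hp₀.nonempty
  obtain ⟨D, hD⟩ := exists_derivation_extending (K := K) (ι := ι) (F := F)
  choose η hspan h₁ h₂ using fun i => E.exists_polarPart (Z i) (hfin i) (hgood i)
  let J (l m : ι) : F := D l (σ (algebraMap (MvPolynomial ι K) F (MvPolynomial.X m)))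
  obtain ⟨a₂, ha₂, hcomap⟩ := E.exists_comap σ
  obtain ⟨a₃, ha₃, hJ⟩ := E.exists_forall_mem (Finset.univ.image fun l : ι × ι => J l.1 l.2)
  let Φ : (ι → F) →ₗ[K] (ι → F) := LinearMap.pi fun l =>
    ∑ m, LinearMap.mulRight K (J l m) ∘ₗ σ.toLinearMap ∘ₗ LinearMap.proj m
  have hΦ (v : ι → F) (l : ι) : Φ v l = ∑ m, σ (v m) * J l m := by
    simp [Φ, LinearMap.sum_apply]
  have hker := finite_fixed_of_semilinear (σ : F →+* F) hσ Φ fun c v => by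
    ext l
    rw [Pi.smul_apply, hΦ, hΦ, smul_eq_mul, Finset.mul_sum]
    refine Finset.sum_congr rfl fun m _ => ?_
    rw [Pi.smul_apply, smul_eq_mul, map_mul, mul_assoc]
    rfl
  let 𝒢 : Set F := {g | ∃ p, E.LogBounded p g}
  let W : Submodule K F := Submodule.span K (𝒢 ∪ ⋃ l : ι × ι, (fun g => J l.1 l.2 * g) '' (σ '' 𝒢))
  let T : Submodule K F :=
    { carrier := {ξ | ξ ∈ W ∧ ∀ (O : ValuationSubring F) (p : MvPolynomial ι K), E.IsGood O p →
        ¬ p ∣ a₀ * (a₂ * a₃) → ξ ∈ O}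
      add_mem' := fun hx hy => ⟨W.add_mem hx.1 hy.1,
        fun O p hO hp => O.add_mem _ _ (hx.2 O p hO hp) (hy.2 O p hO hp)⟩
      zero_mem' := ⟨W.zero_mem, fun O _ _ _ => O.zero_mem⟩
      smul_mem' := fun c x hx => ⟨W.smul_mem c hx.1, fun O p hO hp => by
        rw [Algebra.smul_def, IsScalarTower.algebraMap_apply K (MvPolynomial ι K) F]
        exact O.mul_mem _ _ (hO.mem _) (hx.2 O p hO hp)⟩ }
  have hT : FiniteDimensional K T := E.finiteDimensional_of_logBounded σ J
    (mul_ne_zero ha₀ (mul_ne_zero ha₂ ha₃)) T (fun ξ hξ => hξ.1) fun ξ hξ => hξ.2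
  have hσW (i : I) (l m : ι) : σ (η i m) * J l m ∈ W := by
    have := Submodule.mem_map_of_mem (f := LinearMap.mulRight K (J l m) ∘ₗ σ.toLinearMap)
      (hspan i m)
    rw [Submodule.map_span] at this
    refine Submodule.span_mono ?_ this
    rintro _ ⟨g, hg, rfl⟩
    exact .inr (Set.mem_iUnion.mpr ⟨(l, m), σ g, ⟨g, hg, rfl⟩, mul_comm _ _⟩)
  have hmem (i : I) (l : ι) : (Φ (η i) - η i) l ∈ T := by
    refine ⟨W.sub_mem ?_ (Submodule.span_mono Set.subset_union_left (hspan i l)),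
      fun O p hO hp => ?_⟩
    · rw [hΦ]
      exact W.sum_mem fun m _ => hσW i l m
    have hp₀ : ¬ p ∣ a₀ := fun h => hp (h.mul_right _)
    have hp₂ : ¬ p ∣ a₂ := fun h => hp ((h.mul_right _).mul_left _)
    have hp₃ : ¬ p ∣ a₃ := fun h => hp ((h.mul_left _).mul_left _)
    have hJO (l m : ι) : J l m ∈ O :=
      hJ _ (Finset.mem_image_of_mem (fun l : ι × ι => J l.1 l.2) (Finset.mem_univ (l, m)))
        O p hO hp₃
    rw [Pi.sub_apply, hΦ]
    by_cases hZ : O ∈ Z i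
    · have hZ' := (hinv i O p hO hp₀).mp hZ
      obtain ⟨q, hq⟩ := hgood i _ hZ'
      obtain ⟨-, h⟩ := (hcomap O p hO hp₂).resolve_left hq.ne_top
      obtain ⟨u, hu, hqu⟩ := h q hq
      have := hO.log_transport hu hqu (hD l) (hJO l) (h₂ i _ q hq hZ')
      rw [← sub_sub_sub_cancel_right _ _
        (algebraMap _ F (MvPolynomial.pderiv l p) / algebraMap _ F p)]
      exact O.sub_mem this (h₂ i O p hO hZ l)
    · have hZ' : O.comap (σ : F →+* F) ∉ Z i := fun h => hZ ((hinv i O p hO hp₀).mpr h)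
      refine O.sub_mem (O.toSubring.sum_mem fun m _ => O.mul_mem _ _ ?_ (hJO l m))
        (h₁ i O p hO hZ l)
      change η i m ∈ O.comap (σ : F →+* F)
      rcases hcomap O p hO hp₂ with htop | ⟨⟨q, hq⟩, -⟩
      · rw [htop]
        exact ValuationSubring.mem_top _
      · exact h₁ i _ q hq hZ' m
  refine E.not_fg_span_of_polarParts hfin hgood hinf h₁ h₂
    (Submodule.fg_of_fg_map_of_fg_inf_ker (Φ - LinearMap.id) ?_ ?_)
  · let R := LinearMap.range (LinearMap.pi fun l => T.subtype ∘ₗ LinearMap.proj l :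
      (ι → T) →ₗ[K] (ι → F))
    rw [Submodule.map_span, Submodule.fg_iff_finiteDimensional]
    refine Submodule.finiteDimensional_of_le (S₂ := R) (Submodule.span_le.mpr ?_)
    rintro _ ⟨_, ⟨i, rfl⟩, rfl⟩
    exact ⟨fun l => ⟨_, hmem i l⟩, rfl⟩
  · rw [Submodule.fg_iff_finiteDimensional]
    exact Submodule.finiteDimensional_of_le inf_le_right

end CoreTheorem

section ProperTransform

variable {R S : Type*} [CommRing R] [CommRing S] [IsDomain R] {I : Ideal R}

lemma IsHypersurfaceIdeal.ne_bot (hI : IsHypersurfaceIdeal I) : I ≠ ⊥ := by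
  rintro rfl
  exact (hI.2.2 ⊥ (by rw [Ideal.minimalPrimes_eq_subsingleton_self]; rfl)).2.1 rfl

variable [IsNoetherianRing S]

lemma IsHypersurfaceIdeal.properTransform_le_iff (hI : IsHypersurfaceIdeal I) {φ : R →+* S}
    (hφ : Function.Injective φ) {Q : Ideal S} [Q.IsPrime]
    (hQ : ∀ N : Ideal S, N.IsPrime → N ≠ ⊥ → N ≤ Q → N = Q) :
    properTransform φ I ≤ Q ↔ Q.comap φ ∈ I.minimalPrimes := by
  have hmap {N : Ideal S} (hN : I.map φ ≤ N) : N ≠ ⊥ := by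
    rintro rfl
    exact hI.ne_bot ((Ideal.map_eq_bot_iff_of_injective hφ).mp (le_bot_iff.mp hN))
  constructor
  · intro h
    have hfin : {N : Ideal S | N ∈ (I.map φ).minimalPrimes ∧ N.comap φ ∈ I.minimalPrimes}.Finite :=
      (Ideal.finite_minimalPrimes_of_isNoetherianRing S (I.map φ)).subset fun N hN => hN.1
    rw [properTransform, ← hfin.coe_toFinset, ← Finset.inf_id_eq_sInf,
      Ideal.IsPrime.inf_le' inferInstance] at h
    obtain ⟨N, hN, hNQ⟩ := h
    obtain ⟨h₁, h₂⟩ := hfin.mem_toFinset.mp hN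
    rwa [← hQ N h₁.1.1 (hmap h₁.1.2) hNQ]
  · intro h
    obtain ⟨N, hN, hNQ⟩ := Ideal.exists_minimalPrimes_le (Ideal.map_le_iff_le_comap.mpr h.1.2)
    obtain rfl := hQ N hN.1.1 (hmap hN.1.2) hNQ
    exact sInf_le ⟨hN, h⟩

end ProperTransform

section ExistsCenter

variable {B F : Type*} [CommRing B] [Field F]

lemma ValuationSubring.exists_center_eq {φ : B →+* F} (hφ : Function.Injective φ)
    (P : Ideal B) [P.IsPrime] :
    ∃ (O : ValuationSubring F) (h : ∀ x, φ x ∈ O), O.center φ h = P := by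
  have hunit (y : P.primeCompl) : IsUnit (φ y) :=
    isUnit_iff_ne_zero.mpr ((map_ne_zero_iff φ hφ).mpr fun h0 => y.2 (h0 ▸ P.zero_mem))
  let ψ : Localization.AtPrime P →+* F := IsLocalization.lift hunit
  have hψ (x : B) : ψ (algebraMap B _ x) = φ x := IsLocalization.lift_eq hunit x
  obtain ⟨O, hO⟩ := (LocalSubring.range ψ).exists_le_valuationSubring
  obtain ⟨hle, hloc⟩ := hO
  have hO (z : Localization.AtPrime P) : ψ z ∈ O := hle ⟨z, rfl⟩
  refine ⟨O, fun x => hψ x ▸ hO _, ?_⟩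
  ext x
  rw [ValuationSubring.mem_center, ← hψ]
  constructor
  · intro hx
    by_contra hxP
    have h1 : ψ (algebraMap B _ x) * ψ (IsLocalization.mk' _ 1 (⟨x, hxP⟩ : P.primeCompl)) = 1 := by
      rw [← map_mul, IsLocalization.mul_mk'_eq_mk'_of_mul, mul_one,
        IsLocalization.mk'_self _ (show x ∈ P.primeCompl from hxP), map_one]
    have h2 := congrArg O.valuation h1
    rw [map_mul, map_one] at h2
    have h3 := (O.valuation_le_one_iff _).mpr
      (hO (IsLocalization.mk' _ 1 (⟨x, hxP⟩ : P.primeCompl)))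
    exact (mul_lt_one_of_nonneg_of_lt_one_left zero_le hx h3).ne h2
  · intro hxP
    by_contra hx
    have h1 : O.valuation (ψ (algebraMap B _ x)) = 1 :=
      le_antisymm ((O.valuation_le_one_iff _).mpr (hO _)) (not_lt.mp hx)
    have h2 : IsUnit (Subring.inclusion hle ⟨ψ (algebraMap B _ x), _, rfl⟩) := by
      rw [isUnit_iff_exists_inv]
      refine ⟨⟨(ψ (algebraMap B _ x))⁻¹, ?_⟩, ?_⟩
      · change _ ∈ O
        rw [← O.valuation_le_one_iff, map_inv₀, h1, inv_one]
      · refine Subtype.ext (mul_inv_cancel₀ fun h0 => ?_)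
        have h0 : ψ (algebraMap B _ x) = 0 := h0
        rw [h0, map_zero] at h1
        exact zero_ne_one h1
    obtain ⟨⟨_, z, rfl⟩, hz⟩ := isUnit_iff_exists_inv.mp (hloc.map_nonunit _ h2)
    obtain ⟨b, s, rfl⟩ := IsLocalization.exists_mk'_eq P.primeCompl z
    have hz : φ x * ψ (IsLocalization.mk' _ b s) = 1 := hψ x ▸ congrArg Subtype.val hz
    have hs : ψ (IsLocalization.mk' _ b s) * φ s = φ b := by
      rw [← hψ, ← map_mul, IsLocalization.mk'_spec, hψ]
    have : x * b = s := hφ (by rw [map_mul, ← hs, ← mul_assoc, hz, one_mul])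
    exact s.2 (this ▸ P.mul_mem_right b hxP)

end ExistsCenter

section ExistsPrimElt

variable {A R F : Type*} [CommRing A] [IsDomain A] [CommRing R] [IsDomain R] [Field F]
  [Algebra A R] [FaithfulSMul A R] [Algebra R F] [IsFractionRing R F] [Algebra A F]
  [IsScalarTower A R F]

lemma exists_primElt [IsIntegrallyClosed A] [CharZero A] [Module.Finite A R] :
    ∃ (E : PrimElt A F) (r : R), E.y = algebraMap R F r := by
  have : FaithfulSMul A F := FaithfulSMul.trans A R F
  let k := FractionRing A
  let _ : Algebra k F := FractionRing.liftAlgebra _ _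
  have : IsScalarTower A k F := FractionRing.isScalarTower_liftAlgebra _ _
  have : Module.Finite k F := Module.Finite.of_isLocalization A R (nonZeroDivisors A)
  have : CharZero k := charZero_of_injective_algebraMap (IsFractionRing.injective A k)
  obtain ⟨y₀, hy₀⟩ := Field.exists_primitive_element k F
  obtain ⟨r, ⟨_, a, ha, rfl⟩, h⟩ :=
    IsLocalization.exists_mk'_eq (Algebra.algebraMapSubmonoid R (nonZeroDivisors A)) y₀
  have hr : y₀ * algebraMap A F a = algebraMap R F r := by
    rw [← h, IsScalarTower.algebraMap_apply A R F, IsLocalization.mk'_spec]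
  have ha0 : algebraMap A F a ≠ 0 :=
    (FaithfulSMul.algebraMap_eq_zero_iff A F).not.mpr (nonZeroDivisors.ne_zero ha)
  have hy : IntermediateField.adjoin k {algebraMap R F r} = ⊤ := by
    rw [eq_top_iff, ← hy₀, IntermediateField.adjoin_simple_le_iff, ← mul_div_cancel_right₀ y₀ ha0,
      hr, IsScalarTower.algebraMap_apply A k F]
    exact div_mem (IntermediateField.mem_adjoin_simple_self k _)
      (IntermediateField.algebraMap_mem _ _)
  have h_int : IsIntegral A (algebraMap R F r) :=
    (Algebra.IsIntegral.isIntegral (R := A) r).algebraMap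
  refine ⟨⟨algebraMap R F r, minpoly A _, minpoly.monic h_int, minpoly.aeval A _, ?_, fun g => ?_⟩,
    r, rfl⟩
  · have h := Polynomial.Separable.aeval_derivative_ne_zero
      (Algebra.IsSeparable.isSeparable k (algebraMap R F r))
      (minpoly.aeval k (algebraMap R F r))
    rwa [minpoly.isIntegrallyClosed_eq_field_fractions' k h_int, Polynomial.derivative_map,
      Polynomial.aeval_map_algebraMap] at h
  · have hg : g ∈ Algebra.adjoin k {algebraMap R F r} := by
      rw [← IntermediateField.adjoin_simple_toSubalgebra_of_isAlgebraic
        (h_int.tower_top (A := k)).isAlgebraic, hy]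
      trivial
    rw [Algebra.adjoin_singleton_eq_range_aeval] at hg
    obtain ⟨f, rfl⟩ := hg
    obtain ⟨b, hb, hf⟩ := IsLocalization.integerNormalization_spec (nonZeroDivisors A) f
    refine ⟨IsLocalization.integerNormalization (nonZeroDivisors A) f, b,
      nonZeroDivisors.ne_zero hb, ?_⟩
    rw [← Polynomial.aeval_map_algebraMap k, hf, ← algebraMap_smul k b f, map_smul, algebraMap_smul,
      Algebra.smul_def,
      mul_comm]
    rfl

variable [UniqueFactorizationMonoid A] [Algebra.IsIntegral A R]

omit [IsFractionRing R F] in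
lemma PrimElt.isGood_of_center (E : PrimElt A F) {d : R}
    (hd : Polynomial.aeval E.y (Polynomial.derivative E.f) = algebraMap R F d)
    {O : ValuationSubring F} (hO : ∀ x, algebraMap R F x ∈ O)
    (hd' : d ∉ O.center (algebraMap R F) hO) (hne : O.center (algebraMap R F) hO ≠ ⊥)
    (hP : ∀ N : Ideal R, N.IsPrime → N ≠ ⊥ → N ≤ O.center (algebraMap R F) hO →
      N = O.center (algebraMap R F) hO) : ∃ p, E.IsGood O p := by
  obtain ⟨x, hx, hx0⟩ := Submodule.exists_mem_ne_zero_of_ne_bot hne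
  have hcomap := Ideal.comap_ne_bot_of_integral_mem hx0 hx
    (Algebra.IsIntegral.isIntegral (R := A) x)
  obtain ⟨p, hp, hprime⟩ := Ideal.IsPrime.exists_mem_prime_of_ne_bot
    (Ideal.comap_isPrime (algebraMap A R) (O.center (algebraMap R F) hO)) hcomap
  have hA (a : A) : algebraMap A F a ∈ O := IsScalarTower.algebraMap_apply A R F a ▸ hO _
  refine ⟨p, hprime, hA, fun a => ?_, ?_⟩
  · rw [IsScalarTower.algebraMap_apply A R F]
    constructor
    · exact fun ha => dvd_of_algebraMap_mem hprime _ hP hp a ha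
    · rintro ⟨c, rfl⟩
      rw [map_mul]
      exact Ideal.mul_mem_right (I := O.center (algebraMap R F) hO) _ hp
  · rw [hd]
    exact le_antisymm ((O.valuation_le_one_iff _).mpr (hO d)) (not_lt.mp hd')

omit [IsFractionRing R F] [FaithfulSMul A R] [IsDomain R] [UniqueFactorizationMonoid A]
  [IsDomain A] in
lemma PrimElt.IsGood.algebraMap_mem {E : PrimElt A F} {O : ValuationSubring F} {p : A}
    (hO : E.IsGood O p) (x : R) : algebraMap R F x ∈ O := by
  obtain ⟨f, hf, hx⟩ := (Algebra.IsIntegral.isIntegral (R := A) x).algebraMap (B := F)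
  exact O.mem_of_isIntegral_eval₂ (algebraMap A F) hO.mem hf hx

end ExistsPrimElt

lemma HeightOnePrime.eq_of_le {R : Type*} [CommRing R] {P : Ideal R} (hP : HeightOnePrime P)
    (N : Ideal R) (hN : N.IsPrime) (hN0 : N ≠ ⊥) (hNP : N ≤ P) : N = P :=
  hNP.eq_or_lt.resolve_right fun h => hN0 (hP.2.2 N hN h)

section PlacesOver

variable {A R F : Type*} [CommRing A] [CommRing R] [Field F] [Algebra A F] [Algebra R F]

/-- The good places whose center on `R` is a minimal prime of `I`. -/
def PrimElt.placesOver (E : PrimElt A F) (I : Ideal R) : Set (ValuationSubring F) :=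
  {O | (∃ p, E.IsGood O p) ∧
    ∃ h : ∀ x, algebraMap R F x ∈ O, O.center (algebraMap R F) h ∈ I.minimalPrimes}

variable [IsDomain A] [UniqueFactorizationMonoid A] [FaithfulSMul A F] [Algebra A R]
  [IsScalarTower A R F] [IsNoetherianRing R]

lemma PrimElt.finite_placesOver (E : PrimElt A F) {r : R} (hr : E.y = algebraMap R F r)
    (I : Ideal R) : (E.placesOver I).Finite := by
  let c (O : ValuationSubring F) : Set R := {x | O.valuation (algebraMap R F x) < 1}
  refine Set.Finite.of_finite_image (f := c)
    (((I.finite_minimalPrimes_of_isNoetherianRing R).image SetLike.coe).subset ?_) ?_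
  · rintro _ ⟨O, ⟨-, h, hO⟩, rfl⟩
    exact ⟨_, hO, rfl⟩
  · rintro O ⟨⟨p, hp⟩, -⟩ O' ⟨⟨p', hp'⟩, -⟩ h
    refine hp.eq_of_center hp' fun a => ?_
    rw [hr, Polynomial.aeval_algebraMap_apply]
    exact Set.ext_iff.mp h (Polynomial.aeval r a)

variable [IsDomain R] [FaithfulSMul A R] [FaithfulSMul R F] [Algebra.IsIntegral A R]

omit [FaithfulSMul A F] in
lemma PrimElt.infinite_iUnion_placesOver (E : PrimElt A F) {r : R} (hr : E.y = algebraMap R F r)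
    {𝓘 : Set (Ideal R)} (h𝓘 : ∀ I ∈ 𝓘, IsHypersurfaceIdeal I) (hinf : 𝓘.Infinite) :
    (⋃ I : 𝓘, E.placesOver (I : Ideal R)).Infinite := by
  intro hfin
  let d : R := Polynomial.aeval r (Polynomial.derivative E.f)
  have hd : Polynomial.aeval E.y (Polynomial.derivative E.f) = algebraMap R F d := by
    rw [hr, Polynomial.aeval_algebraMap_apply]
  have hd0 : d ≠ 0 := fun h => E.sep (by rw [hd, h, map_zero])
  let c (O : ValuationSubring F) : Set R := {x | O.valuation (algebraMap R F x) < 1}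
  let 𝒬 : Set (Ideal R) := SetLike.coe ⁻¹' (c '' ⋃ I : 𝓘, E.placesOver (I : Ideal R)) ∪
    (Ideal.span {d}).minimalPrimes
  have h𝒬 : 𝒬.Finite := ((hfin.image c).preimage SetLike.coe_injective.injOn).union
    (Ideal.finite_minimalPrimes_of_isNoetherianRing R _)
  refine hinf ((h𝒬.powerset.image sInf).subset fun I hI => ?_)
  refine ⟨I.minimalPrimes, fun P hP => ?_, by
    rw [Ideal.sInf_minimalPrimes, (h𝓘 I hI).1.radical]⟩
  have hht := (h𝓘 I hI).2.2 P hP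
  have := hht.1
  by_cases hdP : d ∈ P
  · refine .inr ⟨⟨this, (Ideal.span_singleton_le_iff_mem _).mpr hdP⟩, fun N hN hNP => ?_⟩
    have hN0 : N ≠ ⊥ := by
      rintro rfl
      exact hd0 ((Ideal.span_singleton_le_iff_mem _).mp hN.2)
    exact (hht.eq_of_le N hN.1 hN0 hNP).ge
  · obtain ⟨O, hO, rfl⟩ := ValuationSubring.exists_center_eq
      (FaithfulSMul.algebraMap_injective R F) P
    exact .inl ⟨O, Set.mem_iUnion.mpr ⟨⟨I, hI⟩,
      E.isGood_of_center hd hO hdP hht.2.1 hht.eq_of_le, hO, hP⟩, rfl⟩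

end PlacesOver

section Invariance

variable {K ι R S F : Type*} [Field K] [CharZero K] [Fintype ι] [CommRing R] [CommRing S]
  [Field F] [Algebra K F] [Algebra (MvPolynomial ι K) F] [FaithfulSMul (MvPolynomial ι K) F]
  [IsScalarTower K (MvPolynomial ι K) F] [Algebra.IsAlgebraic (MvPolynomial ι K) F]
  [Algebra (MvPolynomial ι K) R] [Algebra.IsIntegral (MvPolynomial ι K) R]
  [Algebra R F] [IsScalarTower (MvPolynomial ι K) R F] [Algebra K S] [Algebra.FiniteType K S]
  [Algebra S F] [IsScalarTower K S F] [FaithfulSMul S F]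

omit [CharZero K] [Fintype ι] [Algebra.IsAlgebraic (MvPolynomial ι K) F]
  [Algebra.IsIntegral (MvPolynomial ι K) R] [Algebra K F] [IsScalarTower K (MvPolynomial ι K) F]
  [Algebra K S] [Algebra.FiniteType K S] [IsScalarTower K S F] in
lemma PrimElt.IsGood.eq_center_of_le {E : PrimElt (MvPolynomial ι K) F} {r : R}
    (hr : E.y = algebraMap R F r) {j : R →+* S} (hj : ∀ x, algebraMap S F (j x) = algebraMap R F x)
    {O : ValuationSubring F} {p : MvPolynomial ι K} (hO : E.IsGood O p)
    (hS : ∀ x, algebraMap S F x ∈ O) (N : Ideal S) (hN : N.IsPrime) (hN0 : N ≠ ⊥)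
    (hle : N ≤ O.center (algebraMap S F) hS) : N = O.center (algebraMap S F) hS := by
  have hinj := FaithfulSMul.algebraMap_injective S F
  let e : S ≃+* (algebraMap S F).range := RingEquiv.ofBijective (algebraMap S F).rangeRestrict
    ⟨fun x y h => hinj (congrArg Subtype.val h), (algebraMap S F).rangeRestrict_surjective⟩
  have hpoly (a : Polynomial (MvPolynomial ι K)) :
      Polynomial.aeval E.y a ∈ (algebraMap S F).range :=
    ⟨j (Polynomial.aeval r a), by rw [hj, hr, Polynomial.aeval_algebraMap_apply]⟩
  have := Ideal.comap_isPrime (e.symm : (algebraMap S F).range →+* S) N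
  have hval (z : (algebraMap S F).range) : algebraMap S F (e.symm z) = z :=
    congrArg Subtype.val (e.apply_symm_apply z)
  have key := hO.eq_bot_of_lt_center (algebraMap S F).range
    (by rintro _ ⟨x, rfl⟩; exact hS x)
    (fun g hg => by
      obtain ⟨h, b, hb, hg⟩ := hO.exists_frac hg
      exact ⟨_, hpoly b, hb, by rw [mul_comm, hg]; exact hpoly h⟩)
    (N.comap (e.symm : (algebraMap S F).range →+* S))
    (fun x hx => hval x ▸ hle hx)
    (fun h => hN0 (by
      rw [eq_bot_iff]
      intro x hx
      have hx' : e x ∈ N.comap (e.symm : (algebraMap S F).range →+* S) := by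
        change e.symm (e x) ∈ N
        rwa [e.symm_apply_apply]
      rw [h, Ideal.mem_bot, map_eq_zero_iff _ e.injective] at hx'
      exact hx'))
  refine le_antisymm hle fun x hx => ?_
  have := key (e x) hx
  change e.symm (e x) ∈ N at this
  rwa [e.symm_apply_apply] at this

variable [IsDomain R] [FaithfulSMul R F]

/-- Total invariance of a hypersurface in terms of the places lying over it. -/
lemma PrimElt.exists_mem_placesOver_iff (E : PrimElt (MvPolynomial ι K) F) {r : R}
    (hr : E.y = algebraMap R F r) {j f : R →+* S}
    (hj : ∀ x, algebraMap S F (j x) = algebraMap R F x) (hf : Function.Injective f)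
    (σ : F →ₐ[K] F) (hσ : ∀ x, σ (algebraMap R F x) = algebraMap S F (f x)) :
    ∃ a : MvPolynomial ι K, a ≠ 0 ∧ ∀ I : Ideal R, IsHypersurfaceIdeal I →
      properTransform f I = properTransform j I →
      ∀ (O : ValuationSubring F) (p : MvPolynomial ι K), E.IsGood O p → ¬ p ∣ a →
        (O ∈ E.placesOver I ↔ O.comap (σ : F →+* F) ∈ E.placesOver I) := by
  classical
  obtain ⟨t, ht⟩ := Algebra.FiniteType.out (R := K) (A := S)
  have : IsNoetherianRing S := Algebra.FiniteType.isNoetherianRing K S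
  obtain ⟨a₁, ha₁, h₁⟩ := E.exists_forall_mem (t.image (algebraMap S F))
  obtain ⟨a₂, ha₂, h₂⟩ := E.exists_comap σ
  refine ⟨a₁ * a₂, mul_ne_zero ha₁ ha₂, fun I hI hinv O p hO hp => ?_⟩
  have hS (x : S) : algebraMap S F x ∈ O := by
    have hx : x ∈ Algebra.adjoin K (t : Set S) := ht ▸ trivial
    induction hx using Algebra.adjoin_induction with
    | mem x hx => exact h₁ _ (Finset.mem_image_of_mem _ hx) O p hO fun h => hp (h.mul_right _)
    | algebraMap c =>
      rw [← IsScalarTower.algebraMap_apply, IsScalarTower.algebraMap_apply K (MvPolynomial ι K) F]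
      exact hO.mem _
    | add x y _ _ hx hy => rw [map_add]; exact O.add_mem _ _ hx hy
    | mul x y _ _ hx hy => rw [map_mul]; exact O.mul_mem _ _ hx hy
  have hjinj : Function.Injective j := fun x y h =>
    FaithfulSMul.algebraMap_injective R F (by rw [← hj, ← hj, h])
  have hmin := hO.eq_center_of_le hr hj hS
  have hR := hO.algebraMap_mem (R := R)
  have hcj : O.center (algebraMap R F) hR = (O.center (algebraMap S F) hS).comap j := by
    ext x
    rw [Ideal.mem_comap, ValuationSubring.mem_center, ValuationSubring.mem_center, hj]
  have hiff := (hI.properTransform_le_iff hjinj hmin).symm.trans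
    (hinv ▸ hI.properTransform_le_iff hf hmin)
  have hR' (x : R) : algebraMap R F x ∈ O.comap (σ : F →+* F) := by
    change σ _ ∈ O
    rw [hσ]
    exact hS _
  have hcf : (O.comap (σ : F →+* F)).center (algebraMap R F) hR' =
      (O.center (algebraMap S F) hS).comap f := by
    ext x
    rw [Ideal.mem_comap, ValuationSubring.mem_center, ValuationSubring.mem_center, ← hσ]
    exact (ValuationSubring.valuation_map_lt_one_iff (fun _ => Iff.rfl) _).symm
  constructor
  · rintro ⟨-, h, hOI⟩
    rw [hcj, hiff, ← hcf] at hOI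
    refine ⟨?_, hR', hOI⟩
    refine ((h₂ O p hO fun h => hp (h.mul_left _)).resolve_left fun htop => ?_).1
    apply (hI.2.2 _ hOI).2.1
    rw [eq_bot_iff]
    intro x hx
    rw [ValuationSubring.mem_center] at hx
    rw [Ideal.mem_bot]
    refine (FaithfulSMul.algebraMap_eq_zero_iff R F).mp ?_
    refine ((ValuationSubring.valuation_lt_one_iff_inv _ _).mp hx).resolve_right fun h => h ?_
    exact htop ▸ ValuationSubring.mem_top _
  · rintro ⟨-, h, hOI⟩
    rw [hcf, ← hiff, ← hcj] at hOI
    exact ⟨⟨p, hO⟩, hR, hOI⟩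

end Invariance

section FunctionField

variable {K R S F : Type*} [Field K] [CharZero K] [CommRing R] [IsDomain R] [Algebra K R]
  [Algebra.FiniteType K R] [CommRing S] [Algebra K S] [Algebra.FiniteType K S] [Field F]
  [Algebra R F] [IsFractionRing R F] [Algebra S F] [FaithfulSMul S F] [Algebra K F]
  [IsScalarTower K R F] [IsScalarTower K S F]

lemma exists_fixed_of_infinite_properTransform {j f : R →+* S}
    (hj : ∀ x, algebraMap S F (j x) = algebraMap R F x) (hf : Function.Injective f)
    (σ : F →ₐ[K] F) (hσ : ∀ x, σ (algebraMap R F x) = algebraMap S F (f x))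
    (hinv : {I : Ideal R | IsHypersurfaceIdeal I ∧
      properTransform f I = properTransform j I}.Infinite) :
    ∃ g : F, σ g = g ∧ ∀ c, g ≠ algebraMap K F c := by
  obtain ⟨n, φ, hφ, hfin⟩ := exists_finite_inj_algHom_of_fg K R
  let _ : Algebra (MvPolynomial (Fin n) K) R := φ.toAlgebra
  let _ : Algebra (MvPolynomial (Fin n) K) F :=
    ((algebraMap R F).comp (φ : MvPolynomial (Fin n) K →+* R)).toAlgebra
  have : IsScalarTower (MvPolynomial (Fin n) K) R F := IsScalarTower.of_algebraMap_eq fun _ => rfl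
  have : IsScalarTower K (MvPolynomial (Fin n) K) F := IsScalarTower.of_algebraMap_eq fun x => by
    rw [IsScalarTower.algebraMap_apply K R F, ← φ.commutes]
    rfl
  have : Module.Finite (MvPolynomial (Fin n) K) R := hfin
  have : FaithfulSMul (MvPolynomial (Fin n) K) R :=
    (faithfulSMul_iff_algebraMap_injective _ _).mpr hφ
  have : FaithfulSMul (MvPolynomial (Fin n) K) F := FaithfulSMul.trans _ R F
  have : Algebra.IsAlgebraic R F :=
    ⟨fun x => (IsFractionRing.isAlgebraic_iff R F F).mpr (isAlgebraic_algebraMap x)⟩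
  have : Algebra.IsAlgebraic (MvPolynomial (Fin n) K) F := Algebra.IsAlgebraic.trans _ R F
  have : IsNoetherianRing R := Algebra.FiniteType.isNoetherianRing K R
  obtain ⟨E, r, hr⟩ := exists_primElt (A := MvPolynomial (Fin n) K) (R := R) (F := F)
  obtain ⟨a, ha, h⟩ := E.exists_mem_placesOver_iff hr hj hf σ hσ
  exact E.exists_fixed_of_infinite σ (fun I : {I : Ideal R | IsHypersurfaceIdeal I ∧
      properTransform f I = properTransform j I} => E.placesOver (I : Ideal R))
    (fun I => E.finite_placesOver hr I) (fun I O hO => hO.1)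
    (E.infinite_iUnion_placesOver hr (fun I hI => hI.1) hinv) ha
    fun I => h I I.2.1 I.2.2

end FunctionField

/-- **Cantat's theorem.** If a rational dynamical system `(X, φ)` over an algebraically
closed field of characteristic zero has infinitely many totally invariant hypersurfaces
(`φ*H = H`), then `φ` preserves a nonconstant rational function: there is
`g ∈ K(X) \ K` with `g∘φ = g`. -/
theorem cantat
    (K : Type*) [Field K] [IsAlgClosed K] [CharZero K]
    (R : Type*) [CommRing R] [IsDomain R] [Algebra K R] [Algebra.FiniteType K R]
    (S : Type*) [CommRing S] [IsDomain S] [Algebra K S] [Algebra.FiniteType K S]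
    -- `j` models the inclusion of a dense affine open `V ⊆ X` (a birational embedding)
    (j : R →ₐ[K] S) (hj : Function.Injective j)
    (hbir : ∀ s : S, ∃ a b : R, b ≠ 0 ∧ s * j b = j a)
    -- `f` models the restriction `φ|_V : V → X` of the dominant rational self-map `φ`
    (f : R →ₐ[K] S) (hdom : Function.Injective f)
    (hinv : {I : Ideal R | IsHypersurfaceIdeal I ∧
        properTransform (f : R →+* S) I = properTransform (j : R →+* S) I}.Infinite) :
    ∃ a b : R, b ≠ 0 ∧ (∀ c : K, a ≠ algebraMap K R c * b) ∧
      f a * j b = j a * f b := by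
  let F := FractionRing S
  let _ : Algebra R F := ((algebraMap S F).comp (j : R →+* S)).toAlgebra
  have hjF (x : R) : algebraMap S F (j x) = algebraMap R F x := rfl
  have hS : Function.Injective (algebraMap S F) := IsFractionRing.injective S F
  have hR : Function.Injective (algebraMap R F) := hS.comp hj
  have : IsScalarTower K R F := IsScalarTower.of_algebraMap_eq fun x => by
    rw [← hjF, j.commutes, ← IsScalarTower.algebraMap_apply]
  have : FaithfulSMul R F := (faithfulSMul_iff_algebraMap_injective _ _).mpr hR
  have : IsFractionRing R F := by
    refine IsFractionRing.of_field R F fun z => ?_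
    obtain ⟨s, t, ht, rfl⟩ := IsFractionRing.div_surjective (A := S) z
    obtain ⟨a, b, hb, hab⟩ := hbir s
    obtain ⟨c, d, hd, hcd⟩ := hbir t
    have ht0 := (map_ne_zero_iff _ hS).mpr (nonZeroDivisors.ne_zero ht)
    have hbF := (map_ne_zero_iff _ hR).mpr hb
    have hdF := (map_ne_zero_iff _ hR).mpr hd
    have hab' : algebraMap S F s * algebraMap R F b = algebraMap R F a := by
      rw [← hjF, ← hjF, ← map_mul, hab]
    have hcd' : algebraMap S F t * algebraMap R F d = algebraMap R F c := by
      rw [← hjF, ← hjF, ← map_mul, hcd]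
    refine ⟨a * d, b * c, ?_⟩
    rw [map_mul, map_mul, ← hab', ← hcd']
    rw [div_eq_div_iff ht0 (mul_ne_zero hbF (mul_ne_zero ht0 hdF))]
    ring
  have hfF : Function.Injective ((Algebra.algHom K S F).comp f) := hS.comp hdom
  let σ : F →ₐ[K] F := IsFractionRing.liftAlgHom hfF
  have hσ (x : R) : σ (algebraMap R F x) = algebraMap S F (f x) :=
    IsFractionRing.lift_algebraMap hfF x
  obtain ⟨g, hg, hgK⟩ := exists_fixed_of_infinite_properTransform (R := R) (j := (j : R →+* S))
    (f := (f : R →+* S)) hjF hdom σ hσ hinv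
  obtain ⟨a, b, hb, rfl⟩ := IsFractionRing.div_surjective (A := R) g
  have hb0 := nonZeroDivisors.ne_zero hb
  have hbF := (map_ne_zero_iff _ hR).mpr hb0
  refine ⟨a, b, hb0, ?_, hS ?_⟩
  · rintro c rfl
    refine hgK c ?_
    rw [map_mul, mul_div_cancel_right₀ _ hbF, ← IsScalarTower.algebraMap_apply]
  · rw [map_div₀, div_eq_div_iff ((map_ne_zero σ).mpr hbF) hbF, hσ, hσ, ← hjF, ← hjF] at hg
    rwa [map_mul, map_mul]
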